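/- The fourth homotopy group π₄(S², N) of the 2-sphere is isomorphic, as a group, to ℤ/2ℤ. -/

import Mathlib

open scoped unitInterval Topology Topology.Homotopy
open Set

set_option linter.unusedSectionVars false
noncomputable section
namespace Pi4

/-! ### M1 : functoriality and representatives -/

section Functor
variable {N M : Type*} [DecidableEq N] [Nonempty N] [DecidableEq M] [Nonempty M]
variable {X Y Z : Type*} [TopologicalSpace X] [TopologicalSpace Y] [TopologicalSpace Z]
variable {x : X} {y : Y} {z : Z}

/-- class of a loop -/
def cls (p : GenLoop N X x) : HomotopyGroup N X x := Quotient.mk _ p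

theorem cls_eq {p q : GenLoop N X x} : cls p = cls q ↔ GenLoop.Homotopic p q := Quotient.eq

theorem cls_surj (a : HomotopyGroup N X x) : ∃ p, cls p = a := Quotient.exists_rep a

theorem cls_mul (i : N) (p q : GenLoop N X x) :
    cls p * cls q = cls (GenLoop.transAt i q p) := HomotopyGroup.mul_spec

theorem cls_inv (i : N) (p : GenLoop N X x) :
    (cls p)⁻¹ = cls (GenLoop.symmAt i p) := HomotopyGroup.inv_spec

theorem cls_const : cls (GenLoop.const : GenLoop N X x) = 1 := rfl

/-- build a homomorphism of homotopy groups from a function on loops -/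
def homOf (Φ : GenLoop N X x → GenLoop M Y y)
    (hΦ : ∀ p q, GenLoop.Homotopic p q → GenLoop.Homotopic (Φ p) (Φ q)) (i : N) (j : M)
    (ht : ∀ p q, Φ (GenLoop.transAt i p q) = GenLoop.transAt j (Φ p) (Φ q)) :
    HomotopyGroup N X x →* HomotopyGroup M Y y :=
  MonoidHom.mk' (Quotient.map Φ hΦ) (by
    intro a b
    obtain ⟨p, rfl⟩ := cls_surj a
    obtain ⟨q, rfl⟩ := cls_surj b
    rw [cls_mul i]
    change cls (Φ _) = cls (Φ p) * cls (Φ q)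
    rw [cls_mul j, ht])

theorem homOf_cls (Φ : GenLoop N X x → GenLoop M Y y) (hΦ) (i : N) (j : M) (ht) (p) :
    homOf Φ hΦ i j ht (cls p) = cls (Φ p) := rfl

/-- postcomposition on loops -/
def gmap (f : C(X, Y)) (h : f x = y) (p : GenLoop N X x) : GenLoop N Y y :=
  ⟨f.comp p.1, fun t ht => by
    simp only [ContinuousMap.comp_apply]
    rw [p.2 t ht, h]⟩

theorem gmap_apply (f : C(X, Y)) (h : f x = y) (p : GenLoop N X x) (t) :
    gmap f h p t = f (p t) := rfl

theorem gmap_homotopic (f : C(X, Y)) (h : f x = y) (p q : GenLoop N X x)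
    (H : GenLoop.Homotopic p q) : GenLoop.Homotopic (gmap f h p) (gmap f h q) :=
  ContinuousMap.HomotopicRel.comp_continuousMap H f

/-- induced map on homotopy groups -/
def pimap (f : C(X, Y)) (h : f x = y) : HomotopyGroup N X x →* HomotopyGroup N Y y :=
  homOf (gmap f h) (gmap_homotopic f h) (Classical.arbitrary N) (Classical.arbitrary N) (by
    intro p q
    ext t
    simp only [gmap_apply, GenLoop.transAt, GenLoop.coe_copy]
    split_ifs <;> rfl)

theorem pimap_cls (f : C(X, Y)) (h : f x = y) (p : GenLoop N X x) :
    pimap f h (cls p) = cls (gmap f h p) := rfl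

theorem pimap_comp (f : C(X, Y)) (h : f x = y) (g : C(Y, Z)) (h' : g y = z)
    (a : HomotopyGroup N X x) :
    pimap g h' (pimap f h a) = pimap (g.comp f) (by simp [h, h']) a := by
  obtain ⟨p, rfl⟩ := cls_surj a
  rfl

/-- maps homotopic through based maps induce the same homomorphism -/
theorem pimap_congr (f g : C(X, Y)) (h : f x = y) (h' : g x = y)
    (H : C(I × X, Y)) (h0 : ∀ v, H (0, v) = f v) (h1 : ∀ v, H (1, v) = g v)
    (hx : ∀ u, H (u, x) = y) (a : HomotopyGroup N X x) :
    pimap f h a = pimap g h' a := by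
  obtain ⟨p, rfl⟩ := cls_surj a
  rw [pimap_cls, pimap_cls, cls_eq]
  refine ⟨⟨⟨⟨fun w => H (w.1, p w.2), by
    have := p.1.continuous
    have : Continuous (fun w : I × (N → I) => p w.2) := this.comp continuous_snd
    fun_prop⟩, fun t => ?_, fun t => ?_⟩, fun u t ht => ?_⟩⟩
  · simp [h0]; rfl
  · simp [h1]; rfl
  · have e : p t = x := p.2 t ht
    simp only [ContinuousMap.coe_mk]
    rw [e, hx]
    exact ((gmap f h p).2 t ht).symm
end Functor

/-- punctured space -/
abbrev P (E : Type*) [Zero E] := {v : E // v ≠ 0}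

/-- the cube in real coordinates -/
def Q (k : ℕ) : Set (Fin k → ℝ) := {y | ∀ i, 0 ≤ y i ∧ y i ≤ 1}

def clamp {k : ℕ} (y : Fin k → ℝ) : Fin k → I := fun i => Set.projIcc 0 1 zero_le_one (y i)

theorem continuous_clamp {k : ℕ} : Continuous (clamp : (Fin k → ℝ) → _) := by
  unfold clamp
  exact continuous_pi fun i => continuous_projIcc.comp (continuous_apply i)

theorem clamp_coe {k : ℕ} (y : Fin k → I) : clamp (fun i => (y i : ℝ)) = y := by
  funext i
  simp [clamp]

theorem coe_mem_Q {k : ℕ} (y : Fin k → I) : (fun i => (y i : ℝ)) ∈ Q k :=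
  fun i => ⟨(y i).2.1, (y i).2.2⟩

theorem clamp_val {k : ℕ} {y : Fin k → ℝ} (hy : y ∈ Q k) : (fun i => (clamp y i : ℝ)) = y := by
  funext i
  simp only [clamp]
  rw [Set.projIcc_of_mem zero_le_one (hy i)]

section Rep
variable {k : ℕ} {E : Type*} [TopologicalSpace E] [Zero E] {n : P E}

/-- extension of a loop to all of `ℝ^k` -/
def ext (p : GenLoop (Fin k) (P E) n) (y : Fin k → ℝ) : E := (p (clamp y)).1

theorem ext_cont (p : GenLoop (Fin k) (P E) n) : Continuous (ext p) :=
  continuous_subtype_val.comp (p.1.continuous.comp continuous_clamp)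

theorem ext_ne (p : GenLoop (Fin k) (P E) n) (y) : ext p y ≠ 0 := (p (clamp y)).2

theorem clamp_bd {y : Fin k → ℝ} (h : ∃ i, y i ≤ 0 ∨ 1 ≤ y i) : clamp y ∈ Cube.boundary (Fin k) := by
  obtain ⟨i, h | h⟩ := h
  · exact ⟨i, Or.inl (Set.projIcc_of_le_left _ h)⟩
  · exact ⟨i, Or.inr (Set.projIcc_of_right_le _ h)⟩

theorem ext_bd (p : GenLoop (Fin k) (P E) n) {y} (h : ∃ i, y i ≤ 0 ∨ 1 ≤ y i) :
    ext p y = n.1 := by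
  unfold ext
  rw [GenLoop.boundary p _ (clamp_bd h)]

theorem ext_coe (p : GenLoop (Fin k) (P E) n) (y : Fin k → I) :
    ext p (fun i => (y i : ℝ)) = (p y).1 := by
  unfold ext; rw [clamp_coe]

/-- loop from a function on `ℝ^k` -/
def mk (n : P E) (f : (Fin k → ℝ) → E) (hc : Continuous f) (h0 : ∀ y ∈ Q k, f y ≠ 0)
    (hb : ∀ y ∈ Q k, (∃ i, y i = 0 ∨ y i = 1) → f y = n.1) : GenLoop (Fin k) (P E) n :=
  ⟨⟨fun y => ⟨f (fun i => (y i : ℝ)), h0 _ (coe_mem_Q y)⟩, by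
    apply Continuous.subtype_mk
    apply hc.comp
    fun_prop⟩, by
    rintro y ⟨i, hi⟩
    apply Subtype.ext
    apply hb _ (coe_mem_Q y)
    refine ⟨i, ?_⟩
    rcases hi with hi | hi
    · left; simp [hi]
    · right; simp [hi]⟩

theorem mk_apply (n : P E) (f : (Fin k → ℝ) → E) (hc h0 hb) (y : Fin k → I) :
    (mk n f hc h0 hb y).1 = f (fun i => (y i : ℝ)) := rfl

theorem ext_mk (n : P E) (f : (Fin k → ℝ) → E) (hc h0 hb) {y : Fin k → ℝ} (hy : y ∈ Q k) :
    ext (mk n f hc h0 hb) y = f y := by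
  unfold ext; rw [mk_apply, clamp_val hy]

/-- homotopy from a formula -/
theorem homotopic_of {p q : GenLoop (Fin k) (P E) n} (H : ℝ → (Fin k → ℝ) → E)
    (hc : Continuous (fun w : ℝ × (Fin k → ℝ) => H w.1 w.2))
    (h0 : ∀ u ∈ Set.Icc (0:ℝ) 1, ∀ y ∈ Q k, H u y ≠ 0)
    (hb : ∀ u ∈ Set.Icc (0:ℝ) 1, ∀ y ∈ Q k, (∃ i, y i = 0 ∨ y i = 1) → H u y = n.1)
    (e0 : ∀ y ∈ Q k, H 0 y = ext p y) (e1 : ∀ y ∈ Q k, H 1 y = ext q y) :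
    GenLoop.Homotopic p q := by
  refine ⟨⟨⟨⟨fun w => ⟨H w.1 (fun i => (w.2 i : ℝ)), h0 _ w.1.2 _ (coe_mem_Q _)⟩, ?_⟩,
    fun t => ?_, fun t => ?_⟩, fun u t ht => ?_⟩⟩
  · apply Continuous.subtype_mk
    apply hc.comp (f := fun w : I × (Fin k → I) => ((w.1 : ℝ), fun i => (w.2 i : ℝ)))
    fun_prop
  · apply Subtype.ext
    simpa [ext_coe] using e0 _ (coe_mem_Q t)
  · apply Subtype.ext
    simpa [ext_coe] using e1 _ (coe_mem_Q t)
  · apply Subtype.ext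
    have e : p t = n := p.2 t ht
    change _ = (p t).1
    rw [e]
    apply hb _ u.2 _ (coe_mem_Q t)
    obtain ⟨i, hi⟩ := ht
    refine ⟨i, ?_⟩
    rcases hi with hi | hi
    · left; simp [hi]
    · right; simp [hi]

theorem homotopic_ext {p q : GenLoop (Fin k) (P E) n} (h : GenLoop.Homotopic p q) :
    ∃ H : ℝ → (Fin k → ℝ) → E,
      Continuous (fun w : ℝ × (Fin k → ℝ) => H w.1 w.2) ∧ (∀ u y, H u y ≠ 0) ∧
      (∀ u y, (∃ i, y i ≤ 0 ∨ 1 ≤ y i) → H u y = n.1) ∧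
      (∀ u ≤ 0, ∀ y, H u y = ext p y) ∧ (∀ u, 1 ≤ u → ∀ y, H u y = ext q y) := by
  obtain ⟨K⟩ := h
  refine ⟨fun u y => (K (Set.projIcc 0 1 zero_le_one u, clamp y)).1, ?_, ?_, ?_, ?_, ?_⟩
  · apply continuous_subtype_val.comp
    apply K.continuous.comp
    exact (continuous_projIcc.comp continuous_fst).prodMk (continuous_clamp.comp continuous_snd)
  · intro u y
    exact (K _).2
  · intro u y hy
    have := K.eq_fst (Set.projIcc 0 1 zero_le_one u) (clamp_bd hy)
    simp only
    rw [this]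
    have e : p (clamp y) = n := p.2 _ (clamp_bd hy)
    change (p (clamp y)).1 = _
    rw [e]
  · intro u hu y
    simp only
    rw [Set.projIcc_of_le_left _ hu]
    have := K.apply_zero (clamp y)
    change (K (0, clamp y)).1 = (p (clamp y)).1
    rw [this]; rfl
  · intro u hu y
    simp only
    rw [Set.projIcc_of_right_le _ hu]
    have := K.apply_one (clamp y)
    change (K (1, clamp y)).1 = (q (clamp y)).1
    rw [this]; rfl

end Rep
end Pi4
end

open scoped unitInterval Topology Topology.Homotopy
open Set
set_option linter.unusedSectionVars false

noncomputable section
namespace Pi4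

section Susp
variable {k : ℕ} {V : Type*} [NormedAddCommGroup V] [NormedSpace ℝ V]

/-- suspension formula -/
def susp (n v : V) (s : ℝ) : V × ℝ :=
  (n + (4 * s * (1 - s)) • (v - n), ‖v - n‖ * (s * (1 - s) * (1 - 2 * s)))

theorem susp_cont (n : V) : Continuous (fun w : V × ℝ => susp n w.1 w.2) := by
  unfold susp; fun_prop

theorem susp_self (n : V) (s : ℝ) : susp n n s = (n, 0) := by simp [susp]
theorem susp_zero (n v : V) : susp n v 0 = (n, 0) := by simp [susp]
theorem susp_one (n v : V) : susp n v 1 = (n, 0) := by simp [susp]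

theorem susp_ne {n v : V} (hn : n ≠ 0) (hv : v ≠ 0) (s : ℝ) : susp n v s ≠ 0 := by
  intro h
  have h1 : n + (4 * s * (1 - s)) • (v - n) = 0 := congrArg Prod.fst h
  have h2 : ‖v - n‖ * (s * (1 - s) * (1 - 2 * s)) = 0 := congrArg Prod.snd h
  rcases mul_eq_zero.1 h2 with h3 | h3
  · rw [norm_eq_zero] at h3
    rw [h3] at h1
    simp at h1
    exact hn h1
  · rcases mul_eq_zero.1 h3 with h3 | h3
    · rcases mul_eq_zero.1 h3 with h3 | h3
      · rw [h3] at h1; simp at h1; exact hn h1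
      · rw [h3] at h1; simp at h1; exact hn h1
    · have : s = 1 / 2 := by linarith
      rw [this] at h1
      norm_num at h1
      exact hv h1

/-- base point of the suspension -/
def sb (n : P V) : P (V × ℝ) := ⟨(n.1, 0), fun h => n.2 (congrArg Prod.fst h)⟩

theorem tail_bd {y : Fin (k + 1) → ℝ} (h : ∃ i, y i = 0 ∨ y i = 1) :
    (y 0 = 0 ∨ y 0 = 1) ∨ ∃ i : Fin k, y i.succ = 0 ∨ y i.succ = 1 := by
  obtain ⟨i, hi⟩ := h
  refine Fin.cases (fun h => Or.inl h) (fun j h => Or.inr ⟨j, h⟩) i hi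

theorem bd_le {k : ℕ} {y : Fin k → ℝ} (h : ∃ i, y i = 0 ∨ y i = 1) : ∃ i, y i ≤ 0 ∨ 1 ≤ y i := by
  obtain ⟨i, hi | hi⟩ := h
  · exact ⟨i, Or.inl hi.le⟩
  · exact ⟨i, Or.inr hi.ge⟩

/-- suspension of a loop -/
def suspL {n : P V} (p : GenLoop (Fin k) (P V) n) : GenLoop (Fin (k + 1)) (P (V × ℝ)) (sb n) :=
  mk (sb n) (fun y => susp n.1 (ext p (fun i => y i.succ)) (y 0))
    (by
      have h1 : Continuous (fun y : Fin (k + 1) → ℝ => ext p (fun i => y i.succ)) :=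
        (ext_cont p).comp (by fun_prop)
      exact (susp_cont n.1).comp (h1.prodMk (continuous_apply 0)))
    (fun y _ => susp_ne n.2 (ext_ne p _) _)
    (fun y _ h => by
      rcases tail_bd h with (h | h) | h
      · rw [h, susp_zero]; rfl
      · rw [h, susp_one]; rfl
      · rw [ext_bd p (bd_le h), susp_self]; rfl)

theorem suspL_apply {n : P V} (p : GenLoop (Fin k) (P V) n) (y : Fin (k + 1) → I) :
    (suspL p y).1 = susp n.1 (p (fun i => y i.succ)).1 (y 0) := by
  unfold suspL
  rw [mk_apply]
  rw [ext_coe p (fun i => y i.succ)]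

theorem ext_suspL {n : P V} (p : GenLoop (Fin k) (P V) n) {y : Fin (k + 1) → ℝ} (hy : y ∈ Q (k+1)) :
    ext (suspL p) y = susp n.1 (ext p (fun i => y i.succ)) (y 0) := ext_mk _ _ _ _ _ hy

theorem suspL_homotopic {n : P V} (p q : GenLoop (Fin k) (P V) n) (h : GenLoop.Homotopic p q) :
    GenLoop.Homotopic (suspL p) (suspL q) := by
  obtain ⟨H, hc, h0, hb, e0, e1⟩ := homotopic_ext h
  refine homotopic_of (fun u y => susp n.1 (H u (fun i => y i.succ)) (y 0)) ?_ ?_ ?_ ?_ ?_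
  · have h1 : Continuous (fun w : ℝ × (Fin (k + 1) → ℝ) => H w.1 (fun i => w.2 i.succ)) :=
      hc.comp (f := fun w : ℝ × (Fin (k + 1) → ℝ) => (w.1, fun i : Fin k => w.2 i.succ))
        (by fun_prop)
    exact (susp_cont n.1).comp (h1.prodMk (by fun_prop))
  · intro u _ y _
    exact susp_ne n.2 (h0 _ _) _
  · intro u _ y _ h
    rcases tail_bd h with (h | h) | h
    · rw [h, susp_zero]; rfl
    · rw [h, susp_one]; rfl
    · rw [hb _ _ (bd_le h), susp_self]; rfl
  · intro y hy
    rw [e0 0 le_rfl, ext_suspL _ hy]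
  · intro y hy
    rw [e1 1 le_rfl, ext_suspL _ hy]

theorem suspL_transAt {n : P V} (p q : GenLoop (Fin (k + 1)) (P V) n) :
    suspL (GenLoop.transAt 0 p q) = GenLoop.transAt (Fin.succ 0) (suspL p) (suspL q) := by
  ext1 t
  apply Subtype.ext
  rw [suspL_apply]
  simp only [GenLoop.transAt, GenLoop.coe_copy]
  have key : ∀ c : I, (fun i : Fin (k+1) => Function.update t (Fin.succ 0) c i.succ) =
      Function.update (fun i : Fin (k+1) => t i.succ) 0 c := by
    intro c
    funext i
    by_cases hi : i = 0
    · subst hi; simp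
    · rw [Function.update_of_ne hi, Function.update_of_ne (fun h => hi (Fin.succ_injective _ h))]
  split_ifs with h
  · rw [suspL_apply, key, Function.update_of_ne (Fin.succ_ne_zero 0).symm]
  · rw [suspL_apply, key, Function.update_of_ne (Fin.succ_ne_zero 0).symm]

/-- suspension homomorphism -/
def suspHom (k : ℕ) (n : P V) :
    HomotopyGroup (Fin (k + 1)) (P V) n →* HomotopyGroup (Fin (k + 2)) (P (V × ℝ)) (sb n) :=
  homOf suspL suspL_homotopic 0 (Fin.succ 0) suspL_transAt

theorem suspHom_cls {n : P V} (p : GenLoop (Fin (k + 1)) (P V) n) :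
    suspHom k n (cls p) = cls (suspL p) := rfl

end Susp
end Pi4
end

open scoped unitInterval Topology Topology.Homotopy
open Set
set_option linter.unusedSectionVars false

noncomputable section
namespace Pi4

theorem isCompact_Q (k : ℕ) : IsCompact (Q k) := by
  have : Q k = Set.pi Set.univ (fun _ => Set.Icc (0:ℝ) 1) := by
    ext y; exact ⟨fun h i _ => h i, fun h i => h i trivial⟩
  rw [this]
  exact isCompact_univ_pi fun _ => isCompact_Icc

theorem exists_boost {X : Type*} [TopologicalSpace X] {C : Set X} (hC : IsCompact C)
    {a b : X → ℝ} (ha : Continuous a) (hb : Continuous b) (hb0 : ∀ x ∈ C, 0 ≤ b x)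
    (h : ∀ x ∈ C, a x ≤ 0 → 0 < b x) : ∃ M : ℝ, ∀ M' ≥ M, ∀ x ∈ C, 0 < a x + M' * b x := by
  have hC' : IsCompact (C ∩ {x | a x ≤ 0}) := hC.inter_right (isClosed_le ha continuous_const)
  obtain ⟨b0, hb0', hbb⟩ : ∃ b0 > 0, ∀ x ∈ C ∩ {x | a x ≤ 0}, b0 ≤ b x := by
    rcases (C ∩ {x | a x ≤ 0}).eq_empty_or_nonempty with he | hne
    · exact ⟨1, one_pos, by simp [he]⟩
    · obtain ⟨x, hx, hm⟩ := hC'.exists_isMinOn hne hb.continuousOn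
      exact ⟨b x, h x hx.1 hx.2, fun y hy => hm hy⟩
  obtain ⟨a0, haa⟩ := hC.bddBelow_image ha.continuousOn
  refine ⟨(|a0| + 1) / b0, fun M' hM' x hx => ?_⟩
  have hM0 : 0 < (|a0| + 1) / b0 := by positivity
  by_cases hax : a x ≤ 0
  · have h1 := hbb x ⟨hx, hax⟩
    have h2 : a0 ≤ a x := haa ⟨x, hx, rfl⟩
    have h3 : (|a0| + 1) / b0 * b0 ≤ M' * b x := by
      apply mul_le_mul hM' h1 hb0'.le (by linarith)
    rw [div_mul_cancel₀ _ hb0'.ne'] at h3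
    have := neg_abs_le a0
    linarith
  · have := mul_nonneg (by linarith : 0 ≤ M') (hb0 x hx)
    linarith

section Approx
variable {m : ℕ} {E : Type*} [NormedAddCommGroup E] [NormedSpace ℝ E]

theorem exists_smooth {n : P E} (p : GenLoop (Fin m) (P E) n) :
    ∃ f : (Fin m → ℝ) → E, ContDiff ℝ 1 f ∧ (∀ y, f y ≠ 0) ∧
      (∀ y, (∃ i, y i ≤ 0 ∨ 1 ≤ y i) → f y = n.1) ∧
      ∀ q : GenLoop (Fin m) (P E) n, (∀ y ∈ Q m, ext q y = f y) → GenLoop.Homotopic p q := by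
  obtain ⟨g, hg, hd, hs⟩ := Continuous.exists_contDiff_approx (E := Fin m → ℝ)
    (f := fun y => ext p y - n.1) (ε := fun y => ‖ext p y‖) 1
    ((ext_cont p).sub continuous_const) (ext_cont p).norm (fun y => norm_pos_iff.2 (ext_ne p y))
  have hline : ∀ u ∈ Set.Icc (0:ℝ) 1, ∀ y, (1 - u) • ext p y + u • (n.1 + g y) ≠ 0 := by
    intro u hu y h
    have h1 := hd y
    rw [dist_eq_norm] at h1
    have h2 : ext p y = - (u • (g y - (ext p y - n.1))) := by
      have : (1 - u) • ext p y + u • (n.1 + g y) = ext p y + u • (g y - (ext p y - n.1)) := by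
        module
      rw [this] at h
      exact eq_neg_of_add_eq_zero_left h
    have h3 : ‖ext p y‖ ≤ ‖g y - (ext p y - n.1)‖ := by
      conv_lhs => rw [h2]
      rw [norm_neg, norm_smul, Real.norm_of_nonneg hu.1]
      exact mul_le_of_le_one_left (norm_nonneg _) hu.2
    linarith
  have hbd : ∀ y, (∃ i, y i ≤ 0 ∨ 1 ≤ y i) → n.1 + g y = n.1 := by
    intro y hy
    have : g y = 0 := by
      by_contra hne
      have := hs (Function.mem_support.2 hne)
      apply this
      simp [ext_bd p hy]
    simp [this]
  refine ⟨fun y => n.1 + g y, contDiff_const.add hg, fun y => ?_, hbd, fun q hq => ?_⟩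
  · simpa using hline 1 (by simp) y
  · refine homotopic_of (fun u y => (1 - u) • ext p y + u • (n.1 + g y)) ?_ ?_ ?_ ?_ ?_
    · have h1 := ext_cont p
      have h2 := hg.continuous
      have h3 : Continuous (fun w : ℝ × (Fin m → ℝ) => ext p w.2) := h1.comp continuous_snd
      have h4 : Continuous (fun w : ℝ × (Fin m → ℝ) => g w.2) := h2.comp continuous_snd
      fun_prop
    · intro u hu y _; exact hline u hu y
    · intro u hu y _ h
      rw [ext_bd p (bd_le h), hbd y (bd_le h)]
      module
    · intro y _; simp
    · intro y hy; simp [hq y hy]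
end Approx

section Freud
variable {k : ℕ} {V : Type*} [NormedAddCommGroup V] [NormedSpace ℝ V] [FiniteDimensional ℝ V]

theorem exists_shear (hk : k + 2 < 2 * Module.finrank ℝ V) (F : (Fin (k + 1) → ℝ) → V × ℝ)
    (hF : ContDiff ℝ 1 F) : ∃ a b : V, ∀ (x : Fin k → ℝ) (s t : ℝ),
      0 < (F (Fin.cons s x)).2 → (F (Fin.cons t x)).2 < 0 →
      (F (Fin.cons s x)).1 = (F (Fin.cons s x)).2 • a →
      (F (Fin.cons t x)).1 = (F (Fin.cons t x)).2 • b → False := by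
  let A : ((Fin k → ℝ) × ℝ × ℝ) → V × ℝ := fun w => F (Fin.cons w.2.1 w.1)
  let B : ((Fin k → ℝ) × ℝ × ℝ) → V × ℝ := fun w => F (Fin.cons w.2.2 w.1)
  have hA : ContDiff ℝ 1 A := by
    apply hF.comp
    rw [contDiff_pi]
    intro i
    refine Fin.cases ?_ (fun j => ?_) i
    · simp only [Fin.cons_zero]; fun_prop
    · simp only [Fin.cons_succ]; fun_prop
  have hB : ContDiff ℝ 1 B := by
    apply hF.comp
    rw [contDiff_pi]
    intro i
    refine Fin.cases ?_ (fun j => ?_) i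
    · simp only [Fin.cons_zero]; fun_prop
    · simp only [Fin.cons_succ]; fun_prop
  let Ψ : ((Fin k → ℝ) × ℝ × ℝ) → V × V := fun w => ((A w).2⁻¹ • (A w).1, (B w).2⁻¹ • (B w).1)
  let S : Set ((Fin k → ℝ) × ℝ × ℝ) := {w | 0 < (A w).2 ∧ (B w).2 < 0}
  have hdim : dimH (Ψ '' S) ≤ dimH S := by
    apply dimH_image_le_of_locally_lipschitzOn
    intro w hw
    have hc : ContDiffAt ℝ 1 Ψ w := by
      refine ContDiffAt.prodMk ?_ ?_
      · exact (hA.contDiffAt.snd.inv hw.1.ne').smul hA.contDiffAt.fst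
      · exact (hB.contDiffAt.snd.inv hw.2.ne).smul hB.contDiffAt.fst
    obtain ⟨K, t, ht, hL⟩ := hc.exists_lipschitzOnWith
    exact ⟨K, t, mem_nhdsWithin_of_mem_nhds ht, hL⟩
  have hS : dimH S ≤ (k + 2 : ℕ) := by
    calc dimH S ≤ dimH (Set.univ : Set ((Fin k → ℝ) × ℝ × ℝ)) := dimH_mono (Set.subset_univ _)
      _ = (Module.finrank ℝ ((Fin k → ℝ) × ℝ × ℝ) : ℕ) := Real.dimH_univ_eq_finrank ((Fin k → ℝ) × ℝ × ℝ)
      _ ≤ (k + 2 : ℕ) := by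
        have : Module.finrank ℝ ((Fin k → ℝ) × ℝ × ℝ) = k + 2 := by simp [Module.finrank_prod]
        rw [this]
  have hlt : dimH (Ψ '' S) < (Module.finrank ℝ (V × V) : ℕ) := by
    refine lt_of_le_of_lt (hdim.trans hS) ?_
    rw [Module.finrank_prod]
    exact_mod_cast (by omega : k + 2 < Module.finrank ℝ V + Module.finrank ℝ V)
  obtain ⟨⟨a, b⟩, hab⟩ := (dense_compl_of_dimH_lt_finrank hlt).nonempty
  refine ⟨a, b, fun x s t hs ht h1 h2 => hab ⟨(x, s, t), ⟨hs, ht⟩, ?_⟩⟩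
  change ((F (Fin.cons s x)).2⁻¹ • (F (Fin.cons s x)).1,
    (F (Fin.cons t x)).2⁻¹ • (F (Fin.cons t x)).1) = (a, b)
  rw [h1, h2, inv_smul_smul₀ hs.ne', inv_smul_smul₀ ht.ne]

/-- step (b): general position -/
theorem exists_sheared (hk : k + 2 < 2 * Module.finrank ℝ V) {n : P V}
    (p : GenLoop (Fin (k + 1)) (P (V × ℝ)) (sb n)) :
    ∃ q : GenLoop (Fin (k + 1)) (P (V × ℝ)) (sb n), GenLoop.Homotopic p q ∧
      ∀ (x : Fin k → ℝ) (s t : ℝ), Fin.cons s x ∈ Q (k + 1) → Fin.cons t x ∈ Q (k + 1) →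
        (ext q (Fin.cons s x)).1 = 0 → 0 ≤ (ext q (Fin.cons s x)).2 →
        (ext q (Fin.cons t x)).1 = 0 → (ext q (Fin.cons t x)).2 ≤ 0 → False := by
  obtain ⟨f, hf, f0, fb, fh⟩ := exists_smooth p
  obtain ⟨a, b, hab⟩ := exists_shear hk f hf
  let H : ℝ → (Fin (k + 1) → ℝ) → V × ℝ := fun u y =>
    ((f y).1 - u • (max (f y).2 0 • a + min (f y).2 0 • b), (f y).2)
  have hfc := hf.continuous
  have hHc : Continuous (fun w : ℝ × (Fin (k + 1) → ℝ) => H w.1 w.2) := by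
    have : Continuous (fun w : ℝ × (Fin (k + 1) → ℝ) => f w.2) := hfc.comp continuous_snd
    simp only [H]
    fun_prop
  have hH0 : ∀ u y, H u y ≠ 0 := by
    intro u y h
    have h2 : (f y).2 = 0 := congrArg Prod.snd h
    have h1 : (f y).1 - u • (max (f y).2 0 • a + min (f y).2 0 • b) = 0 := congrArg Prod.fst h
    rw [h2] at h1
    simp at h1
    exact f0 y (Prod.ext h1 h2)
  have hHb : ∀ u y, (∃ i, y i = 0 ∨ y i = 1) → H u y = (sb n).1 := by
    intro u y hy
    simp [H, fb y (bd_le hy), sb]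
  let q0 := mk (sb n) f hfc (fun y _ => f0 y) (fun y _ h => fb y (bd_le h))
  let q := mk (sb n) (H 1) (hHc.comp (Continuous.prodMk_right 1)) (fun y _ => hH0 1 y)
    (fun y _ h => hHb 1 y h)
  refine ⟨q, (fh q0 fun y hy => ext_mk _ _ _ _ _ hy).trans ?_, ?_⟩
  · refine homotopic_of H hHc (fun u _ y _ => hH0 u y) (fun u _ y _ => hHb u y) ?_ ?_
    · intro y hy; rw [ext_mk _ _ _ _ _ hy]; simp [H]
    · intro y hy; rw [ext_mk _ _ _ _ _ hy]
  · intro x s t hs ht h1 h2 h3 h4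
    rw [ext_mk _ _ _ _ _ hs] at h1 h2
    rw [ext_mk _ _ _ _ _ ht] at h3 h4
    have h2' : 0 < (H 1 (Fin.cons s x)).2 :=
      lt_of_le_of_ne h2 fun h => hH0 1 (Fin.cons s x) (Prod.ext h1 h.symm)
    have h4' : (H 1 (Fin.cons t x)).2 < 0 :=
      lt_of_le_of_ne h4 fun h => hH0 1 (Fin.cons t x) (Prod.ext h3 h)
    simp only [H] at h1 h2' h3 h4'
    refine hab x s t h2' h4' ?_ ?_
    · rw [max_eq_left h2'.le, min_eq_right h2'.le] at h1
      simpa [sub_eq_zero] using h1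
    · rw [max_eq_right h4'.le, min_eq_left h4'.le] at h3
      simpa [sub_eq_zero] using h3

theorem cons_tail (y : Fin (k + 1) → ℝ) : (Fin.cons (y 0) (fun i => y i.succ) : Fin (k+1) → ℝ) = y :=
  Fin.cons_self_tail y

theorem cons_mem_Q {s : ℝ} {x : Fin k → ℝ} (hs : s ∈ Set.Icc (0:ℝ) 1) (hx : x ∈ Q k) :
    (Fin.cons s x : Fin (k+1) → ℝ) ∈ Q (k + 1) := by
  intro i
  refine Fin.cases ?_ (fun j => ?_) i
  · simpa using hs
  · simpa using hx j

theorem tail_mem_Q {y : Fin (k + 1) → ℝ} (hy : y ∈ Q (k + 1)) : (fun i => y i.succ) ∈ Q k :=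
  fun i => hy i.succ

/-- step (c): separation -/
theorem exists_separated {n : P V} (q : GenLoop (Fin (k + 1)) (P (V × ℝ)) (sb n))
    (hq : ∀ (x : Fin k → ℝ) (s t : ℝ), Fin.cons s x ∈ Q (k + 1) → Fin.cons t x ∈ Q (k + 1) →
        (ext q (Fin.cons s x)).1 = 0 → 0 ≤ (ext q (Fin.cons s x)).2 →
        (ext q (Fin.cons t x)).1 = 0 → (ext q (Fin.cons t x)).2 ≤ 0 → False) :
    ∃ r : GenLoop (Fin (k + 1)) (P (V × ℝ)) (sb n), GenLoop.Homotopic q r ∧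
      (∀ y ∈ Q (k + 1), y 0 ≤ 1 / 2 → (ext r y).1 = 0 → 0 < (ext r y).2) ∧
      (∀ y ∈ Q (k + 1), 1 / 2 ≤ y 0 → (ext r y).1 = 0 → (ext r y).2 < 0) := by
  have hc := ext_cont q
  let tl : (Fin (k + 1) → ℝ) → (Fin k → ℝ) := fun y i => y i.succ
  have htl : Continuous tl := by fun_prop
  let A : Set (Fin k → ℝ) := tl '' (Q (k + 1) ∩ {y | (ext q y).1 = 0 ∧ (ext q y).2 ≤ 0})
  let B : Set (Fin k → ℝ) := tl '' (Q (k + 1) ∩ {y | (ext q y).1 = 0 ∧ 0 ≤ (ext q y).2})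
  have hA : IsClosed A := by
    refine (((isCompact_Q _).inter_right ?_).image htl).isClosed
    exact (isClosed_eq hc.fst continuous_const).inter (isClosed_le hc.snd continuous_const)
  have hB : IsClosed B := by
    refine (((isCompact_Q _).inter_right ?_).image htl).isClosed
    exact (isClosed_eq hc.fst continuous_const).inter (isClosed_le continuous_const hc.snd)
  have hAB : Disjoint A B := by
    rw [Set.disjoint_left]
    rintro x ⟨y, ⟨hy, h1, h2⟩, rfl⟩ ⟨z, ⟨hz, h3, h4⟩, hzy⟩
    have ey := cons_tail y
    have ez : (Fin.cons (z 0) (tl y) : Fin (k+1) → ℝ) = z := by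
      rw [← hzy]; exact cons_tail z
    refine hq (tl y) (z 0) (y 0) ?_ ?_ ?_ ?_ ?_ ?_
    · rw [ez]; exact hz
    · rw [ey]; exact hy
    · rw [ez]; exact h3
    · rw [ez]; exact h4
    · rw [ey]; exact h1
    · rw [ey]; exact h2
  obtain ⟨φ, φA, φB, φI⟩ := exists_continuous_zero_one_of_isClosed hA hB hAB
  let β : (Fin (k + 1) → ℝ) → ℝ := fun y =>
    min (2 * y 0) 1 * φ (tl y) + max (2 * y 0 - 1) 0 * (1 - φ (tl y))
  have hβc : Continuous β := by
    have : Continuous (fun y => φ (tl y)) := φ.continuous.comp htl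
    fun_prop
  have hβI : ∀ y ∈ Q (k + 1), β y ∈ Set.Icc (0:ℝ) 1 := by
    intro y hy
    have h1 := hy 0
    obtain ⟨h2, h3⟩ := φI (tl y)
    simp only [β]
    rcases le_total (2 * y 0) 1 with h | h
    · rw [min_eq_left h, max_eq_right (by linarith)]
      constructor <;> nlinarith
    · rw [min_eq_right h, max_eq_left (by linarith)]
      constructor <;> nlinarith
  let H : ℝ → (Fin (k + 1) → ℝ) → V × ℝ := fun u y =>
    ext q (Fin.cons ((1 - u) * y 0 + u * β y) (tl y))
  have hHc : Continuous (fun w : ℝ × (Fin (k + 1) → ℝ) => H w.1 w.2) := by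
    apply hc.comp
    apply continuous_pi
    intro i
    refine Fin.cases ?_ (fun j => ?_) i
    · simp only [Fin.cons_zero]
      have : Continuous (fun w : ℝ × (Fin (k + 1) → ℝ) => β w.2) := hβc.comp continuous_snd
      fun_prop
    · simp only [Fin.cons_succ, tl]; fun_prop
  have hHb : ∀ u y, (∃ i, y i = 0 ∨ y i = 1) → H u y = (sb n).1 := by
    intro u y hy
    apply ext_bd
    rcases tail_bd hy with (h | h) | ⟨i, h⟩
    · refine ⟨0, Or.inl ?_⟩
      simp [h, β]
    · refine ⟨0, Or.inr ?_⟩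
      simp only [Fin.cons_zero, h, β]
      norm_num
    · refine ⟨i.succ, ?_⟩
      simp only [Fin.cons_succ, tl]
      rcases h with h | h
      · left; rw [h]
      · right; rw [h]
  let r := mk (sb n) (H 1) (hHc.comp (Continuous.prodMk_right 1)) (fun y _ => ext_ne q _)
    (fun y _ h => hHb 1 y h)
  have hn0 : (sb n).1.1 ≠ 0 := n.2
  refine ⟨r, ?_, ?_, ?_⟩
  · refine homotopic_of H hHc (fun u _ y _ => ext_ne q _) (fun u _ y _ => hHb u y) ?_ ?_
    · intro y hy
      simp only [H, sub_zero, one_mul, zero_mul, add_zero]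
      rw [cons_tail y]
    · intro y hy; rw [ext_mk _ _ _ _ _ hy]
  · intro y hy h1 h2
    rw [ext_mk _ _ _ _ _ hy] at h2 ⊢
    by_contra h3
    push Not at h3
    have hmem : tl y ∈ A := by
      refine ⟨Fin.cons ((1 - 1) * y 0 + 1 * β y) (tl y), ⟨cons_mem_Q ?_ (tail_mem_Q hy), h2, h3⟩, ?_⟩
      · simpa using hβI y hy
      · funext i; simp [tl]
    have h4 : β y = 0 := by
      have := φA hmem
      simp only [Pi.zero_apply] at this
      simp only [β, this]
      rw [max_eq_right (by linarith)]; simp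
    apply hn0
    rw [← h2]
    simp only [H]
    rw [ext_bd]
    exact ⟨0, Or.inl (by simp [h4])⟩
  · intro y hy h1 h2
    rw [ext_mk _ _ _ _ _ hy] at h2 ⊢
    by_contra h3
    push Not at h3
    have hmem : tl y ∈ B := by
      refine ⟨Fin.cons ((1 - 1) * y 0 + 1 * β y) (tl y), ⟨cons_mem_Q ?_ (tail_mem_Q hy), h2, h3⟩, ?_⟩
      · simpa using hβI y hy
      · funext i; simp [tl]
    have h4 : β y = 1 := by
      have := φB hmem
      simp only [Pi.one_apply] at this
      simp only [β, this]
      rw [min_eq_right (by linarith)]; simp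
    apply hn0
    rw [← h2]
    simp only [H]
    rw [ext_bd]
    exact ⟨0, Or.inr (by simp [h4])⟩

/-- step (d): a separated loop is a suspension -/
theorem exists_desusp {n : P V} (r : GenLoop (Fin (k + 1)) (P (V × ℝ)) (sb n))
    (h1 : ∀ y ∈ Q (k + 1), y 0 ≤ 1 / 2 → (ext r y).1 = 0 → 0 < (ext r y).2)
    (h2 : ∀ y ∈ Q (k + 1), 1 / 2 ≤ y 0 → (ext r y).1 = 0 → (ext r y).2 < 0) :
    ∃ g : GenLoop (Fin k) (P V) n, GenLoop.Homotopic r (suspL g) := by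
  have hrc := ext_cont r
  let tl : (Fin (k + 1) → ℝ) → (Fin k → ℝ) := fun y i => y i.succ
  have htl : Continuous tl := by fun_prop
  have hcons : Continuous (fun x : Fin k → ℝ => (Fin.cons (1/2 : ℝ) x : Fin (k+1) → ℝ)) := by
    apply continuous_pi
    intro i
    refine Fin.cases ?_ (fun j => ?_) i
    · simp only [Fin.cons_zero]; fun_prop
    · simp only [Fin.cons_succ]; fun_prop
  have hhalf : (1/2 : ℝ) ∈ Set.Icc (0:ℝ) 1 := by norm_num
  let g : GenLoop (Fin k) (P V) n := mk n (fun x => (ext r (Fin.cons (1/2 : ℝ) x)).1)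
    ((hrc.comp hcons).fst)
    (fun x hx h => by
      have m := cons_mem_Q hhalf hx
      have a := h1 _ m (by simp) h
      have b := h2 _ m (by simp) h
      linarith)
    (fun x hx h => by
      rw [ext_bd r]
      · rfl
      · obtain ⟨i, hi⟩ := h
        apply bd_le
        exact ⟨i.succ, by simpa using hi⟩)
  have hg : ∀ x ∈ Q k, ext g x = (ext r (Fin.cons (1/2 : ℝ) x)).1 := fun x hx => ext_mk _ _ _ _ _ hx
  let S : (Fin (k + 1) → ℝ) → V × ℝ := fun y => susp n.1 (ext g (tl y)) (y 0)
  have hSc : Continuous S :=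
    (susp_cont n.1).comp (((ext_cont g).comp htl).prodMk (continuous_apply 0))
  have hS0 : ∀ y, S y ≠ 0 := fun y => susp_ne n.2 (ext_ne g _) _
  have hmid : ∀ y ∈ Q (k + 1), y 0 = 1/2 → (S y).1 = (ext r y).1 ∧ (S y).1 ≠ 0 := by
    intro y hy h
    have e : (S y).1 = ext g (tl y) := by
      simp only [S, susp, h]; norm_num
    refine ⟨?_, e ▸ ext_ne g _⟩
    rw [e, hg _ (tail_mem_Q hy), ← h, cons_tail]
  have hSl : ∀ y ∈ Q (k + 1), y 0 ≤ 1 / 2 → (S y).1 = 0 → 0 < (S y).2 := by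
    intro y hy h h'
    refine lt_of_le_of_ne ?_ fun he => hS0 y (Prod.ext h' he.symm)
    have := hy 0
    simp only [S, susp]
    have : 0 ≤ 1 - y 0 := by linarith
    have : 0 ≤ 1 - 2 * y 0 := by linarith
    have : 0 ≤ y 0 := (hy 0).1
    positivity
  have hSr : ∀ y ∈ Q (k + 1), 1 / 2 ≤ y 0 → (S y).1 = 0 → (S y).2 < 0 := by
    intro y hy h h'
    refine lt_of_le_of_ne ?_ fun he => hS0 y (Prod.ext h' he)
    have := hy 0
    simp only [S, susp]
    apply mul_nonpos_of_nonneg_of_nonpos (norm_nonneg _)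
    apply mul_nonpos_of_nonneg_of_nonpos
    · apply mul_nonneg <;> linarith
    · linarith
  let v : (ℝ × (Fin (k + 1) → ℝ)) → V := fun w => (1 - w.1) • (ext r w.2).1 + w.1 • (S w.2).1
  let a : (ℝ × (Fin (k + 1) → ℝ)) → ℝ := fun w => (1 - w.1) * (ext r w.2).2 + w.1 * (S w.2).2
  let b : (ℝ × (Fin (k + 1) → ℝ)) → ℝ := fun w => w.1 * (1 - w.1) * (1 - 2 * w.2 0) * ‖(ext r w.2).1 - (S w.2).1‖
  have c1 : Continuous (fun w : (ℝ × (Fin (k + 1) → ℝ)) => ext r w.2) := hrc.comp continuous_snd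
  have c2 : Continuous (fun w : (ℝ × (Fin (k + 1) → ℝ)) => S w.2) := hSc.comp continuous_snd
  have hv : Continuous v := by fun_prop
  have ha : Continuous a := by fun_prop
  have hb : Continuous b := by fun_prop
  let C : Set (ℝ × (Fin (k + 1) → ℝ)) := (Set.Icc 0 1 ×ˢ Q (k + 1)) ∩ {w | v w = 0}
  have hC : IsCompact C := (isCompact_Icc.prod (isCompact_Q _)).inter_right
    (isClosed_eq hv continuous_const)
  have hC1 : IsCompact (C ∩ {w | w.2 0 ≤ 1/2}) := hC.inter_right
    (isClosed_le (by fun_prop) continuous_const)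
  have hC2 : IsCompact (C ∩ {w | 1/2 ≤ w.2 0}) := hC.inter_right
    (isClosed_le continuous_const (by fun_prop))
  have key : ∀ w ∈ C, w.1 = 0 ∧ (ext r w.2).1 = 0 ∨ w.1 = 1 ∧ (S w.2).1 = 0 ∨
      (ext r w.2).1 = 0 ∧ (S w.2).1 = 0 ∨
      (0 < w.1 ∧ w.1 < 1 ∧ w.2 0 ≠ 1/2 ∧ 0 < ‖(ext r w.2).1 - (S w.2).1‖) := by
    rintro ⟨u, y⟩ ⟨⟨hu, hy⟩, hw⟩
    simp only [v, Set.mem_ofPred_eq] at hw hu hy ⊢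
    rcases hu.1.eq_or_lt with h | h
    · left; rw [← h] at hw; exact ⟨h.symm, by simpa using hw⟩
    rcases hu.2.eq_or_lt with h' | h'
    · right; left; rw [h'] at hw; exact ⟨h', by simpa using hw⟩
    by_cases hd : (ext r y).1 = (S y).1
    · right; right; left
      rw [hd, ← add_smul] at hw
      have : (S y).1 = 0 := by simpa using hw
      exact ⟨hd.trans this, this⟩
    · right; right; right
      refine ⟨h, h', fun h3 => hd (hmid y hy h3).1.symm, norm_pos_iff.2 (sub_ne_zero.2 hd)⟩
  obtain ⟨M1, hM1⟩ := exists_boost hC1 ha hb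
    (by
      rintro ⟨u, y⟩ ⟨⟨⟨hu, hy⟩, -⟩, hs⟩
      simp only [Set.mem_ofPred_eq, b] at hu hs ⊢
      have : 0 ≤ 1 - u := by linarith [hu.2]
      have : 0 ≤ 1 - 2 * y 0 := by linarith
      have : 0 ≤ u := hu.1
      positivity)
    (by
      intro w hw haw
      have hs : w.2 0 ≤ 1/2 := hw.2
      have hy : w.2 ∈ Q (k+1) := hw.1.1.2
      rcases key w hw.1 with ⟨h, h'⟩ | ⟨h, h'⟩ | ⟨h, h'⟩ | ⟨h, h', h'', h3⟩
      · have := h1 _ hy hs h'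
        simp only [a, h] at haw; linarith
      · have := hSl _ hy hs h'
        simp only [a, h] at haw; linarith
      · have e1 := h1 _ hy hs h
        have e2 := hSl _ hy hs h'
        have e3 := hw.1.1.1
        simp only [a] at haw
        rcases e3.1.eq_or_lt with e | e
        · rw [← e] at haw; linarith
        · nlinarith [mul_nonneg (sub_nonneg.2 e3.2) e1.le, mul_pos e e2]
      · have : w.2 0 < 1/2 := lt_of_le_of_ne hs h''
        have e1 : 0 < 1 - 2 * w.2 0 := by linarith
        have e2 : 0 < 1 - w.1 := by linarith
        simp only [b]; positivity)
  obtain ⟨M2, hM2⟩ := exists_boost (a := fun w => - a w) (b := fun w => - b w) hC2 ha.neg hb.neg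
    (by
      rintro ⟨u, y⟩ ⟨⟨⟨hu, hy⟩, -⟩, hs⟩
      simp only [Set.mem_ofPred_eq, b] at hu hs ⊢
      have e1 : 0 ≤ 1 - u := by linarith [hu.2]
      have e2 : 0 ≤ 2 * y 0 - 1 := by linarith
      have e3 : 0 ≤ u := hu.1
      have := mul_nonneg (mul_nonneg (mul_nonneg e3 e1) e2) (norm_nonneg ((ext r y).1 - (S y).1))
      nlinarith)
    (by
      intro w hw haw
      have hs : 1/2 ≤ w.2 0 := hw.2
      have hy : w.2 ∈ Q (k+1) := hw.1.1.2
      rcases key w hw.1 with ⟨h, h'⟩ | ⟨h, h'⟩ | ⟨h, h'⟩ | ⟨h, h', h'', h3⟩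
      · have := h2 _ hy hs h'
        simp only [a, h] at haw; linarith
      · have := hSr _ hy hs h'
        simp only [a, h] at haw; linarith
      · have e1 := h2 _ hy hs h
        have e2 := hSr _ hy hs h'
        have e3 := hw.1.1.1
        simp only [a] at haw
        rcases e3.1.eq_or_lt with e | e
        · rw [← e] at haw; linarith
        · nlinarith [mul_nonneg (sub_nonneg.2 e3.2) (neg_nonneg.2 e1.le), mul_pos e (neg_pos.2 e2)]
      · have : 1/2 < w.2 0 := lt_of_le_of_ne hs (Ne.symm h'')
        have e1 : 0 < 2 * w.2 0 - 1 := by linarith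
        have e2 : 0 < 1 - w.1 := by linarith
        have := mul_pos (mul_pos (mul_pos h e2) e1) h3
        simp only [b]; nlinarith)
  let M := max M1 M2
  refine ⟨g, homotopic_of (fun u y => (v (u, y), a (u, y) + M * b (u, y))) ?_ ?_ ?_ ?_ ?_⟩
  · exact hv.prodMk (ha.add (continuous_const.mul hb))
  · intro u hu y hy h
    have e1 : v (u, y) = 0 := congrArg Prod.fst h
    have e2 : a (u, y) + M * b (u, y) = 0 := congrArg Prod.snd h
    have hC : (u, y) ∈ C := ⟨⟨hu, hy⟩, e1⟩
    rcases le_total (y 0) (1/2) with hs | hs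
    · have := hM1 M (le_max_left _ _) (u, y) ⟨hC, hs⟩
      linarith
    · have := hM2 M (le_max_right _ _) (u, y) ⟨hC, hs⟩
      linarith
  · intro u hu y hy h
    have e1 : ext r y = (n.1, 0) := ext_bd r (bd_le h)
    have e2 : S y = (n.1, 0) := by
      exact (ext_suspL g hy).symm.trans (ext_bd _ (bd_le h))
    simp only [v, a, b, e1, e2]
    apply Prod.ext
    · simp only [sb]; module
    · simp [sb]
  · intro y hy
    simp [v, a, b]
  · intro y hy
    rw [ext_suspL g hy]
    simp [v, a, b, S, tl]

/-- Freudenthal surjectivity -/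
theorem suspHom_surj (n : P V) (hk : k + 3 < 2 * Module.finrank ℝ V) :
    Function.Surjective (suspHom k n) := by
  intro c
  obtain ⟨p, rfl⟩ := cls_surj c
  obtain ⟨q, hpq, hq⟩ := exists_sheared (k := k + 1) (by omega) p
  obtain ⟨r, hqr, hr1, hr2⟩ := exists_separated q hq
  obtain ⟨g, hg⟩ := exists_desusp r hr1 hr2
  refine ⟨cls g, ?_⟩
  rw [suspHom_cls, cls_eq]
  exact ((hpq.trans hqr).trans hg).symm

end Freud
end Pi4
end

open scoped unitInterval Topology Topology.Homotopy
open Set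

set_option linter.unusedSectionVars false
noncomputable section
namespace Pi4

/-! ### M4 : logarithms and the fundamental group of the punctured plane -/

theorem exists_log {A : Type*} [TopologicalSpace A] [ContractibleSpace A]
    [LocallyPathConnectedSpace A] (c : A → ℂ) (hc : Continuous c) (h0 : ∀ a, c a ≠ 0)
    (a₀ : A) (z₀ : ℂ) (hz : Complex.exp z₀ = c a₀) :
    ∃ l : A → ℂ, Continuous l ∧ l a₀ = z₀ ∧ ∀ a, Complex.exp (l a) = c a := by
  haveI : SimplyConnectedSpace A := inferInstance
  obtain ⟨F, ⟨h1, h2⟩, -⟩ := Complex.isCoveringMap_exp.existsUnique_continuousMap_lifts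
    (⟨fun a => ⟨c a, h0 a⟩, hc.subtype_mk _⟩ : C(A, {z : ℂ // z ≠ 0})) a₀ z₀ (Subtype.ext hz)
  refine ⟨F, F.continuous, h1, fun a => ?_⟩
  have := congrFun h2 a
  exact congrArg Subtype.val this

/-- base point of the punctured plane -/
def b1 : P ℂ := ⟨1, one_ne_zero⟩

/-- standard loop of winding number `k` -/
def E1 (k : ℤ) : GenLoop (Fin 1) (P ℂ) b1 :=
  mk b1 (fun y => Complex.exp (2 * Real.pi * Complex.I * k * (y 0 : ℝ))) (by fun_prop)
    (fun y _ => Complex.exp_ne_zero _) (by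
      rintro y - ⟨i, hi⟩
      obtain rfl : i = 0 := Subsingleton.elim _ _
      rcases hi with hi | hi
      · simp [hi, b1]
      · rw [hi]
        change _ = (1:ℂ)
        rw [Complex.exp_eq_one_iff]
        exact ⟨k, by push_cast; ring⟩)

theorem E1_of_log (p : GenLoop (Fin 1) (P ℂ) b1) (l : (Fin 1 → ℝ) → ℂ) (hl : Continuous l)
    (k : ℤ) (h0 : l (fun _ => 0) = 0) (h1 : l (fun _ => 1) = k * (2 * Real.pi * Complex.I))
    (he : ∀ y ∈ Q 1, Complex.exp (l y) = ext p y) : cls p = cls (E1 k) := by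
  rw [cls_eq]
  refine homotopic_of (fun u y => Complex.exp ((1 - u : ℝ) * l y +
    (u : ℝ) * (2 * Real.pi * Complex.I * k * (y 0 : ℝ)))) (by fun_prop)
    (fun _ _ _ _ => Complex.exp_ne_zero _) ?_ ?_ ?_
  · rintro u - y - ⟨i, hi⟩
    obtain rfl : i = 0 := Subsingleton.elim _ _
    rcases hi with hi | hi
    · have : y = fun _ => 0 := by funext j; rw [Subsingleton.elim j 0, hi]
      rw [this, h0]; simp [b1]
    · have : y = fun _ => 1 := by funext j; rw [Subsingleton.elim j 0, hi]
      rw [this, h1]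
      change _ = (1:ℂ)
      rw [Complex.exp_eq_one_iff]
      exact ⟨k, by push_cast; ring⟩
  · intro y hy
    simp [he y hy]
  · intro y hy
    rw [E1, ext_mk _ _ _ _ _ hy]; simp

theorem E1_surj (a : HomotopyGroup (Fin 1) (P ℂ) b1) : ∃ k : ℤ, a = cls (E1 k) := by
  obtain ⟨p, rfl⟩ := cls_surj a
  have hb0 : ext p (fun _ => 0) = 1 := ext_bd p ⟨0, Or.inl le_rfl⟩
  have hb1 : ext p (fun _ => 1) = 1 := ext_bd p ⟨0, Or.inr le_rfl⟩
  obtain ⟨l, hl, hl0, hl1⟩ := exists_log (ext p) (ext_cont p) (ext_ne p) (fun _ => 0) 0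
    (by rw [hb0]; simp)
  have := hl1 (fun _ => 1)
  rw [hb1, Complex.exp_eq_one_iff] at this
  obtain ⟨k, hk⟩ := this
  exact ⟨k, E1_of_log p l hl k hl0 hk (fun y _ => hl1 y)⟩

theorem E1_mul (j k : ℤ) : cls (E1 j) * cls (E1 k) = cls (E1 (j + k)) := by
  rw [cls_mul 0]
  refine E1_of_log _ (fun y => (2 * Real.pi * Complex.I) *
    (k * (min (2 * y 0) 1 : ℝ) + j * (max (2 * y 0 - 1) 0 : ℝ))) (by fun_prop) _ ?_ ?_ ?_
  · simp
  · norm_num; ring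
  · intro y hy
    rw [ext, GenLoop.transAt, GenLoop.coe_copy]
    have hy0 : ((clamp y 0 : I) : ℝ) = y 0 := congrFun (clamp_val hy) 0
    simp only [hy0]
    have hy' := hy 0
    split_ifs with h
    · rw [E1, mk_apply]
      simp only [Function.update_self]
      rw [Set.projIcc_of_mem zero_le_one (⟨by linarith, by linarith⟩ : 2 * y 0 ∈ Icc (0:ℝ) 1)]
      rw [min_eq_left (by linarith), max_eq_right (by linarith)]
      simp only; push_cast; ring_nf
    · rw [E1, mk_apply]
      simp only [Function.update_self]
      rw [Set.projIcc_of_mem zero_le_one (⟨by linarith, by linarith⟩ : 2 * y 0 - 1 ∈ Icc (0:ℝ) 1)]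
      rw [min_eq_right (by linarith), max_eq_left (by linarith), mul_add, Complex.exp_add]
      have : Complex.exp (2 * Real.pi * Complex.I * (k * (1:ℝ))) = 1 := by
        rw [Complex.exp_eq_one_iff]
        exact ⟨k, by push_cast; ring⟩
      rw [this]
      simp only; push_cast; ring_nf

theorem pi1_cyclic (a : HomotopyGroup (Fin 1) (P ℂ) b1) : ∃ k : ℤ, a = (cls (E1 1)) ^ k := by
  let f : Multiplicative ℤ →* HomotopyGroup (Fin 1) (P ℂ) b1 :=
    MonoidHom.mk' (fun k => cls (E1 k.toAdd)) (fun a b => (E1_mul _ _).symm)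
  obtain ⟨k, hk⟩ := E1_surj a
  refine ⟨k, ?_⟩
  have : f (Multiplicative.ofAdd 1 ^ k) = f (Multiplicative.ofAdd 1) ^ k := map_zpow _ _ _
  rw [← ofAdd_zsmul] at this
  simp only [smul_eq_mul, mul_one] at this
  rw [hk]; exact this

end Pi4
end

open scoped unitInterval Topology Topology.Homotopy
open Set

set_option linter.unusedSectionVars false
noncomputable section
namespace Pi4

/-! ### M5 : the Hopf map -/

/-- the Hopf map -/
def hopf (v : ℂ × ℂ) : ℂ × ℝ :=
  (v.1 * (starRingEnd ℂ) v.2, Complex.normSq v.1 - Complex.normSq v.2)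

theorem hopf_cont : Continuous hopf := by
  unfold hopf
  have := Complex.continuous_normSq
  fun_prop

theorem hopf_ne {v : ℂ × ℂ} (hv : v ≠ 0) : hopf v ≠ 0 := by
  intro h
  apply hv
  have h1 := congrArg Prod.fst h
  have h2 := congrArg Prod.snd h
  simp only [hopf, Prod.fst_zero, Prod.snd_zero, mul_eq_zero, map_eq_zero] at h1 h2
  rcases h1 with h1 | h1
  · simp only [h1, map_zero, zero_sub, neg_eq_zero, map_eq_zero] at h2
    exact Prod.ext h1 h2
  · simp only [h1, map_zero, sub_zero, map_eq_zero] at h2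
    exact Prod.ext h2 h1

theorem hopf_smul (c : ℂ) (v : ℂ × ℂ) : hopf (c • v) = Complex.normSq c • hopf v := by
  simp only [hopf, Prod.smul_fst, Prod.smul_snd, smul_eq_mul, map_mul, Prod.smul_mk, mul_sub]
  congr 1
  rw [Complex.real_smul, ← Complex.mul_conj]
  ring

/-- adapted inner product -/
def ip (w w' : ℂ × ℝ) : ℝ := 4 * (w.1.re * w'.1.re + w.1.im * w'.1.im) + w.2 * w'.2

theorem ip_cont : Continuous (fun q : (ℂ × ℝ) × (ℂ × ℝ) => ip q.1 q.2) := by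
  unfold ip
  fun_prop

theorem ip_self_pos {w : ℂ × ℝ} (h : w ≠ 0) : 0 < ip w w := by
  unfold ip
  by_contra hc
  push Not at hc
  apply h
  have h1 := sq_nonneg w.1.re
  have h2 := sq_nonneg w.1.im
  have h3 := sq_nonneg w.2
  refine Prod.ext (Complex.ext ?_ ?_) ?_
  · exact pow_eq_zero_iff two_ne_zero |>.1 (by nlinarith)
  · exact pow_eq_zero_iff two_ne_zero |>.1 (by nlinarith)
  · exact pow_eq_zero_iff two_ne_zero |>.1 (by nlinarith)

def nu (w : ℂ × ℝ) : ℝ := Real.sqrt (ip w w)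

theorem nu_cont : Continuous nu := by
  unfold nu
  have : Continuous (fun w : ℂ × ℝ => ip w w) := ip_cont.comp (continuous_id.prodMk continuous_id)
  fun_prop

theorem ip_self_nonneg (w : ℂ × ℝ) : 0 ≤ ip w w := by
  unfold ip; nlinarith [sq_nonneg w.1.re, sq_nonneg w.1.im, sq_nonneg w.2]

theorem nu_sq (w : ℂ × ℝ) : nu w ^ 2 = ip w w := Real.sq_sqrt (ip_self_nonneg w)

theorem nu_nonneg (w : ℂ × ℝ) : 0 ≤ nu w := Real.sqrt_nonneg _

theorem nu_hopf (v : ℂ × ℂ) : nu (hopf v) = Complex.normSq v.1 + Complex.normSq v.2 := by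
  unfold nu
  rw [Real.sqrt_eq_iff_mul_self_eq (ip_self_nonneg _)
    (add_nonneg (Complex.normSq_nonneg _) (Complex.normSq_nonneg _))]
  simp [ip, hopf, Complex.normSq_apply]
  ring

/-- unnormalised projection -/
def phi (w : ℂ × ℝ) (v : ℂ × ℂ) : ℂ × ℂ :=
  (((nu w + w.2 : ℝ) : ℂ) * v.1 + 2 * w.1 * v.2,
    2 * (starRingEnd ℂ) w.1 * v.1 + ((nu w - w.2 : ℝ) : ℂ) * v.2)

def cc (w : ℂ × ℝ) (v : ℂ × ℂ) : ℝ :=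
  nu w * (Complex.normSq v.1 + Complex.normSq v.2) + ip w (hopf v)

/-- lift of `w` near `v` -/
def stepLift (w : ℂ × ℝ) (v : ℂ × ℂ) : ℂ × ℂ :=
  ((1 / Real.sqrt (2 * cc w v) : ℝ) : ℂ) • phi w v

theorem hopf_phi (w : ℂ × ℝ) (v : ℂ × ℂ) : hopf (phi w v) = (2 * cc w v) • w := by
  have h := nu_sq w
  obtain ⟨z, r⟩ := w
  obtain ⟨a, b⟩ := v
  set n := nu (z, r)
  have hn : nu (z, r) = n := rfl
  obtain ⟨x, y⟩ := z
  obtain ⟨a1, a2⟩ := a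
  obtain ⟨b1, b2⟩ := b
  simp only [ip] at h
  refine Prod.ext (Complex.ext ?_ ?_) ?_
  · simp [hopf, phi, cc, ip, Complex.normSq_apply, hn]
    linear_combination (a1 * b1 + a2 * b2) * h
  · simp [hopf, phi, cc, ip, Complex.normSq_apply, hn]
    linear_combination (a2 * b1 - a1 * b2) * h
  · simp [hopf, phi, cc, ip, Complex.normSq_apply, hn]
    linear_combination (a1 ^ 2 + a2 ^ 2 - b1 ^ 2 - b2 ^ 2) * h

theorem hopf_stepLift {w : ℂ × ℝ} {v : ℂ × ℂ} (h : 0 < cc w v) : hopf (stepLift w v) = w := by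
  unfold stepLift
  rw [hopf_smul, hopf_phi, smul_smul, Complex.normSq_ofReal]
  have h2 : (0:ℝ) < 2 * cc w v := by linarith
  have : 1 / Real.sqrt (2 * cc w v) * (1 / Real.sqrt (2 * cc w v)) * (2 * cc w v) = 1 := by
    have := Real.mul_self_sqrt h2.le
    have h3 := Real.sqrt_pos.2 h2
    field_simp
    nlinarith
  rw [this, one_smul]

theorem cc_pos {w : ℂ × ℝ} {v : ℂ × ℂ} (h : 0 < ip w (hopf v)) : 0 < cc w v := by
  unfold cc
  have := mul_nonneg (nu_nonneg w)
    (add_nonneg (Complex.normSq_nonneg v.1) (Complex.normSq_nonneg v.2))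
  linarith

theorem stepLift_self {v : ℂ × ℂ} (hv : v ≠ 0) : stepLift (hopf v) v = v := by
  have hp := ip_self_pos (hopf_ne hv)
  have hc : 2 * cc (hopf v) v = (2 * nu (hopf v)) ^ 2 := by
    unfold cc
    rw [← nu_hopf, ← nu_sq]; ring
  have hn : 0 < nu (hopf v) := Real.sqrt_pos.2 hp
  unfold stepLift
  rw [hc, Real.sqrt_sq (by linarith)]
  have : phi (hopf v) v = ((2 * nu (hopf v) : ℝ) : ℂ) • v := by
    unfold phi
    rw [nu_hopf]
    refine Prod.ext ?_ ?_
    · simp only [hopf, Prod.smul_fst, smul_eq_mul]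
      push_cast
      rw [← Complex.mul_conj v.1, ← Complex.mul_conj v.2]
      ring
    · simp only [hopf, Prod.smul_snd, smul_eq_mul]
      push_cast
      rw [← Complex.mul_conj v.1, ← Complex.mul_conj v.2]
      simp only [map_mul, Complex.conj_conj]
      ring
  rw [this, smul_smul, ← Complex.ofReal_mul, one_div_mul_cancel (by positivity)]
  simp

theorem phi_cont : Continuous (fun q : (ℂ × ℝ) × (ℂ × ℂ) => phi q.1 q.2) := by
  unfold phi
  have := nu_cont
  fun_prop

theorem cc_cont : Continuous (fun q : (ℂ × ℝ) × (ℂ × ℂ) => cc q.1 q.2) := by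
  unfold cc
  have := nu_cont
  have h2 := Complex.continuous_normSq
  have h3 : Continuous (fun q : (ℂ × ℝ) × (ℂ × ℂ) => ip q.1 (hopf q.2)) :=
    ip_cont.comp (continuous_fst.prodMk (hopf_cont.comp continuous_snd))
  fun_prop

theorem stepLift_cont {A : Type*} [TopologicalSpace A] (w : A → ℂ × ℝ) (v : A → ℂ × ℂ)
    (hw : Continuous w) (hv : Continuous v) (h : ∀ a, 0 < cc (w a) (v a)) :
    Continuous (fun a => stepLift (w a) (v a)) := by
  unfold stepLift
  have h1 : Continuous (fun a => phi (w a) (v a)) := phi_cont.comp (f := fun a => (w a, v a)) (hw.prodMk hv)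
  have h2 : Continuous (fun a => cc (w a) (v a)) := cc_cont.comp (f := fun a => (w a, v a)) (hw.prodMk hv)
  have h3 : Continuous (fun a => 1 / Real.sqrt (2 * cc (w a) (v a))) := by
    apply Continuous.div continuous_const (by fun_prop)
    intro a
    have := h a
    exact (Real.sqrt_pos.2 (by linarith)).ne'
  exact (Complex.continuous_ofReal.comp h3).smul h1

/-- homotopy lifting for the Hopf map -/
theorem hopf_lift {A : Type*} [PseudoMetricSpace A] [CompactSpace A] (f : ℝ → A → ℂ × ℝ)
    (hf : Continuous (fun q : ℝ × A => f q.1 q.2)) (h0 : ∀ u a, f u a ≠ 0)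
    (g : A → ℂ × ℂ) (hg : Continuous g) (hgf : ∀ a, hopf (g a) = f 0 a) :
    ∃ F : ℝ → A → ℂ × ℂ, Continuous (fun q : ℝ × A => F q.1 q.2) ∧
      (∀ u ∈ Icc (0:ℝ) 1, ∀ a, hopf (F u a) = f u a) ∧ (∀ a, F 0 a = g a) ∧
      ∀ a, (∀ u ∈ Icc (0:ℝ) 1, f u a = f 0 a) → ∀ u ∈ Icc (0:ℝ) 1, F u a = g a := by
  -- uniform positivity
  obtain ⟨ε, hε, hpos⟩ : ∃ ε > 0, ∀ u ∈ Icc (0:ℝ) 1, ∀ u' ∈ Icc (0:ℝ) 1, |u - u'| < ε →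
      ∀ a, 0 < ip (f u a) (f u' a) := by
    have hc : Continuous (fun q : ℝ × ℝ × A => ip (f q.1 q.2.2) (f q.2.1 q.2.2)) := by
      have a1 : Continuous (fun q : ℝ × ℝ × A => f q.1 q.2.2) :=
        hf.comp (f := fun q : ℝ × ℝ × A => (q.1, q.2.2)) (by fun_prop)
      have a2 : Continuous (fun q : ℝ × ℝ × A => f q.2.1 q.2.2) :=
        hf.comp (f := fun q : ℝ × ℝ × A => (q.2.1, q.2.2)) (by fun_prop)
      exact ip_cont.comp (a1.prodMk a2)
    have hK : IsCompact (Icc (0:ℝ) 1 ×ˢ (Icc (0:ℝ) 1 ×ˢ (univ : Set A))) :=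
      isCompact_Icc.prod (isCompact_Icc.prod isCompact_univ)
    -- compact set of bad points
    set B := (Icc (0:ℝ) 1 ×ˢ (Icc (0:ℝ) 1 ×ˢ (univ : Set A))) ∩
      {q : ℝ × ℝ × A | ip (f q.1 q.2.2) (f q.2.1 q.2.2) ≤ 0} with hB
    have hBc : IsCompact B := hK.inter_right (isClosed_le hc continuous_const)
    rcases B.eq_empty_or_nonempty with he | hne
    · refine ⟨1, one_pos, fun u hu u' hu' _ a => ?_⟩
      by_contra hcon
      push Not at hcon
      have : (u, u', a) ∈ B := ⟨⟨hu, hu', mem_univ _⟩, hcon⟩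
      rw [he] at this; exact this
    · obtain ⟨q, hq, hmin⟩ := hBc.exists_isMinOn hne
        (f := fun q : ℝ × ℝ × A => |q.1 - q.2.1|) (by fun_prop)
      refine ⟨|q.1 - q.2.1|, ?_, fun u hu u' hu' hlt a => ?_⟩
      · rw [gt_iff_lt, abs_pos]
        intro hz
        have := hq.2
        simp only [Set.mem_ofPred_eq] at this
        rw [sub_eq_zero] at hz
        rw [hz] at this
        exact absurd (ip_self_pos (h0 q.2.1 q.2.2)) (not_lt.2 this)
      · by_contra hcon
        push Not at hcon
        have : (u, u', a) ∈ B := ⟨⟨hu, hu', mem_univ _⟩, hcon⟩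
        exact absurd (hmin this) (not_le.2 hlt)
  obtain ⟨N, hN⟩ := exists_nat_gt (1 / ε)
  have hN0 : (0:ℝ) < N := lt_trans (by positivity) hN
  have key : ∀ i : ℕ, i ≤ N → ∃ F : ℝ → A → ℂ × ℂ, Continuous (fun q : ℝ × A => F q.1 q.2) ∧
      (∀ u a, hopf (F u a) = f (max 0 (min u (i / N))) a) ∧ (∀ a, F 0 a = g a) ∧
      ∀ a, (∀ u ∈ Icc (0:ℝ) 1, f u a = f 0 a) → ∀ u, F u a = g a := by
    intro i
    induction i with
    | zero =>
      intro _
      refine ⟨fun _ a => g a, by fun_prop, fun u a => ?_, fun _ => rfl, fun _ _ _ => rfl⟩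
      rw [hgf]; simp
    | succ i ih =>
      intro hi
      obtain ⟨F, h1, h2, h3, h4⟩ := ih (by omega)
      have hle : ((i:ℝ) + 1) / N ≤ 1 := by
        rw [div_le_one hN0]; exact_mod_cast hi
      have hstep : ((i:ℝ) + 1) / N = i / N + 1 / N := by ring
      have hN1 : 1 / (N:ℝ) < ε := by
        rw [div_lt_iff₀ hN0, mul_comm, ← div_lt_iff₀ hε]; exact hN
      have hN2 : 0 < 1 / (N:ℝ) := by positivity
      have hi0 : (0:ℝ) ≤ i / N := by positivity
      have hcc : ∀ u a, 0 < cc (f (max 0 (min u ((i + 1) / N))) a) (F u a) := by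
        intro u a
        apply cc_pos
        rw [h2]
        apply hpos
        · exact ⟨le_max_left _ _, max_le zero_le_one (min_le_of_right_le hle)⟩
        · exact ⟨le_max_left _ _, max_le zero_le_one (min_le_of_right_le (by linarith))⟩
        · rw [abs_lt]
          rcases le_total u (i / N) with h | h
          · rw [min_eq_left h, min_eq_left (by linarith)]; constructor <;> linarith
          · rw [min_eq_right h, max_eq_right hi0]
            have : min u ((i + 1) / N) ≤ (i + 1) / N := min_le_right _ _
            have h' : (i:ℝ) / N ≤ min u ((i + 1) / N) := le_min h (by linarith)
            rw [max_eq_right (by linarith)]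
            constructor <;> linarith
      have hFne : ∀ u a, F u a ≠ 0 := by
        intro u a hz
        have := h2 u a
        rw [hz] at this
        exact h0 _ _ (this.symm.trans (by simp [hopf]))
      refine ⟨fun u a => stepLift (f (max 0 (min u ((i + 1) / N))) a) (F u a), ?_, ?_, ?_, ?_⟩
      · apply stepLift_cont _ _ _ h1 (fun q => hcc q.1 q.2)
        exact hf.comp (f := fun q : ℝ × A => (max 0 (min q.1 ((i + 1) / N)), q.2)) (by fun_prop)
      · intro u a
        rw [hopf_stepLift (hcc u a)]
        push_cast; rfl
      · intro a
        have e : max 0 (min (0:ℝ) ((i + 1) / N)) = 0 := by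
          rw [min_eq_left (by linarith), max_self]
        simp only [e]
        rw [h3, ← hgf]
        apply stepLift_self
        rw [← h3]; exact hFne _ _
      · intro a ha u
        simp only
        rw [h4 a ha u, ha _ ⟨le_max_left _ _, max_le zero_le_one (min_le_of_right_le hle)⟩, ← hgf]
        apply stepLift_self
        rw [← h3]; exact hFne _ _
  obtain ⟨F, h1, h2, h3, h4⟩ := key N le_rfl
  refine ⟨F, h1, fun u hu a => ?_, h3, fun a ha u _ => h4 a ha u⟩
  rw [h2, div_self hN0.ne', min_eq_left hu.2, max_eq_right hu.1]

end Pi4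
end

open scoped unitInterval Topology Topology.Homotopy
open Set

set_option linter.unusedSectionVars false
noncomputable section
namespace Pi4

/-! ### M5b : the Hopf map on homotopy groups -/

theorem log_eq_of_segment (l : ℝ → ℂ) (hl : Continuous l)
    (h : ∀ t ∈ Icc (0:ℝ) 1, Complex.exp (l t) = 1) : l 1 = l 0 := by
  have h2 : (fun t : I => l t) = fun _ => l 0 := by
    apply Complex.isCoveringMap_exp.eq_of_comp_eq (a := (0 : I)) (by fun_prop) (by fun_prop)
    · funext t
      apply Subtype.ext
      simp only [Function.comp]
      rw [h t t.2, h 0 (by simp)]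
    · simp
  exact congrFun h2 (1 : I)

theorem exists_log_bd {m : ℕ} (c : (Fin (m + 2) → ℝ) → ℂ) (hc : Continuous c)
    (h0 : ∀ a, c a ≠ 0) (hb : ∀ y ∈ Q (m + 2), (∃ i, y i = 0 ∨ y i = 1) → c y = 1) :
    ∃ l : (Fin (m + 2) → ℝ) → ℂ, Continuous l ∧ (∀ a, Complex.exp (l a) = c a) ∧
      ∀ y ∈ Q (m + 2), (∃ i, y i = 0 ∨ y i = 1) → l y = 0 := by
  obtain ⟨l, hl, hl0, hle⟩ := exists_log c hc h0 0 0 (by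
    rw [hb 0 (fun i => by simp) ⟨0, by simp⟩]; simp)
  refine ⟨l, hl, hle, ?_⟩
  -- segments in a face
  have seg : ∀ (i : Fin (m + 2)) (y z : Fin (m + 2) → ℝ), y ∈ Q (m + 2) → z ∈ Q (m + 2) →
      (y i = 0 ∨ y i = 1) → z i = y i → l z = l y := by
    intro i y z hy hz hi hzi
    have := log_eq_of_segment (fun t => l (fun j => (1 - t) * y j + t * z j)) (by fun_prop) (by
      intro t ht
      rw [hle]
      apply hb
      · intro j
        have h1 := hy j
        have h2 := hz j
        have h3 := ht.1
        have h4 := ht.2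
        constructor
        · nlinarith [mul_nonneg (sub_nonneg.2 h4) h1.1, mul_nonneg h3 h2.1]
        · nlinarith [mul_nonneg (sub_nonneg.2 h4) (sub_nonneg.2 h1.2),
            mul_nonneg h3 (sub_nonneg.2 h2.2)]
      · refine ⟨i, ?_⟩
        rw [hzi]
        rcases hi with hi | hi <;> simp [hi])
    simpa using this
  rintro y hy ⟨i, hi⟩
  obtain ⟨j, hj⟩ := exists_ne i
  have hz : Function.update y j 0 ∈ Q (m + 2) := by
    intro k
    by_cases h : k = j
    · subst h; simp
    · rw [Function.update_of_ne h]; exact hy k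
  have e1 := seg i y (Function.update y j 0) hy hz hi (Function.update_of_ne hj.symm _ _)
  have e2 := seg j (Function.update y j 0) 0 hz (fun i => by simp) (by simp) (by simp)
  rw [← e1, ← e2, hl0]

/-- base point of `ℂ² ∖ 0` -/
def bH : P (ℂ × ℂ) := ⟨(1, 1), by simp⟩

theorem hopf_one : hopf (1, 1) = (sb b1 : P (ℂ × ℝ)).1 := by
  simp [hopf, sb, b1]

/-- the Hopf map on punctured spaces -/
def hopfC : C(P (ℂ × ℂ), P (ℂ × ℝ)) :=
  ⟨fun v => ⟨hopf v.1, hopf_ne v.2⟩, (hopf_cont.comp continuous_subtype_val).subtype_mk _⟩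

theorem hopfC_base : hopfC bH = sb b1 := Subtype.ext hopf_one

theorem hopf_fibre {v : ℂ × ℂ} (h : hopf v = (1, 0)) :
    v = v.1 • ((1, 1) : ℂ × ℂ) ∧ Complex.normSq v.1 = 1 := by
  have h1 : v.1 * (starRingEnd ℂ) v.2 = 1 := congrArg Prod.fst h
  have h2 : Complex.normSq v.1 - Complex.normSq v.2 = 0 := congrArg Prod.snd h
  have h3 : Complex.normSq v.1 * Complex.normSq v.2 = 1 := by
    have := congrArg Complex.normSq h1
    simpa using this
  have h4 : Complex.normSq v.1 = 1 := by
    have := Complex.normSq_nonneg v.1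
    nlinarith
  refine ⟨Prod.ext (by simp) ?_, h4⟩
  have h5 : v.1 * (starRingEnd ℂ) v.1 = 1 := by rw [Complex.mul_conj, h4]; simp
  have h6 : v.1 ≠ 0 := left_ne_zero_of_mul_eq_one h1
  have h7 := mul_left_cancel₀ h6 (h1.trans h5.symm)
  have h8 := congrArg (starRingEnd ℂ) h7
  simp only [Complex.conj_conj] at h8
  simpa using h8

theorem sb_b1 : (sb b1 : P (ℂ × ℝ)).1 = (1, 0) := rfl

theorem re_log_zero {z c : ℂ} (h : Complex.exp z = c) (hc : Complex.normSq c = 1) : z.re = 0 := by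
  have := Complex.norm_exp z
  rw [h] at this
  have h2 : ‖c‖ = 1 := by
    rw [Complex.normSq_eq_norm_sq] at hc
    nlinarith [norm_nonneg c]
  rw [h2] at this
  exact (Real.exp_eq_one_iff _).1 this.symm

theorem cons_coe_mem {m : ℕ} (t : ℝ) (y : Fin m → I) (i : Fin m) (h : y i = 0 ∨ y i = 1) :
    ∃ j, (Fin.cons t (fun i => (y i : ℝ)) : Fin (m + 1) → ℝ) j ≤ 0 ∨
      1 ≤ (Fin.cons t (fun i => (y i : ℝ)) : Fin (m + 1) → ℝ) j := by
  refine ⟨i.succ, ?_⟩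
  rcases h with h | h <;> simp [h]

theorem clamp_bd' {m : ℕ} {y : Fin m → ℝ} {i : Fin m} (h : y i = 0 ∨ y i = 1) :
    clamp y i = 0 ∨ clamp y i = 1 := by
  rcases h with h | h
  · left; exact Set.projIcc_of_le_left _ h.le
  · right; exact Set.projIcc_of_right_le _ h.ge

theorem hopf_surj (m : ℕ) : Function.Surjective
    (pimap hopfC hopfC_base : HomotopyGroup (Fin (m + 3)) (P (ℂ × ℂ)) bH →* _) := by
  intro a
  obtain ⟨p, rfl⟩ := cls_surj a
  have hcons : Continuous (fun q : ℝ × (Fin (m + 2) → I) =>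
      (Fin.cons q.1 (fun i => (q.2 i : ℝ)) : Fin (m + 3) → ℝ)) := by
    apply continuous_pi
    intro i
    refine Fin.cases ?_ (fun i => ?_) i
    · simp only [Fin.cons_zero]; fun_prop
    · simp only [Fin.cons_succ]; fun_prop
  obtain ⟨F, hF, h1, h2, h3⟩ := hopf_lift
    (fun (t : ℝ) (y : Fin (m + 2) → I) => ext p (Fin.cons t (fun i => (y i : ℝ))))
    ((ext_cont p).comp hcons) (fun _ _ => ext_ne p _) (fun _ => (1, 1)) continuous_const
    (fun y => by rw [ext_bd p ⟨0, Or.inl (by simp)⟩, hopf_one])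
  have hFne : ∀ u ∈ Icc (0:ℝ) 1, ∀ y, F u y ≠ 0 := by
    intro u hu y hz
    have := h1 u hu y
    rw [hz] at this
    exact ext_ne p _ (this.symm.trans (by simp [hopf]))
  have hF1 : ∀ y, hopf (F 1 y) = (1, 0) := by
    intro y
    rw [h1 1 (by simp), ext_bd p ⟨0, Or.inr (by simp)⟩, sb_b1]
  have hFb : ∀ u ∈ Icc (0:ℝ) 1, ∀ (y : Fin (m + 2) → I), (∃ i, y i = 0 ∨ y i = 1) →
      F u y = (1, 1) := by
    rintro u hu y ⟨i, hi⟩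
    apply h3 y _ u hu
    intro u _
    rw [ext_bd p (cons_coe_mem u y i hi), ext_bd p (cons_coe_mem 0 y i hi)]
  obtain ⟨l, hl, hle, hl0⟩ := exists_log_bd (fun y => (F 1 (clamp y)).1) (by
      exact continuous_fst.comp (hF.comp (continuous_const.prodMk continuous_clamp)))
    (by
      intro y hz
      have := (hopf_fibre (hF1 (clamp y))).2
      rw [hz] at this; simp at this)
    (by
      rintro y hy ⟨i, hi⟩
      rw [hFb 1 (by simp) _ ⟨i, clamp_bd' hi⟩])
  have hlre : ∀ y, (l y).re = 0 := fun y => re_log_zero (hle y) (hopf_fibre (hF1 (clamp y))).2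
  have hFq : Continuous (fun y : Fin (m + 3) → ℝ => F (y 0) (clamp (fun i => y i.succ))) := by
    apply hF.comp (f := fun y : Fin (m + 3) → ℝ => (y 0, clamp (fun i => y i.succ)))
    exact (continuous_apply 0).prodMk (continuous_clamp.comp (by fun_prop))
  refine ⟨cls (mk bH (fun y => Complex.exp (-((y 0 : ℝ) * l (fun i => y i.succ))) •
    F (y 0) (clamp (fun i => y i.succ))) ?_ ?_ ?_), ?_⟩
  · exact Continuous.smul (by fun_prop :
      Continuous (fun y : Fin (m + 3) → ℝ => Complex.exp (-((y 0 : ℝ) * l (fun i => y i.succ))))) hFq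
  · intro y hy
    exact smul_ne_zero (Complex.exp_ne_zero _) (hFne _ (hy 0) _)
  · rintro y hy ⟨i, hi⟩
    change _ = ((1, 1) : ℂ × ℂ)
    have ht : (fun i => y i.succ : Fin (m + 2) → ℝ) ∈ Q (m + 2) := fun i => hy _
    revert hi
    refine Fin.cases (fun hi => ?_) (fun i hi => ?_) i
    · rcases hi with hi | hi
      · simp [hi, h2]
      · rw [hi]
        have := (hopf_fibre (hF1 (clamp (fun i => y i.succ)))).1
        rw [this, smul_smul, ← hle, ← Complex.exp_add]
        simp
    · rw [hl0 _ ht ⟨i, hi⟩, hFb _ (hy 0) _ ⟨i, clamp_bd' (y := fun i => y i.succ) hi⟩]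
      simp
  · rw [pimap_cls]
    congr 1
    apply GenLoop.ext
    intro y
    apply Subtype.ext
    rw [gmap_apply]
    change hopf (Complex.exp (-(((y 0 : ℝ) : ℂ) * l (fun i => (y i.succ : ℝ)))) •
      F (y 0) (clamp (fun i => (y i.succ : ℝ)))) = (p y).1
    rw [hopf_smul, h1 _ (y 0).2, clamp_coe (fun i => y i.succ), Complex.normSq_eq_norm_sq,
      Complex.norm_exp]
    have e : (-(((y 0 : ℝ) : ℂ) * l (fun i => (y i.succ : ℝ)))).re = 0 := by
      simp [hlre]
    rw [e, Real.exp_zero, one_pow, one_smul, ← ext_coe]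
    congr 1
    funext i
    refine Fin.cases ?_ (fun i => ?_) i <;> simp

theorem hopf_inj (m : ℕ) : Function.Injective
    (pimap hopfC hopfC_base : HomotopyGroup (Fin (m + 2)) (P (ℂ × ℂ)) bH →* _) := by
  rw [injective_iff_map_eq_one]
  intro a ha
  obtain ⟨p, rfl⟩ := cls_surj a
  rw [pimap_cls, ← cls_const, cls_eq] at ha
  obtain ⟨H, hH, hH0, hHb, e0, e1⟩ := homotopic_ext ha
  obtain ⟨F, hF, h1, h2, h3⟩ := hopf_lift
    (fun (t : ℝ) (y : Fin (m + 2) → I) => H t (fun i => (y i : ℝ)))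
    (hH.comp (f := fun q : ℝ × (Fin (m + 2) → I) => (q.1, fun i => (q.2 i : ℝ))) (by fun_prop))
    (fun _ _ => hH0 _ _) (fun y => (p y).1) (continuous_subtype_val.comp p.1.continuous)
    (fun y => by rw [e0 0 le_rfl, ext_coe]; rfl)
  have hFne : ∀ u ∈ Icc (0:ℝ) 1, ∀ y, F u y ≠ 0 := by
    intro u hu y hz
    have := h1 u hu y
    rw [hz] at this
    exact hH0 _ _ (this.symm.trans (by simp [hopf]))
  have hF1 : ∀ y, hopf (F 1 y) = (1, 0) := by
    intro y
    rw [h1 1 (by simp), e1 1 le_rfl, ext_coe]; rfl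
  have hFb : ∀ u ∈ Icc (0:ℝ) 1, ∀ (y : Fin (m + 2) → I), (∃ i, y i = 0 ∨ y i = 1) →
      F u y = (1, 1) := by
    rintro u hu y ⟨i, hi⟩
    have hi' : ∃ i, (y i : ℝ) ≤ 0 ∨ 1 ≤ (y i : ℝ) := ⟨i, by
      rcases hi with hi | hi <;> simp [hi]⟩
    rw [h3 y _ u hu]
    · have e : p y = bH := p.2 y ⟨i, hi⟩
      rw [e]; rfl
    · intro u _
      rw [hHb _ _ hi', hHb _ _ hi']
  obtain ⟨l, hl, hle, hl0⟩ := exists_log_bd (fun y => (F 1 (clamp y)).1) (by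
      exact continuous_fst.comp (hF.comp (continuous_const.prodMk continuous_clamp)))
    (by
      intro y hz
      have := (hopf_fibre (hF1 (clamp y))).2
      rw [hz] at this; simp at this)
    (by
      rintro y hy ⟨i, hi⟩
      rw [hFb 1 (by simp) _ ⟨i, clamp_bd' hi⟩])
  have hlc : Continuous (fun y => Complex.exp (l y) • ((1, 1) : ℂ × ℂ)) := by fun_prop
  have step1 : cls p = cls (mk bH (fun y => Complex.exp (l y) • ((1, 1) : ℂ × ℂ)) hlc
      (fun y _ => smul_ne_zero (Complex.exp_ne_zero _) (by simp))
      (by intro y hy hi; rw [hl0 y hy hi]; simp; rfl)) := by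
    rw [cls_eq]
    refine homotopic_of (fun u y => F u (clamp y)) ?_ ?_ ?_ ?_ ?_
    · exact hF.comp (f := fun w : ℝ × (Fin (m + 2) → ℝ) => (w.1, clamp w.2))
        (continuous_fst.prodMk (continuous_clamp.comp continuous_snd))
    · intro u hu y _
      exact hFne u hu _
    · rintro u hu y hy ⟨i, hi⟩
      exact hFb u hu _ ⟨i, clamp_bd' hi⟩
    · intro y _
      rw [h2]; rfl
    · intro y hy
      rw [ext_mk _ _ _ _ _ hy, hle]
      exact (hopf_fibre (hF1 _)).1
  rw [step1, ← cls_const, cls_eq]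
  refine homotopic_of (fun u y => Complex.exp ((1 - u : ℝ) * l y) • ((1, 1) : ℂ × ℂ)) ?_ ?_ ?_ ?_ ?_
  · fun_prop
  · intro u hu y _
    exact smul_ne_zero (Complex.exp_ne_zero _) (by simp)
  · intro u hu y hy hi
    rw [hl0 y hy hi]; simp; rfl
  · intro y hy
    rw [ext_mk _ _ _ _ _ hy]; simp
  · intro y hy
    simp; rfl

end Pi4
end

open scoped unitInterval Topology Topology.Homotopy
open Set

set_option linter.unusedSectionVars false
noncomputable section
namespace Pi4

/-! ### M6 : generators and two-torsion -/

/-- map of punctured spaces -/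
def pm {E F : Type*} [TopologicalSpace E] [Zero E] [TopologicalSpace F] [Zero F]
    (f : E → F) (hf : Continuous f) (h : ∀ v, f v = 0 → v = 0) : C(P E, P F) :=
  ⟨fun v => ⟨f v.1, fun hv => v.2 (h _ hv)⟩, (hf.comp continuous_subtype_val).subtype_mk _⟩

theorem pimap_congr' {k : ℕ} {E F : Type*} [TopologicalSpace E] [Zero E] [TopologicalSpace F] [Zero F]
    {x : P E} {y : P F} (f g : E → F) (hf hg hf0 hg0) (h : pm f hf hf0 x = y)
    (h' : pm g hg hg0 x = y)
    (H : ℝ → E → F) (hH : Continuous (fun q : ℝ × E => H q.1 q.2)) (hH0 : ∀ u v, H u v = 0 → v = 0)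
    (e0 : ∀ v, H 0 v = f v) (e1 : ∀ v, H 1 v = g v) (hx : ∀ u, H u x.1 = y.1)
    (a : HomotopyGroup (Fin (k + 1)) (P E) x) : pimap (pm f hf hf0) h a = pimap (pm g hg hg0) h' a := by
  refine pimap_congr _ _ h h' ⟨fun q => ⟨H q.1 q.2.1, fun hv => q.2.2 (hH0 _ _ hv)⟩, ?_⟩ ?_ ?_ ?_ a
  · apply Continuous.subtype_mk
    exact hH.comp (f := fun q : I × P E => ((q.1 : ℝ), q.2.1)) (by fun_prop)
  · intro v; apply Subtype.ext; exact e0 v.1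
  · intro v; apply Subtype.ext; exact e1 v.1
  · intro u; apply Subtype.ext; exact hx u

theorem pimap_pm_id {k : ℕ} {E : Type*} [TopologicalSpace E] [Zero E] {x : P E}
    (hf hf0) (h : pm (fun v : E => v) hf hf0 x = x) (a : HomotopyGroup (Fin (k + 1)) (P E) x) :
    pimap (pm (fun v : E => v) hf hf0) h a = a := by
  obtain ⟨p, rfl⟩ := cls_surj a
  rfl

/-- identification of `(ℂ × ℝ) × ℝ` with `ℂ²` -/
def ell (v : (ℂ × ℝ) × ℝ) : ℂ × ℂ := (v.1.1 + ⟨v.1.2, v.2⟩, v.1.1 - ⟨v.1.2, v.2⟩)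

def ellInv (v : ℂ × ℂ) : (ℂ × ℝ) × ℝ :=
  (((v.1 + v.2) / 2, (v.1.re - v.2.re) / 2), (v.1.im - v.2.im) / 2)

theorem ell_cont : Continuous ell := by
  have : ell = fun v => (v.1.1 + (v.1.2 + v.2 * Complex.I), v.1.1 - (v.1.2 + v.2 * Complex.I)) := by
    funext v; simp [ell, Complex.mk_eq_add_mul_I]
  rw [this]; fun_prop

theorem ellInv_cont : Continuous ellInv := by unfold ellInv; fun_prop

theorem ell_inv (v) : ell (ellInv v) = v := by
  refine Prod.ext (Complex.ext ?_ ?_) (Complex.ext ?_ ?_) <;> simp [ell, ellInv] <;> ring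

theorem inv_ell (v) : ellInv (ell v) = v := by
  refine Prod.ext (Prod.ext (Complex.ext ?_ ?_) ?_) ?_ <;> simp [ell, ellInv] <;> ring

theorem ell_zero : ell 0 = 0 := by
  refine Prod.ext (Complex.ext ?_ ?_) (Complex.ext ?_ ?_) <;> simp [ell]

theorem ellInv_zero : ellInv 0 = 0 := by rw [← ell_zero, inv_ell]

def ellC : C(P ((ℂ × ℝ) × ℝ), P (ℂ × ℂ)) :=
  pm ell ell_cont (fun v h => by rw [← inv_ell v, h, ellInv_zero])

def ellInvC : C(P (ℂ × ℂ), P ((ℂ × ℝ) × ℝ)) :=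
  pm ellInv ellInv_cont (fun v h => by rw [← ell_inv v, h, ell_zero])

theorem ellC_base : ellC (sb (sb b1)) = bH := by
  apply Subtype.ext
  change ell ((1, 0), 0) = (1, 1)
  refine Prod.ext (Complex.ext ?_ ?_) (Complex.ext ?_ ?_) <;> simp [ell]

theorem ellInvC_base : ellInvC bH = sb (sb b1) := by
  rw [← ellC_base]
  apply Subtype.ext
  exact inv_ell _

theorem ell_surj (k : ℕ) : Function.Surjective
    (pimap ellC ellC_base : HomotopyGroup (Fin (k + 1)) _ _ →* _) := by
  intro a
  refine ⟨pimap ellInvC ellInvC_base a, ?_⟩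
  obtain ⟨p, rfl⟩ := cls_surj a
  rw [pimap_cls, pimap_cls]
  congr 1
  apply GenLoop.ext
  intro y
  apply Subtype.ext
  exact ell_inv _

theorem ell_inj (k : ℕ) : Function.Injective
    (pimap ellC ellC_base : HomotopyGroup (Fin (k + 1)) _ _ →* _) := by
  apply Function.LeftInverse.injective (g := pimap ellInvC ellInvC_base)
  intro a
  obtain ⟨p, rfl⟩ := cls_surj a
  rw [pimap_cls, pimap_cls]
  congr 1
  apply GenLoop.ext
  intro y
  apply Subtype.ext
  exact inv_ell _

/-- conjugation on the two-sphere -/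
def kap (v : ℂ × ℝ) : ℂ × ℝ := ((starRingEnd ℂ) v.1, v.2)
theorem kap_cont : Continuous kap := by unfold kap; fun_prop
theorem kap_eq {v} (h : kap v = 0) : v = 0 := by
  have h1 := congrArg Prod.fst h
  have h2 := congrArg Prod.snd h
  simp only [kap, Prod.fst_zero, Prod.snd_zero, map_eq_zero] at h1 h2
  exact Prod.ext h1 h2
def kapC : C(P (ℂ × ℝ), P (ℂ × ℝ)) := pm kap kap_cont (fun _ => kap_eq)
theorem kapC_base : kapC (sb b1) = sb b1 := by
  apply Subtype.ext
  change kap (1, 0) = (1, 0)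
  simp [kap]

/-- conjugation on `ℂ²` -/
def kapH (v : ℂ × ℂ) : ℂ × ℂ := ((starRingEnd ℂ) v.1, (starRingEnd ℂ) v.2)
theorem kapH_cont : Continuous kapH := by unfold kapH; fun_prop
theorem kapH_eq {v} (h : kapH v = 0) : v = 0 := by
  have h1 := congrArg Prod.fst h
  have h2 := congrArg Prod.snd h
  simp only [kapH, Prod.fst_zero, Prod.snd_zero, map_eq_zero] at h1 h2
  exact Prod.ext h1 h2
def kapHC : C(P (ℂ × ℂ), P (ℂ × ℂ)) := pm kapH kapH_cont (fun _ => kapH_eq)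
theorem kapHC_base : kapHC bH = bH := by
  apply Subtype.ext
  change kapH (1, 1) = (1, 1)
  simp [kapH]

theorem rot_zero {c s x y : ℝ} (h : c ^ 2 + s ^ 2 = 1) (h1 : c * x - s * y = 0)
    (h2 : s * x + c * y = 0) : x = 0 ∧ y = 0 := by
  constructor
  · linear_combination c * h1 + s * h2 - x * h
  · linear_combination (-s) * h1 + c * h2 - y * h

theorem kapH_id {k : ℕ} (a : HomotopyGroup (Fin (k + 1)) (P (ℂ × ℂ)) bH) :
    pimap kapHC kapHC_base a = a := by
  symm
  refine (pimap_pm_id (E := ℂ × ℂ) (x := bH) continuous_id (fun _ h => h) rfl a).symm.trans ?_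
  refine pimap_congr' _ _ _ _ _ _ _ _ (fun u v =>
    (v.1.re + (Real.cos (Real.pi * u) * v.1.im - Real.sin (Real.pi * u) * v.2.im : ℝ) * Complex.I,
     v.2.re + (Real.sin (Real.pi * u) * v.1.im + Real.cos (Real.pi * u) * v.2.im : ℝ) * Complex.I))
    (by fun_prop) ?_ ?_ ?_ ?_ a
  · intro u v h
    have h1 := congrArg Prod.fst h
    have h2 := congrArg Prod.snd h
    simp only [Prod.fst_zero, Prod.snd_zero] at h1 h2
    have a1 := congrArg Complex.re h1
    have a2 := congrArg Complex.im h1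
    have a3 := congrArg Complex.re h2
    have a4 := congrArg Complex.im h2
    simp only [Complex.add_re, Complex.add_im, Complex.re_ofReal_mul, Complex.im_ofReal_mul,
      Complex.ofReal_re, Complex.ofReal_im, Complex.I_re, Complex.I_im, mul_zero, mul_one, add_zero,
      zero_add, Complex.zero_re, Complex.zero_im] at a1 a2 a3 a4
    have := rot_zero (Real.cos_sq_add_sin_sq _) a2 a4
    exact Prod.ext (Complex.ext a1 this.1) (Complex.ext a3 this.2)
  · intro v
    refine Prod.ext (Complex.ext ?_ ?_) (Complex.ext ?_ ?_) <;> simp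
  · intro v
    refine Prod.ext (Complex.ext ?_ ?_) (Complex.ext ?_ ?_) <;> simp [kapH]
  · intro u
    refine Prod.ext (Complex.ext ?_ ?_) (Complex.ext ?_ ?_) <;> simp [bH]

theorem kap_hopf (v) : kap (hopf v) = hopf (kapH v) := by
  simp [kap, hopf, kapH]

theorem kap_id {k : ℕ} (a : HomotopyGroup (Fin (k + 3)) (P (ℂ × ℝ)) (sb b1)) :
    pimap kapC kapC_base a = a := by
  obtain ⟨b, rfl⟩ := hopf_surj k a
  conv_rhs => rw [← kapH_id b]
  obtain ⟨p, rfl⟩ := cls_surj b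
  simp only [pimap_cls]
  congr 1
  apply GenLoop.ext
  intro y
  apply Subtype.ext
  exact kap_hopf _

/-- reflection and conjugation composed -/
def KJ (v : (ℂ × ℝ) × ℝ) : (ℂ × ℝ) × ℝ := (kap v.1, -v.2)
theorem KJ_cont : Continuous KJ := by
  have := kap_cont
  unfold KJ; fun_prop
theorem KJ_eq {v} (h : KJ v = 0) : v = 0 := by
  have h1 := congrArg Prod.fst h
  have h2 := congrArg Prod.snd h
  simp only [KJ, Prod.snd_zero, neg_eq_zero] at h1 h2
  exact Prod.ext (kap_eq h1) h2
def KJC : C(P ((ℂ × ℝ) × ℝ), P ((ℂ × ℝ) × ℝ)) := pm KJ KJ_cont (fun _ => KJ_eq)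
theorem KJC_base : KJC (sb (sb b1)) = sb (sb b1) := by
  apply Subtype.ext
  change KJ ((1, 0), 0) = ((1, 0), 0)
  simp [KJ, kap]

theorem KJ_id {k : ℕ} (a : HomotopyGroup (Fin (k + 1)) (P ((ℂ × ℝ) × ℝ)) (sb (sb b1))) :
    pimap KJC KJC_base a = a := by
  symm
  refine (pimap_pm_id (E := (ℂ × ℝ) × ℝ) (x := sb (sb b1)) continuous_id (fun _ h => h) rfl a).symm.trans ?_
  refine pimap_congr' _ _ _ _ _ _ _ _ (fun u v =>
    ((v.1.1.re + (Real.cos (Real.pi * u) * v.1.1.im - Real.sin (Real.pi * u) * v.2 : ℝ) * Complex.I,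
      v.1.2), Real.sin (Real.pi * u) * v.1.1.im + Real.cos (Real.pi * u) * v.2))
    (by fun_prop) ?_ ?_ ?_ ?_ a
  · intro u v h
    have h1 := congrArg (fun v => v.1.1) h
    have h3 := congrArg (fun v => v.1.2) h
    have a4 := congrArg (fun v => v.2) h
    have a1 := congrArg Complex.re h1
    have a2 := congrArg Complex.im h1
    simp only [Complex.add_re, Complex.add_im, Complex.re_ofReal_mul, Complex.im_ofReal_mul,
      Complex.ofReal_re, Complex.ofReal_im, Complex.I_re, Complex.I_im, mul_zero, mul_one, add_zero,
      zero_add, Complex.zero_re, Complex.zero_im, Prod.fst_zero, Prod.snd_zero] at a1 a2 h3 a4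
    have := rot_zero (Real.cos_sq_add_sin_sq _) a2 a4
    exact Prod.ext (Prod.ext (Complex.ext a1 this.1) h3) this.2
  · intro v
    refine Prod.ext (Prod.ext (Complex.ext ?_ ?_) ?_) ?_ <;> simp
  · intro v
    refine Prod.ext (Prod.ext (Complex.ext ?_ ?_) ?_) ?_ <;> simp [KJ, kap]
  · intro u
    refine Prod.ext (Prod.ext (Complex.ext ?_ ?_) ?_) ?_ <;> simp [sb, b1]

theorem KJ_susp (n v : ℂ × ℝ) (hn : kap n = n) (s : ℝ) :
    KJ (susp n v s) = susp n (kap v) (1 - s) := by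
  have h1 : ‖kap v - n‖ = ‖v - n‖ := by
    conv_lhs => rw [← hn]
    simp only [kap, Prod.mk_sub_mk, Prod.norm_def, ← map_sub, Complex.norm_conj, Prod.fst_sub,
      Prod.snd_sub]
  have hn1 : (starRingEnd ℂ) n.1 = n.1 := congrArg Prod.fst hn
  unfold KJ susp
  rw [h1]
  refine Prod.ext (Prod.ext ?_ ?_) ?_
  · simp [kap, hn1]
    left
    rw [show (starRingEnd ℂ) 4 = 4 from Complex.conj_ofNat 4]
    ring
  · simp [kap]; left; ring
  · simp; ring

theorem susp_two_torsion {k : ℕ} (a : HomotopyGroup (Fin (k + 3)) (P (ℂ × ℝ)) (sb b1)) :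
    suspHom (k + 2) (sb b1) a = (suspHom (k + 2) (sb b1) a)⁻¹ := by
  have h1 := kap_id a
  obtain ⟨p, rfl⟩ := cls_surj a
  conv_lhs => rw [← KJ_id (suspHom (k + 2) (sb b1) (cls p))]
  conv_rhs => rw [← h1]
  rw [suspHom_cls, pimap_cls, pimap_cls, suspHom_cls, cls_inv 0]
  congr 1
  apply GenLoop.ext
  intro y
  apply Subtype.ext
  rw [GenLoop.symmAt, GenLoop.coe_copy, suspL_apply, gmap_apply, gmap_apply]
  change KJ (suspL p y).1 = _
  rw [suspL_apply, KJ_susp _ _ (by simp [kap, sb, b1])]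
  simp [Fin.succ_ne_zero]
  rfl

/-- the generator -/
def gen4 : HomotopyGroup (Fin 4) (P ((ℂ × ℝ) × ℝ)) (sb (sb b1)) :=
  suspHom 2 (sb b1) (pimap hopfC hopfC_base (pimap ellC ellC_base
    (suspHom 1 (sb b1) (suspHom 0 b1 (cls (E1 1))))))

theorem gen_push {G H : Type*} [Group G] [Group H] (f : G →* H) (hf : Function.Surjective f) (g : G)
    (h : ∀ a, ∃ k : ℤ, a = g ^ k) (b : H) : ∃ k : ℤ, b = f g ^ k := by
  obtain ⟨a, rfl⟩ := hf b
  obtain ⟨k, rfl⟩ := h a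
  exact ⟨k, map_zpow _ _ _⟩

theorem gen4_gen (a : HomotopyGroup (Fin 4) (P ((ℂ × ℝ) × ℝ)) (sb (sb b1))) :
    ∃ k : ℤ, a = gen4 ^ k := by
  have d1 : Module.finrank ℝ ℂ = 2 := Complex.finrank_real_complex
  have d2 : Module.finrank ℝ (ℂ × ℝ) = 3 := by simp [d1]
  have s1 := gen_push (suspHom 0 b1) (suspHom_surj b1 (by rw [d1]; norm_num)) _ pi1_cyclic
  have s2 := gen_push (suspHom 1 (sb b1)) (suspHom_surj (sb b1) (by rw [d2]; norm_num)) _ s1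
  have s3 := gen_push _ (ell_surj 2) _ s2
  have s4 := gen_push _ (hopf_surj 0) _ s3
  exact gen_push (suspHom 2 (sb b1)) (suspHom_surj (sb b1) (by rw [d2]; norm_num)) _ s4 a

theorem gen4_sq : gen4 = gen4⁻¹ := susp_two_torsion (k := 0) _

/-- every element of `π₄` of the three-sphere is trivial or the generator -/
theorem pi4_S3_cases (a : HomotopyGroup (Fin 4) (P ((ℂ × ℝ) × ℝ)) (sb (sb b1))) :
    a = 1 ∨ a = gen4 := by
  obtain ⟨k, rfl⟩ := gen4_gen a
  have h : gen4 ^ (2:ℤ) = 1 := by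
    rw [zpow_two]
    nth_rw 1 [gen4_sq]
    exact inv_mul_cancel _
  rcases Int.even_or_odd' k with ⟨j, rfl | rfl⟩
  · left; rw [zpow_mul, h, one_zpow]
  · right; rw [zpow_add, zpow_mul, h, one_zpow, one_mul, zpow_one]

/-- from the three-sphere to the two-sphere -/
def toS2 : HomotopyGroup (Fin 4) (P ((ℂ × ℝ) × ℝ)) (sb (sb b1)) →*
    HomotopyGroup (Fin 4) (P (ℂ × ℝ)) (sb b1) :=
  (pimap hopfC hopfC_base).comp (pimap ellC ellC_base)

theorem toS2_bij : Function.Bijective toS2 :=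
  ⟨(hopf_inj 2).comp (ell_inj 3), (hopf_surj 1).comp (ell_surj 3)⟩

end Pi4
end

open scoped unitInterval Topology Topology.Homotopy
open Set

set_option linter.unusedSectionVars false
noncomputable section
namespace Pi4

/-! ### M7 : combinatorial degree mod two -/

open Classical in
/-- indicator in `ZMod 2` -/
def ind (p : Prop) : ZMod 2 := if p then 1 else 0

theorem ind_true {p : Prop} (h : p) : ind p = 1 := if_pos h
theorem ind_false {p : Prop} (h : ¬ p) : ind p = 0 := if_neg h
theorem ind_congr {p q : Prop} (h : p ↔ q) : ind p = ind q := by rw [propext h]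

theorem z2_add_self (a : ZMod 2) : a + a = 0 := CharTwo.add_self_eq_zero a

theorem z2_eq_of_add {a b : ZMod 2} (h : a + b = 0) : a = b := by
  have := z2_add_self b
  calc a = a + (b + b) := by rw [this, add_zero]
    _ = (a + b) + b := by ring
    _ = b := by rw [h, zero_add]

/-- a sequence of `n+2` labels in `Fin (n+1)` has an even number of full facets -/
theorem doors {n : ℕ} (l : Fin (n + 2) → Fin (n + 1)) :
    ∑ k : Fin (n + 2), ind (Function.Bijective (fun j => l (k.succAbove j))) = 0 := by
  by_cases hex : ∃ k : Fin (n + 2), Function.Bijective (fun j => l (k.succAbove j))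
  · obtain ⟨k, hk⟩ := hex
    obtain ⟨j, hj⟩ := hk.2 (l k)
    simp only at hj
    set k' := k.succAbove j with hk'
    have hne : k' ≠ k := Fin.succAbove_ne _ _
    have hk2 : Function.Bijective (fun j => l (k'.succAbove j)) := by
      rw [← Finite.surjective_iff_bijective]
      intro y
      obtain ⟨i, hi⟩ := hk.2 y
      simp only at hi
      by_cases h : k.succAbove i = k'
      · obtain ⟨i', hi'⟩ := Fin.exists_succAbove_eq hne.symm
        refine ⟨i', ?_⟩
        simp only
        rw [hi', ← hj, ← h, hi]
      · obtain ⟨i', hi'⟩ := Fin.exists_succAbove_eq h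
        exact ⟨i', by simp only; rw [hi', hi]⟩
    rw [← Finset.add_sum_erase _ _ (Finset.mem_univ k), ← Finset.add_sum_erase _ _
      (Finset.mem_erase.2 ⟨hne, Finset.mem_univ k'⟩), ind_true hk, ind_true hk2,
      Finset.sum_eq_zero]
    · exact z2_add_self 1
    · intro k'' hk''
      simp only [Finset.mem_erase, Finset.mem_univ, and_true] at hk''
      apply ind_false
      intro hb
      obtain ⟨i, hi⟩ := Fin.exists_succAbove_eq hk''.1.symm
      obtain ⟨i', hi'⟩ := Fin.exists_succAbove_eq hk''.2.symm
      have : i = i' := hb.1 (by simp only; rw [hi, hi', hj])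
      apply hne
      rw [← hi, ← hi', this]
  · push Not at hex
    exact Finset.sum_eq_zero (fun k _ => ind_false (hex k))

/-- vertices of a Kuhn simplex -/
def vtx {d : ℕ} (v : Fin d → ℕ) (π : Equiv.Perm (Fin d)) (j : ℕ) : Fin d → ℕ :=
  fun i => v i + if (π.symm i : ℕ) < j then 1 else 0

/-- combinatorial degree -/
def D {n : ℕ} (m : ℕ) (l : (Fin n → ℕ) → Fin (n + 1)) (pos : (Fin n → ℕ) → Prop) : ZMod 2 :=
  ∑ v : Fin n → Fin m, ∑ π : Equiv.Perm (Fin n),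
    ind (Function.Bijective (fun j : Fin (n + 1) => l (vtx (fun i => (v i : ℕ)) π j)) ∧
      pos (fun i => (v i : ℕ)))

/-- assemble a permutation from its first value -/
def consPerm {n : ℕ} (q : Fin (n + 1) × Equiv.Perm (Fin n)) : Equiv.Perm (Fin (n + 1)) :=
  (finSuccEquiv' 0).trans ((Equiv.optionCongr q.2).trans (finSuccEquiv' q.1).symm)

theorem consPerm_zero {n : ℕ} (q : Fin (n + 1) × Equiv.Perm (Fin n)) : consPerm q 0 = q.1 := by
  simp [consPerm]

theorem consPerm_succ {n : ℕ} (q : Fin (n + 1) × Equiv.Perm (Fin n)) (j : Fin n) :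
    consPerm q j.succ = q.1.succAbove (q.2 j) := by
  rw [← Fin.succAbove_zero]
  simp only [consPerm, Equiv.trans_apply, finSuccEquiv'_succAbove]
  simp

theorem consPerm_bij {n : ℕ} : Function.Bijective (consPerm (n := n)) := by
  rw [Fintype.bijective_iff_injective_and_card]
  constructor
  · rintro ⟨c, e⟩ ⟨c', e'⟩ h
    have h0 := consPerm_zero (c, e)
    rw [h, consPerm_zero] at h0
    simp only at h0
    subst h0
    congr 1
    ext j
    have h1 := consPerm_succ (c', e) j
    rw [h, consPerm_succ] at h1
    simp only at h1
    rw [Fin.succAbove_right_injective h1]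
  · simp [Fintype.card_perm, Nat.factorial_succ]

theorem consPerm_symm_self {n : ℕ} (q : Fin (n + 1) × Equiv.Perm (Fin n)) :
    (consPerm q).symm q.1 = 0 := by
  rw [Equiv.symm_apply_eq, consPerm_zero]

theorem consPerm_symm_succAbove {n : ℕ} (q : Fin (n + 1) × Equiv.Perm (Fin n)) (i : Fin n) :
    (consPerm q).symm (q.1.succAbove i) = (q.2.symm i).succ := by
  rw [Equiv.symm_apply_eq, consPerm_succ, Equiv.apply_symm_apply]

/-- vertices of the face opposite to vertex zero -/
theorem vtx_face0 {n : ℕ} (q : Fin (n + 1) × Equiv.Perm (Fin n)) (t : ℕ) (w : Fin n → ℕ) (j : ℕ) :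
    vtx (q.1.insertNth (α := fun _ => ℕ) t w) (consPerm q) (j + 1) =
      q.1.insertNth (α := fun _ => ℕ) (t + 1) (vtx w q.2 j) := by
  funext i
  refine Fin.succAboveCases (α := fun i => vtx (q.1.insertNth (α := fun _ => ℕ) t w) (consPerm q) (j + 1) i =
      (q.1.insertNth (α := fun _ => ℕ) (t + 1) (vtx w q.2 j) : Fin (n + 1) → ℕ) i) q.1 ?_ (fun i => ?_) i
  · simp [vtx, consPerm_symm_self]
  · simp [vtx, consPerm_symm_succAbove]

/-- vertices of the face opposite to the last vertex -/
theorem vtx_faceLast {n : ℕ} (q : Fin (n + 1) × Equiv.Perm (Fin n)) (t : ℕ) (w : Fin n → ℕ) (j : ℕ)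
    (hj : j ≤ n) :
    vtx (q.1.insertNth (α := fun _ => ℕ) t w) ((finRotate (n + 1)).trans (consPerm q)) j =
      q.1.insertNth (α := fun _ => ℕ) t (vtx w q.2 j) := by
  funext i
  refine Fin.succAboveCases (α := fun i => vtx (q.1.insertNth (α := fun _ => ℕ) t w) ((finRotate (n + 1)).trans (consPerm q)) j i =
      (q.1.insertNth (α := fun _ => ℕ) t (vtx w q.2 j) : Fin (n + 1) → ℕ) i) q.1 ?_ (fun i => ?_) i
  · have : (finRotate (n + 1)).symm 0 = Fin.last n := by
      rw [Equiv.symm_apply_eq, finRotate_last]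
    simp [vtx, consPerm_symm_self, this, hj]
  · have : (finRotate (n + 1)).symm (q.2.symm i).succ = (q.2.symm i).castSucc := by
      rw [Equiv.symm_apply_eq, finRotate_succ_apply]
      simp
    simp [vtx, consPerm_symm_succAbove, this]

theorem sum_insertNth {n m : ℕ} (c : Fin (n + 1)) (g : (Fin (n + 1) → ℕ) → ZMod 2) :
    ∑ v : Fin (n + 1) → Fin m, g (fun i => (v i : ℕ)) =
      ∑ w : Fin n → Fin m, ∑ t : Fin m, g (c.insertNth (α := fun _ => ℕ) (t : ℕ) (fun i => (w i : ℕ))) := by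
  rw [← (Fin.insertNthEquiv (fun _ => Fin m) c).sum_comp, Fintype.sum_prod_type, Finset.sum_comm]
  refine Finset.sum_congr rfl fun w _ => Finset.sum_congr rfl fun t _ => ?_
  congr 1
  funext i
  refine Fin.succAboveCases (α := fun i => ((Fin.insertNthEquiv (fun _ => Fin m) c (t, w)) i : ℕ) = (c.insertNth (α := fun _ => ℕ) (t : ℕ) (fun i => (w i : ℕ)) : Fin (n + 1) → ℕ) i) c ?_ (fun i => ?_) i
  · simp [Fin.insertNthEquiv]
  · simp [Fin.insertNthEquiv]

theorem telescope (m : ℕ) (g : ℕ → ZMod 2) :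
    ∑ t : Fin m, (g (t + 1) + g t) = g m + g 0 := by
  rw [Fin.sum_univ_eq_sum_range (fun t => g (t + 1) + g t)]
  induction m with
  | zero => simp [z2_add_self]
  | succ m ih =>
    rw [Finset.sum_range_succ, ih]
    have := z2_add_self (g m)
    linear_combination this

/-- combinatorial Stokes theorem -/
theorem comb_stokes {n m : ℕ} (l : (Fin (n + 1) → ℕ) → Fin (n + 1))
    (pos : (Fin (n + 1) → ℕ) → Prop)
    (H : ∀ (v : Fin (n + 1) → Fin m) (π : Equiv.Perm (Fin (n + 1))),
      Function.Bijective (fun j : Fin (n + 1) => l (vtx (fun i => (v i : ℕ)) π (j + 1))) →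
      (pos (vtx (fun i => (v i : ℕ)) π 0) ↔ pos (vtx (fun i => (v i : ℕ)) π 1))) :
    ∑ c : Fin (n + 1),
      (D m (fun w => l (c.insertNth (α := fun _ => ℕ) m w)) (fun w => pos (c.insertNth (α := fun _ => ℕ) m w)) +
       D m (fun w => l (c.insertNth (α := fun _ => ℕ) 0 w)) (fun w => pos (c.insertNth (α := fun _ => ℕ) 0 w))) = 0 := by
  -- the total sum over simplices and facets
  have total : ∀ (v : Fin (n + 1) → Fin m),
      ∑ π : Equiv.Perm (Fin (n + 1)), ∑ k : Fin (n + 2),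
        ind (Function.Bijective (fun j : Fin (n + 1) => l (vtx (fun i => (v i : ℕ)) π (k.succAbove j))) ∧
          pos (fun i => (v i : ℕ))) = 0 := by
    intro v
    apply Finset.sum_eq_zero
    intro π _
    by_cases hp : pos (fun i => (v i : ℕ))
    · simp only [hp, and_true]
      exact doors (fun k : Fin (n + 2) => l (vtx (fun i => (v i : ℕ)) π k))
    · simp only [hp, and_false]
      exact Finset.sum_eq_zero (fun _ _ => ind_false id)
  -- interior facets cancel
  have interior : ∀ (v : Fin (n + 1) → Fin m) (k : Fin n),
      ∑ π : Equiv.Perm (Fin (n + 1)),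
        ind (Function.Bijective (fun j : Fin (n + 1) =>
          l (vtx (fun i => (v i : ℕ)) π (k.castSucc.succ.succAbove j))) ∧
          pos (fun i => (v i : ℕ))) = 0 := by
    intro v k
    have key : ∀ (π : Equiv.Perm (Fin (n + 1))) (j : Fin (n + 2)), j ≠ k.castSucc.succ →
        vtx (fun i => (v i : ℕ)) ((Equiv.swap k.castSucc k.succ).trans π) j =
        vtx (fun i => (v i : ℕ)) π j := by
      intro π j hj
      funext i
      simp only [vtx, Equiv.symm_trans_apply, Equiv.symm_swap]
      congr 2
      rw [eq_iff_iff]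
      have hj' : (j : ℕ) ≠ k + 1 := by
        intro h; apply hj; ext; simp [h]
      rw [Equiv.swap_apply_def]
      split_ifs with h1 h2
      · rw [h1]; simp; omega
      · rw [h2]; simp; omega
      · rfl
    refine Finset.sum_involution (fun π _ => (Equiv.swap k.castSucc k.succ).trans π) ?_ ?_ ?_ ?_
    · intro π _
      simp only [key π _ (Fin.succAbove_ne _ _)]
      exact z2_add_self _
    · intro π _ _ h
      have h2 : (Equiv.swap k.castSucc k.succ).trans π k.castSucc = π k.castSucc := by
        rw [h]
      simp only [Equiv.trans_apply, Equiv.swap_apply_left] at h2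
      have := π.injective h2
      rw [Fin.ext_iff] at this
      simp at this
    · intro _ _; exact Finset.mem_univ _
    · intro π _
      ext i
      simp
  have split : ∑ v : Fin (n + 1) → Fin m, ∑ π : Equiv.Perm (Fin (n + 1)),
      (ind (Function.Bijective (fun j : Fin (n + 1) => l (vtx (fun i => (v i : ℕ)) π (j + 1))) ∧
          pos (fun i => (v i : ℕ))) +
       ind (Function.Bijective (fun j : Fin (n + 1) => l (vtx (fun i => (v i : ℕ)) π j)) ∧
          pos (fun i => (v i : ℕ)))) = 0 := by
    apply Finset.sum_eq_zero
    intro v _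
    have h := total v
    rw [Finset.sum_comm, Fin.sum_univ_succ, Fin.sum_univ_castSucc, Finset.sum_eq_zero
      (fun k _ => interior v k), zero_add, ← Finset.sum_add_distrib] at h
    rw [← h]
    refine Finset.sum_congr rfl fun π _ => ?_
    simp only [Fin.zero_succAbove, Fin.succ_last, Fin.succAbove_last, Fin.val_succ, Fin.val_castSucc]
  let G : Fin (n + 1) × Equiv.Perm (Fin n) → (Fin n → Fin m) → ℕ → ZMod 2 := fun q w t =>
    ind (Function.Bijective (fun j : Fin (n + 1) =>
        l (q.1.insertNth (α := fun _ => ℕ) t (vtx (fun i => (w i : ℕ)) q.2 j))) ∧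
      pos (q.1.insertNth (α := fun _ => ℕ) t (fun i => (w i : ℕ))))
  have vz : ∀ (v : Fin (n + 1) → ℕ) π, vtx v π 0 = v := by
    intro v π; funext i; simp [vtx]
  have vz' : ∀ (v : Fin n → ℕ) π, vtx v π 0 = v := by
    intro v π; funext i; simp [vtx]
  have hA : ∑ v : Fin (n + 1) → Fin m, ∑ π : Equiv.Perm (Fin (n + 1)),
      ind (Function.Bijective (fun j : Fin (n + 1) => l (vtx (fun i => (v i : ℕ)) π (j + 1))) ∧
          pos (fun i => (v i : ℕ))) = ∑ q, ∑ w, ∑ t : Fin m, G q w (t + 1) := by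
    have e1 : ∀ v : Fin (n + 1) → Fin m, ∀ π : Equiv.Perm (Fin (n + 1)),
      ind (Function.Bijective (fun j : Fin (n + 1) => l (vtx (fun i => (v i : ℕ)) π (j + 1))) ∧
          pos (fun i => (v i : ℕ))) =
      ind (Function.Bijective (fun j : Fin (n + 1) => l (vtx (fun i => (v i : ℕ)) π (j + 1))) ∧
          pos (vtx (fun i => (v i : ℕ)) π 1)) := by
      intro v π
      apply ind_congr
      refine and_congr_right fun hb => ?_
      rw [← H v π hb, vz]
    simp only [e1]
    rw [Finset.sum_comm, ← consPerm_bij.sum_comp]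
    refine Finset.sum_congr rfl fun q _ => ?_
    rw [sum_insertNth q.1 (fun v => ind (Function.Bijective (fun j : Fin (n + 1) => l (vtx v (consPerm q) (j + 1))) ∧
          pos (vtx v (consPerm q) 1)))]
    refine Finset.sum_congr rfl fun w _ => Finset.sum_congr rfl fun t _ => ?_
    have := vtx_face0 q t (fun i => (w i : ℕ)) 0
    rw [zero_add, vz'] at this
    simp only [vtx_face0, this, G]
  have hB : ∑ v : Fin (n + 1) → Fin m, ∑ π : Equiv.Perm (Fin (n + 1)),
      ind (Function.Bijective (fun j : Fin (n + 1) => l (vtx (fun i => (v i : ℕ)) π j)) ∧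
          pos (fun i => (v i : ℕ))) = ∑ q, ∑ w, ∑ t : Fin m, G q w t := by
    rw [Finset.sum_comm, ← Equiv.sum_comp (Equiv.mulRight (finRotate (n + 1))), ← consPerm_bij.sum_comp]
    refine Finset.sum_congr rfl fun q _ => ?_
    rw [sum_insertNth q.1 (fun v => ind (Function.Bijective (fun j : Fin (n + 1) => l (vtx v ((Equiv.mulRight (finRotate (n + 1))) (consPerm q)) j)) ∧
          pos v))]
    refine Finset.sum_congr rfl fun w _ => Finset.sum_congr rfl fun t _ => ?_
    have e2 : (Equiv.mulRight (finRotate (n + 1))) (consPerm q) = (finRotate (n + 1)).trans (consPerm q) := rfl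
    simp only [e2, G]
    have e3 : ∀ j : Fin (n + 1), vtx (q.1.insertNth (α := fun _ => ℕ) (t : ℕ) (fun i => (w i : ℕ))) ((finRotate (n + 1)).trans (consPerm q)) j = q.1.insertNth (α := fun _ => ℕ) (t : ℕ) (vtx (fun i => (w i : ℕ)) q.2 j) :=
      fun j => vtx_faceLast q t _ j (by omega)
    simp only [e3]
  simp only [Finset.sum_add_distrib] at split
  rw [hA, hB, ← Finset.sum_add_distrib] at split
  rw [← split, Fintype.sum_prod_type]
  refine Finset.sum_congr rfl fun c _ => ?_
  simp only [← Finset.sum_add_distrib, telescope]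
  rw [Finset.sum_comm]
  simp only [Finset.sum_add_distrib]
  rfl

end Pi4
end

open scoped unitInterval Topology Topology.Homotopy
open Set

set_option linter.unusedSectionVars false
noncomputable section
namespace Pi4

/-! ### M7b : the mod two degree of a map -/

open Filter

/-- a label is valid for the vector `γ` -/
def Valid {n : ℕ} (γ : Fin n → ℝ) (i : Fin (n + 1)) : Prop :=
  (∀ j : Fin n, i = j.castSucc → 0 ≤ γ j) ∧ (i = Fin.last n → ∀ j, γ j ≤ 0)

theorem exists_lab {n : ℕ} (γ : Fin n → ℝ) : ∃ i : Fin (n + 1),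
    (∀ j : Fin n, j.castSucc < i → γ j < 0) ∧ (∀ j : Fin n, i = j.castSucc → 0 ≤ γ j) := by
  classical
  by_cases h : ∃ k : ℕ, ∃ hk : k < n, 0 ≤ γ ⟨k, hk⟩
  · obtain ⟨hk, h0⟩ := Nat.find_spec h
    refine ⟨(⟨Nat.find h, hk⟩ : Fin n).castSucc, ?_, ?_⟩
    · intro j hj
      have := Nat.find_min h (m := j) (by simpa [Fin.lt_def] using hj)
      push Not at this
      exact this j.2
    · intro j hj
      rw [← Fin.castSucc_injective _ hj]
      exact h0
  · push Not at h
    refine ⟨Fin.last n, fun j _ => h j j.2, fun j hj => ?_⟩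
    exact absurd hj.symm (Fin.castSucc_lt_last j).ne

/-- canonical label -/
def lab {n : ℕ} (γ : Fin n → ℝ) : Fin (n + 1) := Classical.choose (exists_lab γ)

theorem lab_lt {n : ℕ} (γ : Fin n → ℝ) (j : Fin n) (h : j.castSucc < lab γ) : γ j < 0 :=
  (Classical.choose_spec (exists_lab γ)).1 j h

theorem lab_eq {n : ℕ} (γ : Fin n → ℝ) (j : Fin n) (h : lab γ = j.castSucc) : 0 ≤ γ j :=
  (Classical.choose_spec (exists_lab γ)).2 j h

theorem lab_valid {n : ℕ} (γ : Fin n → ℝ) : Valid γ (lab γ) := by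
  refine ⟨lab_eq γ, fun h j => (lab_lt γ j ?_).le⟩
  rw [h]; exact Fin.castSucc_lt_last j

/-- grid points -/
def pt {d : ℕ} (m : ℕ) (v : Fin d → ℕ) : Fin d → ℝ := fun i => (v i : ℝ) / m

theorem pt_mem {d m : ℕ} (v : Fin d → ℕ) (h : ∀ i, v i ≤ m) : pt m v ∈ Q d := by
  intro i
  refine ⟨by simp only [pt]; positivity, ?_⟩
  simp only [pt]
  have : (v i : ℝ) ≤ m := by exact_mod_cast h i
  exact div_le_one_of_le₀ this (by positivity)

theorem vtx_le {d m : ℕ} (v : Fin d → Fin m) (π : Equiv.Perm (Fin d)) (j : ℕ) (i : Fin d) :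
    vtx (fun i => (v i : ℕ)) π j i ≤ m := by
  have := (v i).2
  simp only [vtx]; split_ifs <;> omega

theorem vtx_zero {d : ℕ} (v : Fin d → ℕ) (π : Equiv.Perm (Fin d)) : vtx v π 0 = v := by
  funext i; simp [vtx]

theorem pt_dist {d m : ℕ} (v : Fin d → ℕ) (π : Equiv.Perm (Fin d)) (j k : ℕ) :
    dist (pt m (vtx v π j)) (pt m (vtx v π k)) ≤ 1 / m := by
  rw [dist_pi_le_iff (by positivity)]
  intro i
  rw [Real.dist_eq]
  simp only [pt, vtx]
  rw [← sub_div, abs_div, Nat.abs_cast]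
  gcongr
  push_cast
  rw [abs_le]
  split_ifs <;> norm_num

theorem core1 {n d : ℕ} (Γ : (Fin d → ℝ) → (Fin n → ℝ)) (φ : (Fin d → ℝ) → ℝ)
    (hΓ : Continuous Γ) (hφ : Continuous φ) (h : ∀ y ∈ Q d, Γ y = 0 → 0 < φ y) :
    ∃ δ > 0, ∃ η > 0, ∀ a ∈ Q d, ∀ p : Fin (n + 1) → (Fin d → ℝ), (∀ i, p i ∈ Q d) →
      (∀ i, dist (p i) a < δ) → (∀ i, Valid (Γ (p i)) i) → η ≤ φ a := by
  have hQ : IsCompact (Q d) := isCompact_Q d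
  have hg : ∀ y ∈ Q d, 0 < max ‖Γ y‖ (φ y) := by
    intro y hy
    by_cases h0 : Γ y = 0
    · exact lt_max_of_lt_right (h y hy h0)
    · exact lt_max_of_lt_left (norm_pos_iff.2 h0)
  have hgc : Continuous (fun y => max ‖Γ y‖ (φ y)) := by fun_prop
  obtain ⟨η, hη, hη2⟩ : ∃ η > 0, ∀ y ∈ Q d, η ≤ max ‖Γ y‖ (φ y) := by
    obtain he | hne := (Q d).eq_empty_or_nonempty
    · exact ⟨1, one_pos, by simp [he]⟩
    · obtain ⟨x, hx, hx2⟩ := hQ.exists_isMinOn hne hgc.continuousOn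
      exact ⟨_, hg x hx, fun y hy => hx2 hy⟩
  have hu := hQ.uniformContinuousOn_of_continuous hΓ.continuousOn
  rw [Metric.uniformContinuousOn_iff] at hu
  obtain ⟨δ, hδ, hu⟩ := hu (η / 2) (by linarith)
  refine ⟨δ, hδ, η, hη, fun a ha p hp hpa hv => ?_⟩
  have hle : ‖Γ a‖ ≤ η / 2 := by
    rw [pi_norm_le_iff_of_nonneg (by linarith)]
    intro i
    have key : ∀ k, |Γ (p k) i - Γ a i| < η / 2 := by
      intro k
      have h1 := hu (p k) (hp k) a ha (hpa k)
      have h2 := dist_le_pi_dist (Γ (p k)) (Γ a) i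
      rw [Real.dist_eq] at h2
      linarith
    have h1 := (hv i.castSucc).1 i rfl
    have h2 := (hv (Fin.last n)).2 rfl i
    have k1 := abs_lt.1 (key i.castSucc)
    have k2 := abs_lt.1 (key (Fin.last n))
    rw [Real.norm_eq_abs, abs_le]
    constructor <;> linarith
  have := hη2 a ha
  rcases le_max_iff.1 this with h | h
  · linarith
  · exact h

theorem face_vanish {n : ℕ} (Γ : (Fin n → ℝ) → (Fin n → ℝ)) (ρ : (Fin n → ℝ) → ℝ)
    (hΓ : Continuous Γ) (hρ : Continuous ρ) (h : ∀ y ∈ Q n, Γ y = 0 → ρ y < 0) :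
    ∀ᶠ m : ℕ in atTop, ∀ l : (Fin n → ℕ) → Fin (n + 1),
      (∀ v, (∀ i, v i ≤ m) → Valid (Γ (pt m v)) (l v)) →
      D m l (fun v => 0 < ρ (pt m v)) = 0 := by
  obtain ⟨δ, hδ, η, hη, hc⟩ := core1 Γ (fun y => - ρ y) hΓ hρ.neg
    (fun y hy h0 => by linarith [h y hy h0])
  have h1 : ∀ᶠ m : ℕ in atTop, 1 / (m : ℝ) < δ :=
    (tendsto_one_div_atTop_nhds_zero_nat (𝕜 := ℝ)).eventually (gt_mem_nhds hδ)
  filter_upwards [h1] with m hm l hl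
  refine Finset.sum_eq_zero fun v _ => Finset.sum_eq_zero fun π _ => ind_false ?_
  rintro ⟨hb, hp⟩
  choose g hg using hb.2
  have := hc (pt m (fun i => (v i : ℕ))) (pt_mem _ fun i => (v i).2.le)
    (fun i => pt m (vtx (fun i => (v i : ℕ)) π (g i))) (fun i => pt_mem _ (vtx_le v π _))
    (fun i => by
      have := pt_dist (m := m) (fun i => (v i : ℕ)) π (g i) 0
      rw [vtx_zero] at this
      exact this.trans_lt hm)
    (fun i => by
      have := hl _ (vtx_le v π (g i))
      have e := hg i
      simp only at e
      rwa [e] at this)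
  linarith

/-- faces of the cube -/
def face {n : ℕ} (m : ℕ) (f : Fin (n + 1) × Bool) (w : Fin n → ℕ) : Fin (n + 1) → ℕ :=
  f.1.insertNth (α := fun _ => ℕ) (if f.2 then m else 0) w

/-- faces of the cube, real version -/
def rface {n : ℕ} (f : Fin (n + 1) × Bool) (w : Fin n → ℝ) : Fin (n + 1) → ℝ :=
  f.1.insertNth (α := fun _ => ℝ) (if f.2 then 1 else 0) w

theorem pt_face {n m : ℕ} (hm : 0 < m) (f : Fin (n + 1) × Bool) (w : Fin n → ℕ) :
    pt m (face m f w) = rface f (pt m w) := by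
  have : (m : ℝ) ≠ 0 := by positivity
  obtain ⟨c, b⟩ := f
  rw [rface, Fin.eq_insertNth_iff]
  constructor
  · cases b <;> simp [pt, face, this]
  · funext i; simp [pt, face, Fin.removeNth]

theorem rface_cont {n : ℕ} (f : Fin (n + 1) × Bool) : Continuous (rface f) := by
  unfold rface
  exact Continuous.finInsertNth _ continuous_const continuous_id

theorem face_le {n m : ℕ} (f : Fin (n + 1) × Bool) (w : Fin n → ℕ) (h : ∀ i, w i ≤ m) (i) :
    face m f w i ≤ m := by
  obtain ⟨c, b⟩ := f
  refine Fin.succAboveCases (α := fun i => face m (c, b) w i ≤ m) c ?_ (fun i => ?_) i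
  · cases b <;> simp [face]
  · simpa [face] using h i

theorem rface_mem {n : ℕ} (f : Fin (n + 1) × Bool) (w : Fin n → ℝ) (h : w ∈ Q n) :
    rface f w ∈ Q (n + 1) := by
  obtain ⟨c, b⟩ := f
  intro i
  refine Fin.succAboveCases (α := fun i => 0 ≤ rface (c, b) w i ∧ rface (c, b) w i ≤ 1) c ?_ (fun i => ?_) i
  · cases b <;> simp [rface]
  · simpa [rface] using h i

theorem stokes_two {n : ℕ} (Γ : (Fin (n + 1) → ℝ) → (Fin n → ℝ)) (ρ : (Fin (n + 1) → ℝ) → ℝ)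
    (hΓ : Continuous Γ) (hρ : Continuous ρ) (h : ∀ y ∈ Q (n + 1), Γ y = 0 → ρ y ≠ 0)
    (f₁ f₂ : Fin (n + 1) × Bool) (hf : f₁ ≠ f₂)
    (hb : ∀ y ∈ Q (n + 1), ∀ f : Fin (n + 1) × Bool, f ≠ f₁ → f ≠ f₂ →
      y f.1 = (if f.2 then 1 else 0) → Γ y = 0 → ρ y < 0) :
    ∀ᶠ m : ℕ in atTop, ∀ l : (Fin (n + 1) → ℕ) → Fin (n + 1),
      (∀ v, (∀ i, v i ≤ m) → Valid (Γ (pt m v)) (l v)) →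
      D m (fun w => l (face m f₁ w)) (fun w => 0 < ρ (pt m (face m f₁ w))) =
      D m (fun w => l (face m f₂ w)) (fun w => 0 < ρ (pt m (face m f₂ w))) := by
  obtain ⟨δ, hδ, η, hη, hc⟩ := core1 Γ (fun y => |ρ y|) hΓ hρ.abs
    (fun y hy h0 => abs_pos.2 (h y hy h0))
  have hu := (isCompact_Q (n + 1)).uniformContinuousOn_of_continuous hρ.continuousOn
  rw [Metric.uniformContinuousOn_iff] at hu
  obtain ⟨δ', hδ', hu⟩ := hu η hη
  have h1 : ∀ᶠ m : ℕ in atTop, 1 / (m : ℝ) < min δ δ' :=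
    (tendsto_one_div_atTop_nhds_zero_nat (𝕜 := ℝ)).eventually (gt_mem_nhds (lt_min hδ hδ'))
  have h2 : ∀ᶠ m : ℕ in atTop, ∀ f : Fin (n + 1) × Bool, f ≠ f₁ → f ≠ f₂ →
      ∀ l : (Fin n → ℕ) → Fin (n + 1),
      (∀ v, (∀ i, v i ≤ m) → Valid (Γ (rface f (pt m v))) (l v)) →
      D m l (fun v => 0 < ρ (rface f (pt m v))) = 0 := by
    rw [eventually_all]
    intro f
    by_cases hf1 : f = f₁
    · simp [hf1]
    by_cases hf2 : f = f₂
    · simp [hf2]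
    filter_upwards [face_vanish (fun y => Γ (rface f y)) (fun y => ρ (rface f y))
      (hΓ.comp (rface_cont f)) (hρ.comp (rface_cont f)) (fun y hy h0 =>
        hb _ (rface_mem f y hy) f hf1 hf2 (by simp [rface]) h0)] with m hm _ _ l hl
    exact hm l hl
  filter_upwards [h1, h2, eventually_gt_atTop 0] with m hm1 hm2 hm0 l hl
  have st := comb_stokes (m := m) l (fun v => 0 < ρ (pt m v)) (by
    intro v π hbij
    choose g hg using hbij.2
    have h3 := hc (pt m (vtx (fun i => (v i : ℕ)) π 0)) (pt_mem _ (vtx_le v π _))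
      (fun i => pt m (vtx (fun i => (v i : ℕ)) π (g i + 1))) (fun i => pt_mem _ (vtx_le v π _))
      (fun i => ((pt_dist (m := m) (fun i => (v i : ℕ)) π (g i + 1) 0).trans_lt hm1).trans_le (min_le_left _ _))
      (fun i => by
        have := hl _ (vtx_le v π (g i + 1))
        have e := hg i
        simp only at e
        rwa [e] at this)
    have h4 := hu (pt m (vtx (fun i => (v i : ℕ)) π 0)) (pt_mem _ (vtx_le v π _))
      (pt m (vtx (fun i => (v i : ℕ)) π 1)) (pt_mem _ (vtx_le v π _))
      (((pt_dist (m := m) (fun i => (v i : ℕ)) π 0 1).trans_lt hm1).trans_le (min_le_right _ _))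
    rw [Real.dist_eq, abs_lt] at h4
    rcases le_abs.1 h3 with h5 | h5 <;> constructor <;> intro h6 <;> linarith)
  have st2 : ∑ f : Fin (n + 1) × Bool, D m (fun w => l (face m f w)) (fun w => 0 < ρ (pt m (face m f w))) = 0 := by
    rw [Fintype.sum_prod_type]
    simp only [Fintype.sum_bool]
    exact st
  rw [← Finset.add_sum_erase _ _ (Finset.mem_univ f₁), ← Finset.add_sum_erase _ _
      (Finset.mem_erase.2 ⟨hf.symm, Finset.mem_univ f₂⟩), Finset.sum_eq_zero, add_zero] at st2
  · exact z2_eq_of_add st2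
  · intro f hf'
    simp only [Finset.mem_erase, Finset.mem_univ, and_true] at hf'
    have := hm2 f hf'.2 hf'.1 (fun w => l (face m f w)) (fun v hv => by
      rw [← pt_face hm0]; exact hl _ (face_le f v hv))
    simpa only [← pt_face hm0] using this

theorem face_zero {n m : ℕ} (b : Bool) (w : Fin n → ℕ) :
    face m (0, b) w = Fin.cons (α := fun _ => ℕ) (if b then m else 0) w := by
  simp [face]

theorem prism {n : ℕ} (Γ : ℝ → (Fin n → ℝ) → (Fin n → ℝ)) (ρ : ℝ → (Fin n → ℝ) → ℝ)
    (hΓ : Continuous fun q : ℝ × (Fin n → ℝ) => Γ q.1 q.2)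
    (hρ : Continuous fun q : ℝ × (Fin n → ℝ) => ρ q.1 q.2)
    (h : ∀ u, 0 ≤ u → u ≤ 1 → ∀ y ∈ Q n, Γ u y = 0 → ρ u y ≠ 0)
    (hb : ∀ u, 0 ≤ u → u ≤ 1 → ∀ y ∈ Q n, ∀ i, y i = 0 ∨ y i = 1 → Γ u y = 0 → ρ u y < 0) :
    ∀ᶠ m : ℕ in atTop, ∀ l₀ l₁ : (Fin n → ℕ) → Fin (n + 1),
      (∀ v, (∀ i, v i ≤ m) → Valid (Γ 0 (pt m v)) (l₀ v)) →
      (∀ v, (∀ i, v i ≤ m) → Valid (Γ 1 (pt m v)) (l₁ v)) →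
      D m l₀ (fun v => 0 < ρ 0 (pt m v)) = D m l₁ (fun v => 0 < ρ 1 (pt m v)) := by
  have ht : Continuous fun y : Fin (n + 1) → ℝ => (y 0, fun i : Fin n => y i.succ) := by fun_prop
  have := stokes_two (fun y => Γ (y 0) (fun i => y i.succ)) (fun y => ρ (y 0) (fun i => y i.succ))
    (hΓ.comp (f := fun y : Fin (n + 1) → ℝ => (y 0, fun i : Fin n => y i.succ)) ht)
    (hρ.comp (f := fun y : Fin (n + 1) → ℝ => (y 0, fun i : Fin n => y i.succ)) ht)
    (fun y hy => h _ (hy 0).1 (hy 0).2 _ (fun i => hy i.succ)) (0, false) (0, true) (by simp)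
    (by
      rintro y hy ⟨c, b⟩ h1 h2 hc
      obtain ⟨i, rfl⟩ : ∃ i : Fin n, c = i.succ := by
        refine Fin.exists_succ_eq.2 ?_ |>.imp fun _ h => h.symm
        rintro rfl
        cases b <;> simp at h1 h2
      exact hb _ (hy 0).1 (hy 0).2 _ (fun i => hy i.succ) i (by cases b <;> simp_all))
  filter_upwards [this, eventually_gt_atTop 0] with m hm hm0 l₀ l₁ h₀ h₁
  have hm' : (m : ℝ) ≠ 0 := by positivity
  have key := hm (fun v => if v 0 = 0 then l₀ (fun i => v i.succ) else if v 0 = m then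
    l₁ (fun i => v i.succ) else lab (Γ (pt m v 0) (fun i => pt m v i.succ))) (by
    intro v hv
    by_cases e0 : v 0 = 0
    · have : pt m v 0 = 0 := by simp [pt, e0]
      rw [if_pos e0, this]
      exact h₀ _ (fun i => hv i.succ)
    · by_cases e1 : v 0 = m
      · have : pt m v 0 = 1 := by simp [pt, e1, hm']
        rw [if_neg e0, if_pos e1, this]
        exact h₁ _ (fun i => hv i.succ)
      · rw [if_neg e0, if_neg e1]
        exact lab_valid _)
  simp only [face_zero, pt, Fin.cons_zero, Fin.cons_succ, if_true, hm0.ne', if_false, Nat.cast_zero,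
    zero_div, div_self hm', Bool.false_eq_true] at key
  exact key

/-- degree with canonical labels -/
def Dc {n : ℕ} (m : ℕ) (Γ : (Fin n → ℝ) → (Fin n → ℝ)) (ρ : (Fin n → ℝ) → ℝ) : ZMod 2 :=
  D m (fun v => lab (Γ (pt m v))) (fun v => 0 < ρ (pt m v))

theorem Dc_homotopy {n : ℕ} (Γ : ℝ → (Fin n → ℝ) → (Fin n → ℝ)) (ρ : ℝ → (Fin n → ℝ) → ℝ)
    (hΓ : Continuous fun q : ℝ × (Fin n → ℝ) => Γ q.1 q.2)
    (hρ : Continuous fun q : ℝ × (Fin n → ℝ) => ρ q.1 q.2)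
    (h : ∀ u, 0 ≤ u → u ≤ 1 → ∀ y ∈ Q n, Γ u y = 0 → ρ u y ≠ 0)
    (hb : ∀ u, 0 ≤ u → u ≤ 1 → ∀ y ∈ Q n, ∀ i, y i = 0 ∨ y i = 1 → Γ u y = 0 → ρ u y < 0) :
    ∀ᶠ m : ℕ in atTop, Dc m (Γ 0) (ρ 0) = Dc m (Γ 1) (ρ 1) := by
  filter_upwards [prism Γ ρ hΓ hρ h hb] with m hm
  exact hm _ _ (fun v _ => lab_valid _) (fun v _ => lab_valid _)

theorem Dc_dom_perm {n m : ℕ} (Γ : (Fin n → ℝ) → (Fin n → ℝ)) (ρ : (Fin n → ℝ) → ℝ)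
    (τ : Equiv.Perm (Fin n)) :
    Dc m (fun y => Γ (fun i => y (τ i))) (fun y => ρ (fun i => y (τ i))) = Dc m Γ ρ := by
  unfold Dc D
  symm
  rw [← (Equiv.arrowCongr τ.symm (Equiv.refl (Fin m))).sum_comp]
  refine Finset.sum_congr rfl fun v _ => ?_
  rw [← Equiv.sum_comp (Equiv.mulLeft τ.symm)]
  refine Finset.sum_congr rfl fun π _ => ?_
  have e : ∀ j : ℕ, vtx (fun i => ((Equiv.arrowCongr τ.symm (Equiv.refl (Fin m)) v) i : ℕ))
      (Equiv.mulLeft τ.symm π) j = fun i => vtx (fun i => (v i : ℕ)) π j (τ i) := by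
    intro j; funext i; rfl
  simp only [e]
  rfl

/-- relblelling -/
def relbl {n : ℕ} (τ : Equiv.Perm (Fin n)) (i : Fin (n + 1)) : Fin (n + 1) :=
  Fin.lastCases (motive := fun _ => Fin (n + 1)) (Fin.last n) (fun j => (τ j).castSucc) i

theorem relbl_inj {n : ℕ} (τ : Equiv.Perm (Fin n)) : Function.Injective (relbl τ) := by
  intro i j
  induction i using Fin.lastCases with
  | last =>
    induction j using Fin.lastCases with
    | last => simp
    | cast j => 
      simp only [relbl, Fin.lastCases_last, Fin.lastCases_castSucc]
      intro h; exact absurd h.symm (Fin.castSucc_lt_last _).ne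
  | cast i =>
    induction j using Fin.lastCases with
    | last => 
      simp only [relbl, Fin.lastCases_last, Fin.lastCases_castSucc]
      intro h; exact absurd h (Fin.castSucc_lt_last _).ne
    | cast j => 
      simp [relbl]

theorem relbl_valid {n : ℕ} (τ : Equiv.Perm (Fin n)) (γ : Fin n → ℝ) (i : Fin (n + 1))
    (h : Valid (fun i => γ (τ i)) i) : Valid γ (relbl τ i) := by
  induction i using Fin.lastCases with
  | last =>
    refine ⟨?_, fun _ j => ?_⟩
    · intro j hj
      simp only [relbl, Fin.lastCases_last] at hj
      exact absurd hj.symm (Fin.castSucc_lt_last _).ne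
    · simpa using h.2 rfl (τ.symm j)
  | cast i =>
    refine ⟨?_, ?_⟩
    · intro j hj
      simp only [relbl, Fin.lastCases_castSucc] at hj
      have := Fin.castSucc_injective _ hj
      rw [← this]
      exact h.1 i rfl
    · intro hj
      simp only [relbl, Fin.lastCases_castSucc] at hj
      exact absurd hj (Fin.castSucc_lt_last _).ne

theorem Dc_tgt_perm {n : ℕ} (Γ : (Fin n → ℝ) → (Fin n → ℝ)) (ρ : (Fin n → ℝ) → ℝ)
    (hΓ : Continuous Γ) (hρ : Continuous ρ) (h : ∀ y ∈ Q n, Γ y = 0 → ρ y ≠ 0)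
    (hb : ∀ y ∈ Q n, ∀ i, y i = 0 ∨ y i = 1 → Γ y = 0 → ρ y < 0) (τ : Equiv.Perm (Fin n)) :
    ∀ᶠ m : ℕ in atTop, Dc m (fun y i => Γ y (τ i)) ρ = Dc m Γ ρ := by
  filter_upwards [prism (fun _ => Γ) (fun _ => ρ) (hΓ.comp continuous_snd) (hρ.comp continuous_snd)
    (fun _ _ _ => h) (fun _ _ _ => hb)] with m hm
  have := hm _ _ (fun v _ => relbl_valid τ _ _ (lab_valid (fun i => Γ (pt m v) (τ i))))
    (fun v _ => lab_valid _)
  unfold Dc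
  rw [← this]
  unfold D
  refine Finset.sum_congr rfl fun v _ => Finset.sum_congr rfl fun π _ => ind_congr ?_
  refine and_congr_left fun _ => ?_
  have hr := Finite.injective_iff_bijective.1 (relbl_inj τ)
  exact (hr.of_comp_iff' _).symm

theorem Dc_base {n m : ℕ} (hm : 0 < m) (ρ : (Fin n → ℝ) → ℝ) (hρ : ∀ y, 0 < ρ y) :
    Dc m (fun y i => 1 / 2 - y i) ρ = 1 := by
  have hm' : (0 : ℝ) < m := by positivity
  unfold Dc D
  simp only [hρ, and_true]
  have hlt : ∀ (v : Fin n → ℕ) (j : Fin n), (1 / 2 - pt m v j < 0) ↔ m < 2 * v j := by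
    intro v j
    rw [← @Nat.cast_lt ℝ]
    simp only [pt]
    push_cast
    rw [sub_neg, lt_div_iff₀ hm']
    constructor <;> intro h <;> linarith
  let l : (Fin n → ℕ) → Fin (n + 1) := fun v => lab (fun i => 1 / 2 - pt m v i)
  have hl1 : ∀ v (j : Fin n), j.castSucc < l v → m < 2 * v j := fun v j h => (hlt v j).1 (lab_lt _ j h)
  have hl2 : ∀ v (j : Fin n), l v = j.castSucc → 2 * v j ≤ m := by
    intro v j h
    have := lab_eq _ j h
    by_contra hc
    push Not at hc
    have := (hlt v j).2 hc
    linarith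
  have hc : m / 2 < m := Nat.div_lt_self hm (by norm_num)
  have huniq : ∀ (v : Fin n → Fin m) (π : Equiv.Perm (Fin n)),
      Function.Bijective (fun j : Fin (n + 1) => l (vtx (fun i => (v i : ℕ)) π j)) ↔
      v = (fun _ => ⟨m / 2, hc⟩) ∧ π = Equiv.refl _ := by
    intro v π
    constructor
    · intro hb
      have hmono : Monotone (fun j : Fin (n + 1) => l (vtx (fun i => (v i : ℕ)) π j)) := by
        intro a b hab
        simp only
        by_contra hlt
        push Not at hlt
        obtain ⟨i, hi⟩ := Fin.exists_castSucc_eq.2 (hlt.trans_le (Fin.le_last _)).ne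
        have h1 := hl2 _ i hi.symm
        have h2 := hl1 _ i (hi ▸ hlt)
        have hab' : (a : ℕ) ≤ b := hab
        simp only [vtx] at h1 h2
        split_ifs at h1 h2 <;> omega
      have hid : ∀ j : Fin (n + 1), l (vtx (fun i => (v i : ℕ)) π j) = j := by
        have hs : StrictMono (fun j : Fin (n + 1) => l (vtx (fun i => (v i : ℕ)) π j)) :=
          hmono.strictMono_of_injective hb.1
        intro j
        have := Subsingleton.elim (hs.orderIsoOfSurjective _ hb.2) (OrderIso.refl _)
        have h2 := congrArg (fun e : Fin (n + 1) ≃o Fin (n + 1) => e j) this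
        simpa using h2
      have h1 : ∀ j : Fin n, 2 * vtx (fun i => (v i : ℕ)) π j j ≤ m := fun j =>
        hl2 _ j (hid j.castSucc)
      have h2 : ∀ j : Fin n, m < 2 * vtx (fun i => (v i : ℕ)) π (j + 1) j := fun j =>
        hl1 _ j (by
          have := hid j.succ
          simp only [Fin.val_succ] at this
          rw [this]; exact Fin.castSucc_lt_succ)
      have h3 : ∀ j : Fin n, (v j : ℕ) = m / 2 ∧ (π.symm j : ℕ) = j := by
        intro j
        have a := h1 j
        have b := h2 j
        simp only [vtx] at a b
        split_ifs at a b <;> omega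
      constructor
      · funext j; ext; exact (h3 j).1
      · ext j
        have := (h3 (π j)).2
        rw [Equiv.symm_apply_apply] at this
        simp [this]
    · rintro ⟨rfl, rfl⟩
      have hid : ∀ j : Fin (n + 1), l (vtx (fun i => ((⟨m / 2, hc⟩ : Fin m) : ℕ)) (Equiv.refl (Fin n)) j) = j := by
        intro j
        set v := vtx (fun i => ((⟨m / 2, hc⟩ : Fin m) : ℕ)) (Equiv.refl (Fin n)) j with hv
        rcases lt_trichotomy (l v) j with h | h | h
        · obtain ⟨i, hi⟩ := Fin.exists_castSucc_eq.2 (h.trans_le (Fin.le_last _)).ne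
          have h1 := hl2 _ i hi.symm
          rw [← hi] at h
          have h' : (i : ℕ) < j := h
          simp only [hv, vtx, Equiv.refl_symm, Equiv.refl_apply, h', if_true] at h1
          omega
        · exact h
        · obtain ⟨i, hi⟩ := Fin.exists_castSucc_eq.2 (h.trans_le (Fin.le_last _)).ne
          rw [← hi] at h
          have h1 := hl1 _ i h
          have h' : (j : ℕ) = i := by rw [← hi]; simp
          simp only [hv, vtx, Equiv.refl_symm, Equiv.refl_apply, h', lt_irrefl, if_false] at h1
          omega
      have : (fun j : Fin (n + 1) => l (vtx (fun i => ((⟨m / 2, hc⟩ : Fin m) : ℕ)) (Equiv.refl (Fin n)) j)) = id :=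
        funext hid
      rw [this]
      exact Function.bijective_id
  have := huniq
  simp only [l] at this
  simp only [this]
  rw [Finset.sum_eq_single (fun _ => ⟨m / 2, hc⟩), Finset.sum_eq_single (Equiv.refl _)]
  · exact ind_true ⟨rfl, rfl⟩
  · intro π _ h; exact ind_false fun h' => h h'.2
  · simp
  · intro v _ h; exact Finset.sum_eq_zero fun π _ => ind_false fun h' => h h'.1
  · simp

end Pi4
end

open scoped unitInterval Topology Topology.Homotopy
open Set

set_option linter.unusedSectionVars false
noncomputable section
namespace Pi4

/-! ### M8a : an explicit representative of the Hopf element -/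

def NN (X₁ X₂ X₃ : ℝ) : ℝ := min 1 (max |X₁| (max |X₂| |X₃|))

def aa (X₁ X₂ X₃ : ℝ) : ℂ :=
  ⟨4 * NN X₁ X₂ X₃ - 3 + 4 * X₂ * (1 - NN X₁ X₂ X₃), (1 - NN X₁ X₂ X₃) * X₁⟩

def bb (X₁ X₂ X₃ : ℝ) : ℂ :=
  ⟨4 * NN X₁ X₂ X₃ - 3 - 4 * X₂ * (1 - NN X₁ X₂ X₃), -((1 - NN X₁ X₂ X₃) * X₃)⟩

def ff (X₁ X₂ X₃ : ℝ) : ℂ × ℝ := hopf (aa X₁ X₂ X₃, bb X₁ X₂ X₃)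

theorem NN_cont : Continuous (fun q : ℝ × ℝ × ℝ => NN q.1 q.2.1 q.2.2) := by
  unfold NN; fun_prop

theorem cplx_cont {Y : Type*} [TopologicalSpace Y] {f g : Y → ℝ} (hf : Continuous f) (hg : Continuous g) :
    Continuous (fun y => (⟨f y, g y⟩ : ℂ)) := by
  have : (fun y => (⟨f y, g y⟩ : ℂ)) = fun y => Complex.equivRealProdCLM.symm (f y, g y) := by
    funext y; rfl
  rw [this]
  fun_prop

theorem ff_cont : Continuous (fun q : ℝ × ℝ × ℝ => ff q.1 q.2.1 q.2.2) := by
  have h := NN_cont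
  unfold ff
  apply hopf_cont.comp
  unfold aa bb
  apply Continuous.prodMk
  · apply cplx_cont <;> fun_prop
  · apply cplx_cont <;> fun_prop

theorem NN_one {X₁ X₂ X₃ : ℝ} (h : 1 ≤ |X₁| ∨ 1 ≤ |X₂| ∨ 1 ≤ |X₃|) : NN X₁ X₂ X₃ = 1 := by
  apply min_eq_left
  simpa only [le_max_iff] using h

theorem ff_one {X₁ X₂ X₃ : ℝ} (h : 1 ≤ |X₁| ∨ 1 ≤ |X₂| ∨ 1 ≤ |X₃|) : ff X₁ X₂ X₃ = (1, 0) := by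
  have e1 : aa X₁ X₂ X₃ = 1 := by
    apply Complex.ext <;> simp [aa, NN_one h]; norm_num
  have e2 : bb X₁ X₂ X₃ = 1 := by
    apply Complex.ext <;> simp [bb, NN_one h]; norm_num
  rw [ff, e1, e2]
  simp [hopf]

theorem ff_ne (X₁ X₂ X₃ : ℝ) : ff X₁ X₂ X₃ ≠ 0 := by
  apply hopf_ne
  intro h
  have ha : aa X₁ X₂ X₃ = 0 := congrArg Prod.fst h
  have hb : bb X₁ X₂ X₃ = 0 := congrArg Prod.snd h
  have h1 := congrArg Complex.re ha
  have h2 := congrArg Complex.re hb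
  have h3 := congrArg Complex.im ha
  have h4 := congrArg Complex.im hb
  simp only [aa, bb, Complex.zero_re, Complex.zero_im] at h1 h2 h3 h4
  have hN : NN X₁ X₂ X₃ = 3 / 4 := by linarith
  rw [hN] at h1 h3 h4
  have e1 : X₁ = 0 := by linarith
  have e2 : X₂ = 0 := by linarith
  have e3 : X₃ = 0 := by linarith
  rw [e1, e2, e3] at hN
  norm_num [NN] at hN

theorem hopf_zero_pos {a b : ℂ} (h : (hopf (a, b)).1 = 0) (h2 : 0 < (hopf (a, b)).2) : b = 0 := by
  simp only [hopf, mul_eq_zero, map_eq_zero] at h h2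
  rcases h with h | h
  · rw [h] at h2
    have := Complex.normSq_nonneg b
    simp at h2; linarith
  · exact h

theorem hopf_zero_neg {a b : ℂ} (h : (hopf (a, b)).1 = 0) (h2 : (hopf (a, b)).2 < 0) : a = 0 := by
  simp only [hopf, mul_eq_zero, map_eq_zero] at h h2
  rcases h with h | h
  · exact h
  · rw [h] at h2
    have := Complex.normSq_nonneg a
    simp at h2; linarith

theorem aa_zero {X₁ X₂ X₃ : ℝ} (h : aa X₁ X₂ X₃ = 0) : X₁ = 0 ∧ NN X₁ X₂ X₃ < 1 ∧
    4 * NN X₁ X₂ X₃ - 3 + 4 * X₂ * (1 - NN X₁ X₂ X₃) = 0 := by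
  have h1 := congrArg Complex.re h
  have h3 := congrArg Complex.im h
  simp only [aa, Complex.zero_re, Complex.zero_im] at h1 h3
  have hN : NN X₁ X₂ X₃ ≤ 1 := min_le_left _ _
  have hN2 : NN X₁ X₂ X₃ ≠ 1 := by
    intro hN; rw [hN] at h1; norm_num at h1
  have hN3 := lt_of_le_of_ne hN hN2
  refine ⟨?_, hN3, h1⟩
  rcases mul_eq_zero.1 h3 with h | h
  · linarith
  · exact h

theorem bb_zero {X₁ X₂ X₃ : ℝ} (h : bb X₁ X₂ X₃ = 0) : X₃ = 0 ∧ NN X₁ X₂ X₃ < 1 ∧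
    4 * NN X₁ X₂ X₃ - 3 - 4 * X₂ * (1 - NN X₁ X₂ X₃) = 0 := by
  have h1 := congrArg Complex.re h
  have h3 := congrArg Complex.im h
  simp only [bb, Complex.zero_re, Complex.zero_im] at h1 h3
  have hN : NN X₁ X₂ X₃ ≤ 1 := min_le_left _ _
  have hN2 : NN X₁ X₂ X₃ ≠ 1 := by
    intro hN; rw [hN] at h1; norm_num at h1
  have hN3 := lt_of_le_of_ne hN hN2
  refine ⟨?_, hN3, h1⟩
  rcases mul_eq_zero.1 (neg_eq_zero.1 h3) with h | h
  · linarith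
  · exact h

theorem NN_axis {X : ℝ} (h : NN 0 X 0 < 1) : NN 0 X 0 = |X| := by
  have : NN 0 X 0 = min 1 |X| := by simp [NN]
  rw [this] at h ⊢
  rcases min_lt_iff.1 h with h | h
  · exact absurd h (lt_irrefl _)
  · exact min_eq_right h.le

theorem unique_zero {X₁ X₂ X₃ u : ℝ} (hu : 0 ≤ u) (ha : aa X₁ X₂ X₃ = 0)
    (hb : bb X₁ (X₂ - 2 * u) X₃ = 0) : X₁ = 0 ∧ X₃ = 0 ∧ X₂ = 1 / 2 ∧ u = 1 / 2 := by
  obtain ⟨h1, hN, h⟩ := aa_zero ha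
  obtain ⟨h3, hN', h'⟩ := bb_zero hb
  subst h1 h3
  rw [NN_axis hN] at h hN
  rw [NN_axis hN'] at h' hN'
  set Z := X₂ - 2 * u with hZ
  have hle : Z ≤ X₂ := by linarith
  have k1 : X₂ = 1 / 2 ∨ (X₂ < 0 ∧ 4 * X₂ ^ 2 = 3) := by
    rcases le_or_gt 0 X₂ with h0 | h0
    · rw [abs_of_nonneg h0] at h hN
      left
      have : (2 * X₂ - 1) * (2 * X₂ - 3) = 0 := by linarith
      rcases mul_eq_zero.1 this with h | h <;> linarith
    · rw [abs_of_neg h0] at h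
      right; exact ⟨h0, by linarith⟩
  have k2 : Z = - 1 / 2 ∨ (0 ≤ Z ∧ 4 * Z ^ 2 = 3) := by
    rcases le_or_gt 0 Z with h0 | h0
    · rw [abs_of_nonneg h0] at h'
      right; exact ⟨h0, by linarith⟩
    · rw [abs_of_neg h0] at h' hN'
      left
      have : (2 * Z + 1) * (2 * Z + 3) = 0 := by linarith
      rcases mul_eq_zero.1 this with h | h <;> linarith
  rcases k1 with k1 | ⟨k1, k1'⟩ <;> rcases k2 with k2 | ⟨k2, k2'⟩
  · refine ⟨rfl, rfl, k1, by linarith⟩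
  · exfalso; nlinarith
  · exfalso; nlinarith
  · exfalso; linarith

/-- value of `NN` near the critical points -/
theorem NN_box {X₁ X₂ X₃ : ℝ} (h1 : |X₁| ≤ 1 / 8) (h3 : |X₃| ≤ 1 / 8) (h2 : 3 / 8 ≤ |X₂|)
    (h2' : |X₂| ≤ 5 / 8) : NN X₁ X₂ X₃ = |X₂| := by
  unfold NN
  rw [max_eq_left (a := |X₂|) (by linarith), max_eq_right (by linarith), min_eq_right (by linarith)]

theorem lin_alg {z x P R S T : ℝ} (hP : 0 < P) (hR : 0 < R) (hST : 0 ≤ S * T)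
    (e1 : z * P + x * S = 0) (e2 : x * R - z * T = 0) : z = 0 ∧ x = 0 := by
  have h : (P * R + S * T) * z = 0 := by linear_combination R * e1 - S * e2
  have hz : z = 0 := by
    rcases mul_eq_zero.1 h with h | h
    · nlinarith [mul_pos hP hR]
    · exact h
  subst hz
  refine ⟨rfl, ?_⟩
  have : x * R = 0 := by linarith
  rcases mul_eq_zero.1 this with h | h
  · exact h
  · linarith

/-- formula in the box around the zero of `aa` -/
theorem box_a {X₁ X₂ X₃ θ : ℝ} (hθ : 0 ≤ θ) (hθ1 : θ ≤ 1) (h1 : |X₁| ≤ 1 / 8) (h3 : |X₃| ≤ 1 / 8)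
    (h2 : |X₂ - 1 / 2| ≤ 1 / 8)
    (e1 : (1 - θ) * (ff X₁ X₂ X₃).1.re + θ * (1 - 2 * X₂) = 0)
    (e2 : (1 - θ) * (ff X₁ X₂ X₃).1.im + θ * (-X₁) = 0) : X₂ = 1 / 2 ∧ X₁ = 0 := by
  rw [abs_le] at h2
  have hX : |X₂| = X₂ := abs_of_nonneg (by linarith)
  have hN := NN_box h1 h3 (X₂ := X₂) (by rw [hX]; linarith) (by rw [hX]; linarith)
  rw [hX] at hN
  simp only [ff, hopf, aa, bb, hN, Complex.mul_re, Complex.mul_im, Complex.conj_re, Complex.conj_im] at e1 e2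
  have hβ : 0 < 3 - 4 * X₂ ^ 2 := by nlinarith
  have key := lin_alg (z := 2 * X₂ - 1) (x := X₁) (P := (1 - θ) * ((3 - 4 * X₂ ^ 2) * (3 - 2 * X₂)) + θ)
    (R := (1 - θ) * ((1 - X₂) * (3 - 4 * X₂ ^ 2)) + θ) (S := (1 - θ) * ((1 - X₂) ^ 2 * X₃))
    (T := (1 - θ) * ((1 - X₂) * (3 - 2 * X₂) * X₃)) ?_ ?_ ?_ ?_ ?_
  · exact ⟨by linarith [key.1], key.2⟩
  · have : 0 < (3 - 4 * X₂ ^ 2) * (3 - 2 * X₂) := mul_pos hβ (by linarith)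
    rcases eq_or_lt_of_le hθ with h | h
    · rw [← h]; linarith
    · have := mul_nonneg (sub_nonneg.2 hθ1) this.le
      linarith
  · have : 0 < (1 - X₂) * (3 - 4 * X₂ ^ 2) := mul_pos (by linarith) hβ
    rcases eq_or_lt_of_le hθ with h | h
    · rw [← h]; linarith
    · have := mul_nonneg (sub_nonneg.2 hθ1) this.le
      linarith
  · have : 0 ≤ (1 - X₂) ^ 3 * (3 - 2 * X₂) := mul_nonneg (pow_nonneg (by linarith) _) (by linarith)
    have h5 := mul_nonneg this (sq_nonneg ((1 - θ) * X₃))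
    linarith
  · linear_combination - e1
  · linear_combination - e2

theorem box_b {X₁ X₂ X₃ θ : ℝ} (hθ : 0 ≤ θ) (hθ1 : θ ≤ 1) (h1 : |X₁| ≤ 1 / 8) (h3 : |X₃| ≤ 1 / 8)
    (h2 : |X₂ + 1 / 2| ≤ 1 / 8)
    (e1 : (1 - θ) * (ff X₁ X₂ X₃).1.re + θ * (2 * X₂ + 1) = 0)
    (e2 : (1 - θ) * (ff X₁ X₂ X₃).1.im + θ * (-X₃) = 0) : X₂ = - 1 / 2 ∧ X₃ = 0 := by
  have hN : NN X₁ X₂ X₃ = NN X₃ (-X₂) X₁ := by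
    simp only [NN, abs_neg]
    congr 1
    rw [max_comm |X₁|, max_assoc, max_comm |X₂|, max_assoc, max_comm |X₁|]
  have := box_a (X₁ := X₃) (X₂ := - X₂) (X₃ := X₁) hθ hθ1 h3 h1
    (by rw [← abs_neg]; convert h2 using 2; ring)
    (by
      rw [← e1]
      simp only [ff, hopf, aa, bb, hN, Complex.mul_re, Complex.mul_im, Complex.conj_re, Complex.conj_im]
      ring)
    (by
      rw [← e2]
      simp only [ff, hopf, aa, bb, hN, Complex.mul_re, Complex.mul_im, Complex.conj_re, Complex.conj_im]
      ring)
  exact ⟨by linarith [this.1], this.2⟩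

theorem box_neg {X₁ X₂ X₃ : ℝ} (h1 : |X₁| ≤ 1 / 8) (h3 : |X₃| ≤ 1 / 8)
    (h2 : |X₂ - 1 / 2| ≤ 1 / 8) (h : (ff X₁ X₂ X₃).1 = 0) : (ff X₁ X₂ X₃).2 < 0 := by
  rw [abs_le] at h2
  have hX : |X₂| = X₂ := abs_of_nonneg (by linarith)
  have hN := NN_box h1 h3 (X₂ := X₂) (by rw [hX]; linarith) (by rw [hX]; linarith)
  rw [hX] at hN
  by_contra hc
  push Not at hc
  have h0 : (ff X₁ X₂ X₃).2 ≠ 0 := fun h0 => ff_ne X₁ X₂ X₃ (Prod.ext h h0)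
  have := hopf_zero_pos h (lt_of_le_of_ne hc h0.symm)
  have := (bb_zero this).2.2
  rw [hN] at this
  nlinarith

theorem box_pos {X₁ X₂ X₃ : ℝ} (h1 : |X₁| ≤ 1 / 8) (h3 : |X₃| ≤ 1 / 8)
    (h2 : |X₂ + 1 / 2| ≤ 1 / 8) (h : (ff X₁ X₂ X₃).1 = 0) : 0 < (ff X₁ X₂ X₃).2 := by
  rw [abs_le] at h2
  have hX : |X₂| = - X₂ := abs_of_nonpos (by linarith)
  have hN := NN_box h1 h3 (X₂ := X₂) (by rw [hX]; linarith) (by rw [hX]; linarith)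
  rw [hX] at hN
  by_contra hc
  push Not at hc
  have h0 : (ff X₁ X₂ X₃).2 ≠ 0 := fun h0 => ff_ne X₁ X₂ X₃ (Prod.ext h h0)
  have := hopf_zero_neg h (lt_of_le_of_ne hc h0)
  have := (aa_zero this).2.2
  rw [hN] at this
  nlinarith

end Pi4
end

open scoped unitInterval Topology Topology.Homotopy
open Set

set_option linter.unusedSectionVars false
noncomputable section
namespace Pi4

/-! ### M8b : the degree of the explicit map is one -/

def pair (v v' : (ℂ × ℝ) × ℝ) : Fin 6 → ℝ :=
  ![v.1.1.re, v.1.1.im, v.2, v'.2, v'.1.1.im, v'.1.1.re]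

def rho (v v' : (ℂ × ℝ) × ℝ) : ℝ := min v.1.2 (-v'.1.2)

theorem vec6_cont {Y : Type*} [TopologicalSpace Y] {a b c d e f : Y → ℝ} (ha : Continuous a)
    (hb : Continuous b) (hc : Continuous c) (hd : Continuous d) (he : Continuous e)
    (hf : Continuous f) : Continuous (fun y => ![a y, b y, c y, d y, e y, f y]) := by
  apply continuous_pi
  intro i
  fin_cases i <;> simpa

theorem vec6_zero {a b c d e f : ℝ} (h : ![a, b, c, d, e, f] = 0) :
    a = 0 ∧ b = 0 ∧ c = 0 ∧ d = 0 ∧ e = 0 ∧ f = 0 :=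
  ⟨congrFun h 0, congrFun h 1, congrFun h 2, congrFun h 3, congrFun h 4, congrFun h 5⟩

theorem pair_cont {Y : Type*} [TopologicalSpace Y] {f g : Y → (ℂ × ℝ) × ℝ} (hf : Continuous f)
    (hg : Continuous g) : Continuous (fun y => pair (f y) (g y)) := by
  unfold pair
  have := Complex.continuous_re
  have := Complex.continuous_im
  apply vec6_cont <;> fun_prop

theorem rho_cont {Y : Type*} [TopologicalSpace Y] {f g : Y → (ℂ × ℝ) × ℝ} (hf : Continuous f)
    (hg : Continuous g) : Continuous (fun y => rho (f y) (g y)) := by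
  unfold rho
  fun_prop

theorem pair_zero {v v' : (ℂ × ℝ) × ℝ} (h : pair v v' = 0) :
    v.1.1 = 0 ∧ v.2 = 0 ∧ v'.1.1 = 0 ∧ v'.2 = 0 := by
  obtain ⟨h1, h2, h3, h4, h5, h6⟩ := vec6_zero h
  exact ⟨Complex.ext h1 h2, h3, Complex.ext h6 h5, h4⟩

theorem rho_ne {v v' : (ℂ × ℝ) × ℝ} (h : pair v v' = 0) (hv : v ≠ 0) (hv' : v' ≠ 0) : rho v v' ≠ 0 := by
  obtain ⟨h1, h2, h3, h4⟩ := pair_zero h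
  have a : v.1.2 ≠ 0 := fun a => hv (Prod.ext (Prod.ext h1 a) h2)
  have b : v'.1.2 ≠ 0 := fun a => hv' (Prod.ext (Prod.ext h3 a) h4)
  unfold rho
  rcases min_choice v.1.2 (-v'.1.2) with e | e <;> rw [e]
  · exact a
  · exact neg_ne_zero.2 b

theorem rho_self_le (v : (ℂ × ℝ) × ℝ) : rho v v ≤ 0 := by
  unfold rho
  rcases le_total v.1.2 0 with h | h
  · exact (min_le_left _ _).trans h
  · exact (min_le_right _ _).trans (by linarith)

/-- deformation of the suspension -/
def sv (θ : ℝ) (v : ℂ × ℝ) (s : ℝ) : (ℂ × ℝ) × ℝ :=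
  (((1, 0) : ℂ × ℝ) + ((1 - θ) * (4 * s * (1 - s)) + θ) • (v - ((1, 0) : ℂ × ℝ)),
    (1 - θ) * (‖v - ((1, 0) : ℂ × ℝ)‖ * (s * (1 - s) * (1 - 2 * s))) + θ * (1 / 2 - s))

theorem sv_zero (v : ℂ × ℝ) (s : ℝ) : sv 0 v s = susp (1, 0) v s := by
  simp [sv, susp]

theorem sv_one (v : ℂ × ℝ) (s : ℝ) : sv 1 v s = (v, 1 / 2 - s) := by
  simp [sv]

theorem sv_cont {Y : Type*} [TopologicalSpace Y] {θ s : Y → ℝ} {v : Y → ℂ × ℝ} (hθ : Continuous θ)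
    (hs : Continuous s) (hv : Continuous v) : Continuous (fun y => sv (θ y) (v y) (s y)) := by
  unfold sv
  fun_prop

theorem sv_half {θ : ℝ} {v : ℂ × ℝ} : sv θ v (1 / 2) = (v, 0) := by
  have : (1 - θ) * (4 * (1 / 2) * (1 - 1 / 2)) + θ = 1 := by ring
  unfold sv
  rw [this]
  norm_num

theorem sv_eq_zero {θ s : ℝ} {v : ℂ × ℝ} (h0 : 0 ≤ θ) (h1 : θ ≤ 1) (hs : 0 ≤ s) (hs1 : s ≤ 1)
    (e1 : (sv θ v s).1.1.re = 0) (e2 : (sv θ v s).2 = 0) : s = 1 / 2 := by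
  by_contra hne
  have hk : (1 - 2 * s) * ((1 - θ) * (‖v - ((1, 0) : ℂ × ℝ)‖ * (s * (1 - s))) + θ / 2) = 0 := by
    simp only [sv] at e2
    linarith
  have h2 : (1 - θ) * (‖v - ((1, 0) : ℂ × ℝ)‖ * (s * (1 - s))) + θ / 2 = 0 := by
    rcases mul_eq_zero.1 hk with h | h
    · exact absurd (by linarith) hne
    · exact h
  have hn : 0 ≤ ‖v - ((1, 0) : ℂ × ℝ)‖ * (s * (1 - s)) :=
    mul_nonneg (norm_nonneg _) (mul_nonneg hs (by linarith))
  have h3 := mul_nonneg (sub_nonneg.2 h1) hn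
  have hθ : θ = 0 := by linarith
  subst hθ
  have h4 : ‖v - ((1, 0) : ℂ × ℝ)‖ * (s * (1 - s)) = 0 := by linarith
  have h5 : (s * (1 - s)) • (v - ((1, 0) : ℂ × ℝ)) = 0 := by
    rcases mul_eq_zero.1 h4 with h | h
    · rw [norm_eq_zero.1 h, smul_zero]
    · rw [h, zero_smul]
  have h6 : (sv 0 v s).1 = (1, 0) := by
    have : ((1 : ℝ) - 0) * (4 * s * (1 - s)) + 0 = 4 * (s * (1 - s)) := by ring
    simp only [sv]
    rw [this, mul_smul, h5]
    simp
  rw [h6] at e1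
  simp at e1

def W' (y : Fin 6 → ℝ) : ℂ × ℝ := ff (2 * y 3 - 1) (2 * y 4 - 1 - 2 * y 0) (2 * y 5 - 1)
def W (y : Fin 6 → ℝ) : ℂ × ℝ := ff (2 * y 3 - 1) (2 * y 4 - 1) (2 * y 5 - 1)

@[fun_prop]
theorem W'_cont : Continuous W' :=
  ff_cont.comp (f := fun y : Fin 6 → ℝ => (2 * y 3 - 1, 2 * y 4 - 1 - 2 * y 0, 2 * y 5 - 1)) (by fun_prop)
@[fun_prop]
theorem W_cont : Continuous W :=
  ff_cont.comp (f := fun y : Fin 6 → ℝ => (2 * y 3 - 1, 2 * y 4 - 1, 2 * y 5 - 1)) (by fun_prop)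

/-- boundary behaviour -/
theorem W_bd {y : Fin 6 → ℝ} (i : Fin 6) (h : y i = 0 ∨ y i = 1) (hy : y ∈ Q 6)
    (h1 : (W' y).1 = 0) (h2 : (W y).1 = 0) (hs : y 1 = 1 / 2) (ht : y 2 = 1 / 2) :
    min (W' y).2 (-(W y).2) < 0 := by
  have key : ∀ X₁ X₂ X₃, (ff X₁ X₂ X₃).1 = 0 → ¬ (1 ≤ |X₁| ∨ 1 ≤ |X₂| ∨ 1 ≤ |X₃|) := by
    intro X₁ X₂ X₃ h hc
    rw [ff_one hc] at h
    exact one_ne_zero h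
  have ab : ∀ x : ℝ, x = 0 ∨ x = 1 → 1 ≤ |2 * x - 1| := by
    rintro x (rfl | rfl) <;> norm_num
  have kW := key _ _ _ h2
  have kW' := key _ _ _ h1
  push Not at kW kW'
  have hcase : y 0 = 0 := by
    fin_cases i
    · rcases h with h | h
      · exact h
      · exfalso
        change y 0 = 1 at h
        have := kW'.2.1
        rw [abs_lt, h] at this
        linarith [(hy 4).2]
    · exfalso; change y 1 = 0 ∨ y 1 = 1 at h; rw [hs] at h; norm_num at h
    · exfalso; change y 2 = 0 ∨ y 2 = 1 at h; rw [ht] at h; norm_num at h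
    · exact absurd (ab _ h) (not_le.2 kW.1)
    · exact absurd (ab _ h) (not_le.2 kW.2.1)
    · exact absurd (ab _ h) (not_le.2 kW.2.2)
  have e : W' y = W y := by simp [W', W, hcase]
  have hne : (W y).2 ≠ 0 := fun h0 => ff_ne _ _ _ (Prod.ext h2 h0)
  rw [e]
  rcases lt_or_gt_of_ne hne with h | h
  · exact (min_le_left _ _).trans_lt h
  · exact (min_le_right _ _).trans_lt (by linarith)

theorem W_ne {y : Fin 6 → ℝ} (h1 : (W' y).1 = 0) (h2 : (W y).1 = 0) : min (W' y).2 (-(W y).2) ≠ 0 := by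
  have hne : (W y).2 ≠ 0 := fun h0 => ff_ne _ _ _ (Prod.ext h2 h0)
  have hne' : (W' y).2 ≠ 0 := fun h0 => ff_ne _ _ _ (Prod.ext h1 h0)
  rcases min_choice (W' y).2 (-(W y).2) with e | e <;> rw [e]
  · exact hne'
  · exact neg_ne_zero.2 hne

/-- box function -/
def rho2 (y : Fin 6 → ℝ) : ℝ :=
  1 / 8 - max (max |2 * y 3 - 1| |2 * y 5 - 1|)
    (max |2 * y 4 - 1 - 1 / 2| |2 * y 4 - 1 - 2 * y 0 + 1 / 2|)

theorem rho2_cont : Continuous rho2 := by unfold rho2; fun_prop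

theorem rho2_nonneg {y : Fin 6 → ℝ} (h : 0 ≤ rho2 y) : |2 * y 3 - 1| ≤ 1 / 8 ∧ |2 * y 5 - 1| ≤ 1 / 8 ∧
    |2 * y 4 - 1 - 1 / 2| ≤ 1 / 8 ∧ |2 * y 4 - 1 - 2 * y 0 + 1 / 2| ≤ 1 / 8 := by
  have : max (max |2 * y 3 - 1| |2 * y 5 - 1|)
    (max |2 * y 4 - 1 - 1 / 2| |2 * y 4 - 1 - 2 * y 0 + 1 / 2|) ≤ 1 / 8 := by
    unfold rho2 at h; linarith
  simp only [max_le_iff] at this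
  exact ⟨this.1.1, this.1.2, this.2.1, this.2.2⟩

theorem rho2_center {y : Fin 6 → ℝ} (h3 : 2 * y 3 - 1 = 0) (h5 : 2 * y 5 - 1 = 0)
    (h4 : 2 * y 4 - 1 = 1 / 2) (h0 : 2 * y 4 - 1 - 2 * y 0 = - 1 / 2) : 0 < rho2 y := by
  unfold rho2
  rw [h3, h5, h4] at *
  rw [h0]
  norm_num

def G1 (y : Fin 6 → ℝ) : Fin 6 → ℝ :=
  ![(W' y).1.re, (W' y).1.im, 1 / 2 - y 1, 1 / 2 - y 2, (W y).1.im, (W y).1.re]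

theorem G1_cont : Continuous G1 := by
  have := Complex.continuous_re
  have := Complex.continuous_im
  have := W_cont
  have := W'_cont
  unfold G1
  refine vec6_cont (Complex.continuous_re.comp W'_cont.fst) (Complex.continuous_im.comp W'_cont.fst)
    ?_ ?_ (Complex.continuous_im.comp W_cont.fst) (Complex.continuous_re.comp W_cont.fst) <;> fun_prop

def L1 (y : Fin 6 → ℝ) : Fin 6 → ℝ :=
  ![2 * (2 * y 4 - 1 - 2 * y 0) + 1, -(2 * y 5 - 1), 1 / 2 - y 1, 1 / 2 - y 2, -(2 * y 3 - 1), 1 - 2 * (2 * y 4 - 1)]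

theorem L1_cont : Continuous L1 := by
  unfold L1
  apply vec6_cont <;> fun_prop

open Filter

theorem step1 : ∀ᶠ m : ℕ in atTop,
    Dc m (fun y => pair (susp (1, 0) (W' y) (y 1)) (susp (1, 0) (W y) (y 2)))
      (fun y => rho (susp (1, 0) (W' y) (y 1)) (susp (1, 0) (W y) (y 2))) =
    Dc m G1 (fun y => min (W' y).2 (-(W y).2)) := by
  have hW := W_cont
  have hW' := W'_cont
  have c1 : Continuous (fun q : ℝ × (Fin 6 → ℝ) => sv q.1 (W' q.2) (q.2 1)) :=
    sv_cont (by fun_prop) (by fun_prop) (by fun_prop)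
  have c2 : Continuous (fun q : ℝ × (Fin 6 → ℝ) => sv q.1 (W q.2) (q.2 2)) :=
    sv_cont (by fun_prop) (by fun_prop) (by fun_prop)
  have key : ∀ u, 0 ≤ u → u ≤ 1 → ∀ y ∈ Q 6,
      pair (sv u (W' y) (y 1)) (sv u (W y) (y 2)) = 0 → y 1 = 1 / 2 ∧ y 2 = 1 / 2 ∧ (W' y).1 = 0 ∧
        (W y).1 = 0 ∧ rho (sv u (W' y) (y 1)) (sv u (W y) (y 2)) = min (W' y).2 (-(W y).2) := by
    intro u h0 h1 y hy h
    obtain ⟨z1, z2, z3, z4⟩ := pair_zero h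
    have s1 := sv_eq_zero h0 h1 (hy 1).1 (hy 1).2 (by rw [z1]; rfl) z2
    have s2 := sv_eq_zero h0 h1 (hy 2).1 (hy 2).2 (by rw [z3]; rfl) z4
    rw [s1, sv_half] at z1
    rw [s2, sv_half] at z3
    refine ⟨s1, s2, z1, z3, ?_⟩
    rw [s1, s2, sv_half, sv_half]
    rfl
  have := Dc_homotopy (fun u y => pair (sv u (W' y) (y 1)) (sv u (W y) (y 2)))
    (fun u y => rho (sv u (W' y) (y 1)) (sv u (W y) (y 2)))
    (pair_cont c1 c2) (rho_cont c1 c2)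
    (by
      intro u h0 h1 y hy h
      obtain ⟨a, b, c, d, e⟩ := key u h0 h1 y hy h
      rw [e]; exact W_ne c d)
    (by
      intro u h0 h1 y hy i hi h
      obtain ⟨a, b, c, d, e⟩ := key u h0 h1 y hy h
      rw [e]; exact W_bd i hi hy c d a b)
  simp only [sv_zero, sv_one] at this
  exact this

theorem G1_zero {y : Fin 6 → ℝ} (h : G1 y = 0) : y 1 = 1 / 2 ∧ y 2 = 1 / 2 ∧ (W' y).1 = 0 ∧ (W y).1 = 0 := by
  obtain ⟨h1, h2, h3, h4, h5, h6⟩ := vec6_zero h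
  exact ⟨by linarith, by linarith, Complex.ext h1 h2, Complex.ext h6 h5⟩

theorem step2 : ∀ᶠ m : ℕ in atTop, Dc m G1 (fun y => min (W' y).2 (-(W y).2)) = Dc m G1 rho2 := by
  have hW := W_cont
  have hW' := W'_cont
  have hr := rho2_cont
  have hG := G1_cont
  have c1 := W_cont.snd
  have c2 := W'_cont.snd
  have c3 : Continuous (fun y => min (W' y).2 (-(W y).2)) := c2.min c1.neg
  have neg : ∀ y ∈ Q 6, G1 y = 0 → min (W' y).2 (-(W y).2) < 0 → rho2 y < 0 := by
    intro y hy h hlt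
    obtain ⟨s, t, h1, h2⟩ := G1_zero h
    by_contra hc
    push Not at hc
    obtain ⟨b1, b2, b3, b4⟩ := rho2_nonneg hc
    have p1 := box_pos b1 b2 b4 h1
    have p2 := box_neg b1 b2 b3 h2
    rcases min_lt_iff.1 hlt with h | h
    · exact absurd p1 (not_lt.2 h.le)
    · have : 0 < (W y).2 := by linarith
      exact absurd p2 (not_lt.2 this.le)
  have pos : ∀ y ∈ Q 6, G1 y = 0 → 0 < min (W' y).2 (-(W y).2) → 0 < rho2 y := by
    intro y hy h hlt
    obtain ⟨s, t, h1, h2⟩ := G1_zero h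
    obtain ⟨p1, p2⟩ := lt_min_iff.1 hlt
    have hb := hopf_zero_pos h1 p1
    have ha := hopf_zero_neg h2 (neg_pos.1 p2)
    obtain ⟨u1, u2, u3, u4⟩ := unique_zero (hy 0).1 ha hb
    exact rho2_center u1 u2 u3 (by linarith)
  have := Dc_homotopy (fun _ y => G1 y) (fun u y => (1 - u) * min (W' y).2 (-(W y).2) + u * rho2 y)
    (by fun_prop) (((continuous_const.sub continuous_fst).mul (c3.comp continuous_snd)).add
      (continuous_fst.mul (hr.comp continuous_snd)))
    (by
      intro u h0 h1 y hy h
      obtain ⟨s, t, z1, z2⟩ := G1_zero h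
      rcases lt_or_gt_of_ne (W_ne z1 z2) with hl | hl
      · have := neg y hy h hl
        apply ne_of_lt
        rcases eq_or_lt_of_le h0 with e | e
        · rw [← e]; linarith
        · nlinarith
      · have := pos y hy h hl
        apply ne_of_gt
        rcases eq_or_lt_of_le h0 with e | e
        · rw [← e]; linarith
        · nlinarith)
    (by
      intro u h0 h1 y hy i hi h
      obtain ⟨s, t, z1, z2⟩ := G1_zero h
      have hl := W_bd i hi hy z1 z2 s t
      have := neg y hy h hl
      rcases eq_or_lt_of_le h0 with e | e
      · rw [← e]; linarith
      · nlinarith)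
  simpa using this

theorem step3 : ∀ᶠ m : ℕ in atTop, Dc m G1 rho2 = Dc m L1 rho2 := by
  have hr := rho2_cont
  have hG := G1_cont
  have hL := L1_cont
  have key : ∀ u : ℝ, 0 ≤ u → u ≤ 1 → ∀ y ∈ Q 6, (1 - u) • G1 y + u • L1 y = 0 → 0 ≤ rho2 y →
      (2 * y 3 - 1 = 0 ∧ 2 * y 5 - 1 = 0 ∧ 2 * y 4 - 1 = 1 / 2 ∧ 2 * y 4 - 1 - 2 * y 0 = - 1 / 2) ∧
      y 1 = 1 / 2 ∧ y 2 = 1 / 2 := by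
    intro u h0 h1 y hy h hn
    obtain ⟨b1, b2, b3, b4⟩ := rho2_nonneg hn
    have e0 := congrFun h 0
    have e1 := congrFun h 1
    have e2 := congrFun h 2
    have e3 := congrFun h 3
    have e4 := congrFun h 4
    have e5 := congrFun h 5
    simp only [G1, L1, Pi.add_apply, Pi.smul_apply, smul_eq_mul, Pi.zero_apply, Matrix.cons_val] at e0 e1 e2 e3 e4 e5
    obtain ⟨p1, p2⟩ := box_b h0 h1 b1 b2 b4 e0 e1
    obtain ⟨p3, p4⟩ := box_a h0 h1 b1 b2 b3 e5 e4
    exact ⟨⟨p4, p2, p3, p1⟩, by linarith, by linarith⟩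
  have := Dc_homotopy (fun u y => (1 - u) • G1 y + u • L1 y) (fun _ y => rho2 y)
    (by fun_prop) (by fun_prop)
    (by
      intro u h0 h1 y hy h he
      obtain ⟨⟨a, b, c, d⟩, _⟩ := key u h0 h1 y hy h he.ge
      exact (rho2_center a b c d).ne' he)
    (by
      intro u h0 h1 y hy i hi h
      by_contra hc
      push Not at hc
      obtain ⟨⟨a, b, c, d⟩, e, f⟩ := key u h0 h1 y hy h hc
      fin_cases i <;> simp only [Fin.reduceFinMk, Fin.zero_eta, Fin.mk_one] at hi <;> 
        rcases hi with hi | hi <;> linarith)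
  simpa using this

theorem L1_zero {y : Fin 6 → ℝ} (h : L1 y = 0) :
    (2 * y 3 - 1 = 0 ∧ 2 * y 5 - 1 = 0 ∧ 2 * y 4 - 1 = 1 / 2 ∧ 2 * y 4 - 1 - 2 * y 0 = - 1 / 2) ∧
      y 1 = 1 / 2 ∧ y 2 = 1 / 2 := by
  obtain ⟨h1, h2, h3, h4, h5, h6⟩ := vec6_zero h
  exact ⟨⟨by linarith, by linarith, by linarith, by linarith⟩, by linarith, by linarith⟩

theorem step4 : ∀ᶠ m : ℕ in atTop, Dc m L1 rho2 = Dc m L1 (fun _ => 1) := by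
  have hr := rho2_cont
  have hL := L1_cont
  have := Dc_homotopy (fun _ y => L1 y) (fun u y => (1 - u) * rho2 y + u * 1)
    (by fun_prop) (by fun_prop)
    (by
      intro u h0 h1 y hy h
      obtain ⟨⟨a, b, c, d⟩, _⟩ := L1_zero h
      have := rho2_center a b c d
      apply ne_of_gt
      rcases eq_or_lt_of_le h0 with e | e
      · rw [← e]; linarith
      · nlinarith)
    (by
      intro u h0 h1 y hy i hi h
      obtain ⟨⟨a, b, c, d⟩, e, f⟩ := L1_zero h
      exfalso
      fin_cases i <;> simp only [Fin.reduceFinMk, Fin.zero_eta, Fin.mk_one] at hi <;> 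
        rcases hi with hi | hi <;> linarith)
  simpa using this

def kap6 : Equiv.Perm (Fin 6) := Equiv.ofBijective ![0, 5, 1, 2, 3, 4] (by decide)

def L2 (y : Fin 6 → ℝ) : Fin 6 → ℝ :=
  ![1 / 2 - y 0, 1 / 2 - y 5, 1 / 2 - y 1, 1 / 2 - y 2, 1 / 2 - y 3, 1 / 2 - y 4]

theorem L2_eq : L2 = fun y i => 1 / 2 - y (kap6 i) := by
  funext y i
  fin_cases i <;> rfl

theorem L2_cont : Continuous L2 := by
  unfold L2
  apply vec6_cont <;> fun_prop

theorem step5 : ∀ᶠ m : ℕ in atTop, Dc m L1 (fun _ => 1) = Dc m L2 (fun _ => 1) := by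
  have hL := L1_cont
  have hL2 := L2_cont
  have := Dc_homotopy (fun u y => (1 - u) • L1 y + u • L2 y) (fun _ _ => 1)
    (by fun_prop) (by fun_prop)
    (by
      intro u h0 h1 y hy h
      norm_num)
    (by
      intro u h0 h1 y hy i hi h
      exfalso
      have e0 := congrFun h 0
      have e1 := congrFun h 1
      have e2 := congrFun h 2
      have e3 := congrFun h 3
      have e4 := congrFun h 4
      have e5 := congrFun h 5
      simp only [L1, L2, Pi.add_apply, Pi.smul_apply, smul_eq_mul, Pi.zero_apply, Matrix.cons_val] at e0 e1 e2 e3 e4 e5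
      have y4 : 1 / 2 ≤ y 4 ∧ y 4 ≤ 3 / 4 := by
        constructor
        · by_contra hc; push Not at hc; nlinarith
        · by_contra hc; push Not at hc; nlinarith
      fin_cases i <;> simp only [Fin.reduceFinMk, Fin.zero_eta, Fin.mk_one] at hi <;> 
        rcases hi with hi | hi <;> nlinarith)
  simpa using this

theorem step6 : ∀ᶠ m : ℕ in atTop, Dc m L2 (fun _ => 1) = 1 := by
  have := Dc_tgt_perm (n := 6) (fun y i => 1 / 2 - y i) (fun _ => 1) (by fun_prop) (by fun_prop)
    (by intro y hy h; norm_num) (by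
      intro y hy i hi h
      have := congrFun h i
      simp only [Pi.zero_apply] at this
      exfalso
      rcases hi with hi | hi <;> linarith) kap6
  filter_upwards [this, eventually_gt_atTop 0] with m hm hm0
  rw [L2_eq, hm]
  exact Dc_base hm0 _ (fun _ => one_pos)

theorem e_one : ∀ᶠ m : ℕ in atTop,
    Dc m (fun y => pair (susp (1, 0) (W' y) (y 1)) (susp (1, 0) (W y) (y 2)))
      (fun y => rho (susp (1, 0) (W' y) (y 1)) (susp (1, 0) (W y) (y 2))) = 1 := by
  filter_upwards [step1, step2, step3, step4, step5, step6] with m h1 h2 h3 h4 h5 h6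
  rw [h1, h2, h3, h4, h5, h6]

end Pi4
end

open scoped unitInterval Topology Topology.Homotopy
open Set

set_option linter.unusedSectionVars false
noncomputable section
namespace Pi4

/-! ### M8c : vanishing of the diagonal degree and conclusion -/

open Filter

/-- rotation in the second and third coordinates -/
def rotv (θ : ℝ) (v : (ℂ × ℝ) × ℝ) : (ℂ × ℝ) × ℝ :=
  ((⟨v.1.1.re, Real.cos (Real.pi * θ) * v.1.1.im - Real.sin (Real.pi * θ) * v.1.2⟩,
    Real.sin (Real.pi * θ) * v.1.1.im + Real.cos (Real.pi * θ) * v.1.2), v.2)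

theorem rot_zero_iff {θ a b : ℝ} (h1 : Real.cos (Real.pi * θ) * a - Real.sin (Real.pi * θ) * b = 0)
    (h2 : Real.sin (Real.pi * θ) * a + Real.cos (Real.pi * θ) * b = 0) : a = 0 ∧ b = 0 := by
  have := Real.sin_sq_add_cos_sq (Real.pi * θ)
  constructor
  · linear_combination Real.cos (Real.pi * θ) * h1 + Real.sin (Real.pi * θ) * h2 - a * this
  · linear_combination - Real.sin (Real.pi * θ) * h1 + Real.cos (Real.pi * θ) * h2 - b * this

theorem rotv_ne {θ : ℝ} {v : (ℂ × ℝ) × ℝ} (hv : v ≠ 0) : rotv θ v ≠ 0 := by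
  intro h
  have h1 : (rotv θ v).1.1.re = 0 := by rw [h]; rfl
  have h2 : (rotv θ v).1.1.im = 0 := by rw [h]; rfl
  have h3 : (rotv θ v).1.2 = 0 := by rw [h]; rfl
  have h4 : (rotv θ v).2 = 0 := by rw [h]; rfl
  obtain ⟨a, b⟩ := rot_zero_iff h2 h3
  exact hv (Prod.ext (Prod.ext (Complex.ext h1 a) b) h4)

theorem rotv_cont {Y : Type*} [TopologicalSpace Y] {θ : Y → ℝ} {v : Y → (ℂ × ℝ) × ℝ}
    (hθ : Continuous θ) (hv : Continuous v) : Continuous (fun y => rotv (θ y) (v y)) := by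
  have c1 : Continuous fun y => (v y).1.1.re := Complex.continuous_re.comp hv.fst.fst
  have c2 : Continuous fun y => (v y).1.1.im := Complex.continuous_im.comp hv.fst.fst
  have c3 : Continuous fun y => (v y).1.2 := hv.fst.snd
  have c4 : Continuous fun y => (v y).2 := hv.snd
  unfold rotv
  refine Continuous.prodMk (Continuous.prodMk (cplx_cont c1 ?_) ?_) c4 <;> fun_prop

theorem rotv_zero (v : (ℂ × ℝ) × ℝ) : rotv 0 v = v := by
  simp [rotv]

theorem rotv_one (v : (ℂ × ℝ) × ℝ) : rotv 1 v = ((⟨v.1.1.re, -v.1.1.im⟩, -v.1.2), v.2) := by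
  simp [rotv]

section diag
variable (H : ℝ → (Fin 4 → ℝ) → (ℂ × ℝ) × ℝ)

def Fs (z : Fin 6 → ℝ) : (ℂ × ℝ) × ℝ := H (z 0) ![z 1, z 3, z 4, z 5]
def Ft (z : Fin 6 → ℝ) : (ℂ × ℝ) × ℝ := H (z 0) ![z 2, z 3, z 4, z 5]

theorem vec4_cont {Y : Type*} [TopologicalSpace Y] {a b c d : Y → ℝ} (ha : Continuous a)
    (hb : Continuous b) (hc : Continuous c) (hd : Continuous d) :
    Continuous (fun y => ![a y, b y, c y, d y]) := by
  apply continuous_pi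
  intro i
  fin_cases i <;> simpa

variable (hc : Continuous (fun w : ℝ × (Fin 4 → ℝ) => H w.1 w.2)) (hne : ∀ u y, H u y ≠ 0)
  (hb : ∀ u y, (∃ i, y i ≤ 0 ∨ 1 ≤ y i) → H u y = ((1, 0), 0))
  (h1 : ∀ y, H 1 y = ((1, 0), 0))
  (h0 : ∀ y, 0 ≤ y 0 → y 0 ≤ 1 → (H 0 y).1.1.re = 0 → (H 0 y).2 = 0 → y 0 = 1 / 2)

theorem Fs_cont (hc : Continuous (fun w : ℝ × (Fin 4 → ℝ) => H w.1 w.2)) : Continuous (Fs H) :=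
  hc.comp (f := fun z : Fin 6 → ℝ => (z 0, ![z 1, z 3, z 4, z 5]))
    ((continuous_apply 0).prodMk (vec4_cont (by fun_prop) (by fun_prop) (by fun_prop) (by fun_prop)))

theorem Ft_cont (hc : Continuous (fun w : ℝ × (Fin 4 → ℝ) => H w.1 w.2)) : Continuous (Ft H) :=
  hc.comp (f := fun z : Fin 6 → ℝ => (z 0, ![z 2, z 3, z 4, z 5]))
    ((continuous_apply 0).prodMk (vec4_cont (by fun_prop) (by fun_prop) (by fun_prop) (by fun_prop)))

/-- zero analysis, interior -/
theorem diag_ne (hne : ∀ u y, H u y ≠ 0) (θ : ℝ) (z : Fin 6 → ℝ)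
    (h : pair (rotv θ (Fs H z)) (rotv θ (Ft H z)) = 0) :
    min (rho (rotv θ (Fs H z)) (rotv θ (Ft H z))) (z 2 - z 1) ≠ 0 := by
  have hr := rho_ne h (rotv_ne (hne _ _)) (rotv_ne (hne _ _))
  intro hm
  rcases min_cases (rho (rotv θ (Fs H z)) (rotv θ (Ft H z))) (z 2 - z 1) with ⟨e, _⟩ | ⟨e, hl⟩
  · rw [e] at hm; exact hr hm
  · rw [e] at hm
    have hst : z 2 = z 1 := by linarith
    have e2 : Fs H z = Ft H z := by unfold Fs Ft; rw [hst]
    have := rho_self_le (rotv θ (Ft H z))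
    rw [e2] at hl
    linarith

/-- zero analysis, boundary -/
theorem diag_bd (hne : ∀ u y, H u y ≠ 0)
    (hb : ∀ u y, (∃ i, y i ≤ 0 ∨ 1 ≤ y i) → H u y = ((1, 0), 0))
    (h1 : ∀ y, H 1 y = ((1, 0), 0))
    (h0 : ∀ y, 0 ≤ y 0 → y 0 ≤ 1 → (H 0 y).1.1.re = 0 → (H 0 y).2 = 0 → y 0 = 1 / 2)
    (θ : ℝ) (z : Fin 6 → ℝ) (hz : z ∈ Q 6) (i : Fin 6) (hi : z i = 0 ∨ z i = 1)
    (h : pair (rotv θ (Fs H z)) (rotv θ (Ft H z)) = 0) :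
    rho (rotv θ (Fs H z)) (rotv θ (Ft H z)) < 0 := by
  obtain ⟨a1, a2, a3, a4⟩ := pair_zero h
  have a1' : (Fs H z).1.1.re = 0 := by
    have : (rotv θ (Fs H z)).1.1.re = 0 := by rw [a1]; rfl
    exact this
  have a3' : (Ft H z).1.1.re = 0 := by
    have : (rotv θ (Ft H z)).1.1.re = 0 := by rw [a3]; rfl
    exact this
  have b1 : ∀ i : Fin 4, ¬ (![z 1, z 3, z 4, z 5] i = 0 ∨ ![z 1, z 3, z 4, z 5] i = 1) := by
    intro i hi
    have := hb (z 0) ![z 1, z 3, z 4, z 5] ⟨i, hi.imp (fun h => h.le) (fun h => h.ge)⟩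
    unfold Fs at a1'
    rw [this] at a1'
    simp at a1'
  have b2 : ∀ i : Fin 4, ¬ (![z 2, z 3, z 4, z 5] i = 0 ∨ ![z 2, z 3, z 4, z 5] i = 1) := by
    intro i hi
    have := hb (z 0) ![z 2, z 3, z 4, z 5] ⟨i, hi.imp (fun h => h.le) (fun h => h.ge)⟩
    unfold Ft at a3'
    rw [this] at a3'
    simp at a3'
  have hz0 : z 0 = 0 := by
    fin_cases i
    · rcases hi with h | h
      · exact h
      · exfalso
        change z 0 = 1 at h
        unfold Fs at a1'
        rw [h, h1] at a1'
        simp at a1'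
    · exact absurd hi (b1 0)
    · exact absurd hi (b2 0)
    · exact absurd hi (b1 1)
    · exact absurd hi (b1 2)
    · exact absurd hi (b1 3)
  have s1 : z 1 = 1 / 2 := by
    have := h0 ![z 1, z 3, z 4, z 5] (hz 1).1 (hz 1).2
      (by unfold Fs at a1'; rwa [hz0] at a1')
      (by
        have : (Fs H z).2 = 0 := a2
        unfold Fs at this; rwa [hz0] at this)
    exact this
  have s2 : z 2 = 1 / 2 := by
    have := h0 ![z 2, z 3, z 4, z 5] (hz 2).1 (hz 2).2
      (by unfold Ft at a3'; rwa [hz0] at a3')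
      (by
        have : (Ft H z).2 = 0 := a4
        unfold Ft at this; rwa [hz0] at this)
    exact this
  have hr := rho_ne h (rotv_ne (hne _ _)) (rotv_ne (hne _ _))
  have e2 : Fs H z = Ft H z := by unfold Fs Ft; rw [s1, s2]
  have := rho_self_le (rotv θ (Ft H z))
  rw [e2] at hr ⊢
  exact lt_of_le_of_ne this hr

/-- the rotating map -/
def GR (θ : ℝ) (z : Fin 6 → ℝ) : Fin 6 → ℝ :=
  ![(rotv θ (Fs H z)).1.1.re,
    Real.cos (Real.pi * θ) * (rotv θ (Fs H z)).1.1.im - Real.sin (Real.pi * θ) * (rotv θ (Ft H z)).1.1.im,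
    (rotv θ (Fs H z)).2, (rotv θ (Ft H z)).2,
    Real.sin (Real.pi * θ) * (rotv θ (Fs H z)).1.1.im + Real.cos (Real.pi * θ) * (rotv θ (Ft H z)).1.1.im,
    (rotv θ (Ft H z)).1.1.re]

theorem GR_zero {θ : ℝ} {z : Fin 6 → ℝ} (h : GR H θ z = 0) :
    pair (rotv θ (Fs H z)) (rotv θ (Ft H z)) = 0 := by
  obtain ⟨a1, a2, a3, a4, a5, a6⟩ := vec6_zero h
  obtain ⟨b1, b2⟩ := rot_zero_iff a2 a5
  unfold pair
  rw [a1, b1, a3, a4, b2, a6]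
  funext i
  fin_cases i <;> rfl

theorem d_half (hc : Continuous (fun w : ℝ × (Fin 4 → ℝ) => H w.1 w.2)) (hne : ∀ u y, H u y ≠ 0)
    (hb : ∀ u y, (∃ i, y i ≤ 0 ∨ 1 ≤ y i) → H u y = ((1, 0), 0))
    (h1 : ∀ y, H 1 y = ((1, 0), 0))
    (h0 : ∀ y, 0 ≤ y 0 → y 0 ≤ 1 → (H 0 y).1.1.re = 0 → (H 0 y).2 = 0 → y 0 = 1 / 2) :
    ∀ᶠ m : ℕ in atTop,
      Dc m (fun z => pair (Fs H z) (Ft H z)) (fun z => min (rho (Fs H z) (Ft H z)) (z 2 - z 1)) =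
      Dc m (fun z => pair (Fs H z) (Ft H z)) (fun z => min (rho (Ft H z) (Fs H z)) (z 2 - z 1)) := by
  have cs := Fs_cont H hc
  have ct := Ft_cont H hc
  have rs : Continuous (fun q : ℝ × (Fin 6 → ℝ) => rotv q.1 (Fs H q.2)) :=
    rotv_cont continuous_fst (cs.comp continuous_snd)
  have rt : Continuous (fun q : ℝ × (Fin 6 → ℝ) => rotv q.1 (Ft H q.2)) :=
    rotv_cont continuous_fst (ct.comp continuous_snd)
  have := Dc_homotopy (GR H) (fun θ z => min (rho (rotv θ (Fs H z)) (rotv θ (Ft H z))) (z 2 - z 1))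
    (by
      have i1 := Complex.continuous_im.comp rs.fst.fst
      have i2 := Complex.continuous_im.comp rt.fst.fst
      have k1 : Continuous (fun q : ℝ × (Fin 6 → ℝ) => Real.cos (Real.pi * q.1)) := by fun_prop
      have k2 : Continuous (fun q : ℝ × (Fin 6 → ℝ) => Real.sin (Real.pi * q.1)) := by fun_prop
      exact vec6_cont (Complex.continuous_re.comp rs.fst.fst) ((k1.mul i1).sub (k2.mul i2)) rs.snd rt.snd
        ((k2.mul i1).add (k1.mul i2)) (Complex.continuous_re.comp rt.fst.fst))
    ((rho_cont rs rt).min (by fun_prop))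
    (fun θ _ _ z hz h => diag_ne H hne θ z (GR_zero H h))
    (fun θ _ _ z hz i hi h => (min_le_left _ _).trans_lt
      (diag_bd H hne hb h1 h0 θ z hz i hi (GR_zero H h)))
  filter_upwards [this] with m hm
  have e0 : GR H 0 = fun z => pair (Fs H z) (Ft H z) := by
    funext z
    simp [GR, rotv_zero, pair]
  have e1 : GR H 1 = fun z => pair (Fs H z) (Ft H z) := by
    funext z
    simp [GR, rotv_one, pair]
  have e2 : ∀ z, rho (rotv 1 (Fs H z)) (rotv 1 (Ft H z)) = rho (Ft H z) (Fs H z) := by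
    intro z
    simp only [rotv_one, rho, neg_neg]
    exact min_comm _ _
  rw [e0, e1] at hm
  simp only [rotv_zero, e2] at hm
  exact hm

theorem pair_rev (v v' : (ℂ × ℝ) × ℝ) : (fun i => pair v v' (Fin.revPerm i)) = pair v' v := by
  funext i
  fin_cases i <;> rfl

theorem Dc_split {n m : ℕ} (Γ : (Fin n → ℝ) → (Fin n → ℝ)) (ρ ρ₁ ρ₂ : (Fin n → ℝ) → ℝ)
    (h : ∀ y, 0 < ρ y ↔ (0 < ρ₁ y ∨ 0 < ρ₂ y)) (h' : ∀ y, ¬ (0 < ρ₁ y ∧ 0 < ρ₂ y)) :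
    Dc m Γ ρ = Dc m Γ ρ₁ + Dc m Γ ρ₂ := by
  unfold Dc D
  simp only [← Finset.sum_add_distrib]
  refine Finset.sum_congr rfl fun v _ => Finset.sum_congr rfl fun π _ => ?_
  have h1 := h' (pt m fun i => (v i : ℕ))
  have h2 := h (pt m fun i => (v i : ℕ))
  generalize (Function.Bijective _) = B
  simp only [ind]
  by_cases b0 : B <;> by_cases b1 : 0 < ρ₁ (pt m fun i => (v i : ℕ)) <;>
    by_cases b2 : 0 < ρ₂ (pt m fun i => (v i : ℕ)) <;> simp only [h2, b0, b1, b2] <;>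
    first | (exfalso; exact h1 ⟨by assumption, by assumption⟩) | simp

theorem d_zero (hc : Continuous (fun w : ℝ × (Fin 4 → ℝ) => H w.1 w.2)) (hne : ∀ u y, H u y ≠ 0)
    (hb : ∀ u y, (∃ i, y i ≤ 0 ∨ 1 ≤ y i) → H u y = ((1, 0), 0))
    (h1 : ∀ y, H 1 y = ((1, 0), 0))
    (h0 : ∀ y, 0 ≤ y 0 → y 0 ≤ 1 → (H 0 y).1.1.re = 0 → (H 0 y).2 = 0 → y 0 = 1 / 2) :
    ∀ᶠ m : ℕ in atTop,
      Dc m (fun z => pair (Fs H z) (Ft H z)) (fun z => rho (Fs H z) (Ft H z)) = 0 := by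
  have cs := Fs_cont H hc
  have ct := Ft_cont H hc
  -- reversed block order
  have tp := Dc_tgt_perm (fun z => pair (Fs H z) (Ft H z))
    (fun z => min (rho (Ft H z) (Fs H z)) (z 2 - z 1)) (pair_cont cs ct)
    ((rho_cont ct cs).min (by fun_prop))
    (by
      intro z hz h
      have h' : pair (rotv 1 (Fs H z)) (rotv 1 (Ft H z)) = 0 := by
        obtain ⟨a1, a2, a3, a4, a5, a6⟩ := vec6_zero h
        simp only [rotv_one, pair, a1, a2, a3, a4, a5, a6]
        funext i
        fin_cases i <;> simp
      have := diag_ne H hne 1 z h'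
      simp only [rotv_one, rho, neg_neg] at this
      rw [min_comm (-(Fs H z).1.2)] at this
      exact this)
    (by
      intro z hz i hi h
      have h' : pair (rotv 1 (Fs H z)) (rotv 1 (Ft H z)) = 0 := by
        obtain ⟨a1, a2, a3, a4, a5, a6⟩ := vec6_zero h
        simp only [rotv_one, pair, a1, a2, a3, a4, a5, a6]
        funext i
        fin_cases i <;> simp
      have := diag_bd H hne hb h1 h0 1 z hz i hi h'
      simp only [rotv_one, rho, neg_neg] at this
      rw [min_comm (-(Fs H z).1.2)] at this
      exact (min_le_left _ _).trans_lt this) Fin.revPerm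
  filter_upwards [d_half H hc hne hb h1 h0, tp] with m hm htp
  rw [Dc_split _ _ (fun z => min (rho (Fs H z) (Ft H z)) (z 2 - z 1))
    (fun z => min (rho (Fs H z) (Ft H z)) (z 1 - z 2)), hm]
  · have dp := Dc_dom_perm (m := m) (fun z => pair (Fs H z) (Ft H z))
      (fun z => min (rho (Fs H z) (Ft H z)) (z 1 - z 2)) (Equiv.swap 1 2)
    have es : ∀ z : Fin 6 → ℝ, Fs H (fun i => z (Equiv.swap 1 2 i)) = Ft H z := by
      intro z; rfl
    have et : ∀ z : Fin 6 → ℝ, Ft H (fun i => z (Equiv.swap 1 2 i)) = Fs H z := by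
      intro z; rfl
    simp only [es, et, Equiv.swap_apply_left, Equiv.swap_apply_right] at dp
    have er : (fun y i => pair (Fs H y) (Ft H y) (Fin.revPerm i)) = fun y => pair (Ft H y) (Fs H y) :=
      funext fun y => pair_rev _ _
    rw [er] at htp
    rw [← dp, htp]
    exact z2_add_self _
  · intro z
    simp only [lt_min_iff]
    constructor
    · intro h
      rcases lt_trichotomy (z 1) (z 2) with h' | h' | h'
      · exact Or.inl ⟨h, by linarith⟩
      · exfalso
        have e2 : Fs H z = Ft H z := by unfold Fs Ft; rw [h']
        rw [e2] at h
        exact absurd h (not_lt.2 (rho_self_le _))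
      · exact Or.inr ⟨h, by linarith⟩
    · rintro (h | h) <;> exact h.1
  · intro z
    simp only [lt_min_iff]
    rintro ⟨⟨_, a⟩, _, b⟩
    linarith

end diag

end Pi4
end

open scoped unitInterval Topology Topology.Homotopy
open Set
open Filter
set_option linter.unusedSectionVars false
noncomputable section
namespace Pi4

/-! ### M8d : the suspension of the Hopf element is nontrivial -/

theorem D_congr {n m : ℕ} {l l' : (Fin n → ℕ) → Fin (n + 1)} {pos pos' : (Fin n → ℕ) → Prop}
    (h : ∀ w, (∀ i, w i ≤ m) → l w = l' w) (h' : ∀ w, (∀ i, w i ≤ m) → (pos w ↔ pos' w)) :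
    D m l pos = D m l' pos' := by
  unfold D
  refine Finset.sum_congr rfl fun v _ => Finset.sum_congr rfl fun π _ => ind_congr ?_
  have e : (fun j : Fin (n + 1) => l (vtx (fun i => (v i : ℕ)) π j)) =
      fun j : Fin (n + 1) => l' (vtx (fun i => (v i : ℕ)) π j) :=
    funext fun j => h _ (vtx_le v π j)
  rw [e, h' _ (fun i => (v i).2.le)]

theorem abs_big {z : ℝ} (h : z ≤ 0 ∨ 1 ≤ z) : 1 ≤ |2 * z - 1| := by
  rcases h with h | h
  · exact le_abs.2 (Or.inr (by linarith))
  · exact le_abs.2 (Or.inl (by linarith))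

/-- the formula of the explicit loop -/
def ffl (x : Fin 3 → ℝ) : ℂ × ℝ := ff (2 * x 0 - 1) (2 * x 1 - 1) (2 * x 2 - 1)

theorem ffl_cont : Continuous ffl :=
  ff_cont.comp (f := fun y : Fin 3 → ℝ => (2 * y 0 - 1, 2 * y 1 - 1, 2 * y 2 - 1)) (by fun_prop)

theorem ffl_bd {x : Fin 3 → ℝ} (h : ∃ i, x i ≤ 0 ∨ 1 ≤ x i) : ffl x = (1, 0) := by
  obtain ⟨i, h⟩ := h
  have := abs_big h
  apply ff_one
  fin_cases i
  · exact Or.inl this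
  · exact Or.inr (Or.inl this)
  · exact Or.inr (Or.inr this)

def hl : GenLoop (Fin 3) (P (ℂ × ℝ)) (sb b1) :=
  mk (sb b1) ffl ffl_cont (fun y _ => ff_ne _ _ _) (by
    rintro y _ ⟨i, h⟩
    rw [sb_b1]
    exact ffl_bd ⟨i, h.imp (fun h => h.le) (fun h => h.ge)⟩)

theorem ext_hl (x : Fin 3 → ℝ) : ext hl x = ffl x := by
  by_cases h : ∃ i, x i ≤ 0 ∨ 1 ≤ x i
  · rw [ext_bd _ h, ffl_bd h, sb_b1]
  · push Not at h
    exact ext_mk _ _ _ _ _ (fun i => ⟨(h i).1.le, (h i).2.le⟩)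

theorem sb_sb_b1 : (sb (sb b1)).1 = (((1 : ℂ), (0 : ℝ)), (0 : ℝ)) := by
  show ((sb b1).1, (0 : ℝ)) = _
  rw [sb_b1]

theorem ext_susp_hl (y : Fin 4 → ℝ) (h0 : 0 ≤ y 0) (h1 : y 0 ≤ 1) :
    ext (suspL hl) y = susp (1, 0) (ff (2 * y 1 - 1) (2 * y 2 - 1) (2 * y 3 - 1)) (y 0) := by
  unfold ext
  rw [suspL_apply, sb_b1]
  have e1 : ((clamp y 0 : I) : ℝ) = y 0 := by
    simp only [clamp]
    rw [Set.projIcc_of_mem zero_le_one ⟨h0, h1⟩]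
  have e2 : (hl (fun i => clamp y i.succ)).1 = ffl (fun i => y i.succ) := ext_hl (fun i => y i.succ)
  rw [e1, e2]
  rfl

theorem pair_base_left {v v' : (ℂ × ℝ) × ℝ} (hv : v = ((1, 0), 0)) : pair v v' ≠ 0 := by
  intro h
  have := (pair_zero h).1
  rw [hv] at this
  exact one_ne_zero this

theorem pair_base_right {v v' : (ℂ × ℝ) × ℝ} (hv : v' = ((1, 0), 0)) : pair v v' ≠ 0 := by
  intro h
  have := (pair_zero h).2.2.1
  rw [hv] at this
  exact one_ne_zero this

section big
variable (H : ℝ → (Fin 4 → ℝ) → (ℂ × ℝ) × ℝ)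

def Bs (y : Fin 7 → ℝ) : (ℂ × ℝ) × ℝ := H (y 1) ![y 2, y 4, y 5 - y 0, y 6]
def Bt (y : Fin 7 → ℝ) : (ℂ × ℝ) × ℝ := H (y 1) ![y 3, y 4, y 5, y 6]

theorem big_stokes (hc : Continuous (fun w : ℝ × (Fin 4 → ℝ) => H w.1 w.2)) (hne : ∀ u y, H u y ≠ 0)
    (hb : ∀ u y, (∃ i, y i ≤ 0 ∨ 1 ≤ y i) → H u y = ((1, 0), 0))
    (h1 : ∀ y, H 1 y = ((1, 0), 0)) :
    ∀ᶠ m : ℕ in atTop,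
      Dc m (fun z => pair (Fs H z) (Ft H z)) (fun z => rho (Fs H z) (Ft H z)) =
      Dc m (fun z => pair (H 0 ![z 1, z 3, z 4 - z 0, z 5]) (H 0 ![z 2, z 3, z 4, z 5]))
        (fun z => rho (H 0 ![z 1, z 3, z 4 - z 0, z 5]) (H 0 ![z 2, z 3, z 4, z 5])) := by
  have cs : Continuous (Bs H) := hc.comp (f := fun y : Fin 7 → ℝ => (y 1, ![y 2, y 4, y 5 - y 0, y 6]))
    ((continuous_apply 1).prodMk (vec4_cont (by fun_prop) (by fun_prop) (by fun_prop) (by fun_prop)))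
  have ct : Continuous (Bt H) := hc.comp (f := fun y : Fin 7 → ℝ => (y 1, ![y 3, y 4, y 5, y 6]))
    ((continuous_apply 1).prodMk (vec4_cont (by fun_prop) (by fun_prop) (by fun_prop) (by fun_prop)))
  have st := stokes_two (fun y => pair (Bs H y) (Bt H y)) (fun y => rho (Bs H y) (Bt H y))
    (pair_cont cs ct) (rho_cont cs ct) (fun y _ h => rho_ne h (hne _ _) (hne _ _))
    ((0 : Fin 7), false) ((1 : Fin 7), false) (by simp) (by
      rintro y hy ⟨i, b⟩ n1 n2 e h
      exfalso
      have e' : y i ≤ 0 ∨ 1 ≤ y i := by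
        cases b
        · left; simpa using e.le
        · right; simpa using e.ge
      simp only [ne_eq, Prod.mk.injEq, not_and] at n1 n2
      fin_cases i
      · have : b = true := by simpa using n1
        have e3 : y 0 = 1 := by simpa [this] using e
        refine pair_base_left (hb _ _ ⟨2, Or.inl ?_⟩) h
        have := (hy 5).2
        simp only [Matrix.cons_val]
        linarith
      · have : b = true := by simpa using n2
        have e3 : y 1 = 1 := by simpa [this] using e
        refine pair_base_left ?_ h
        unfold Bs
        rw [e3, h1]
      · exact pair_base_left (hb _ _ ⟨0, e'⟩) h
      · exact pair_base_right (hb _ _ ⟨0, e'⟩) h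
      · exact pair_base_right (hb _ _ ⟨1, e'⟩) h
      · exact pair_base_right (hb _ _ ⟨2, e'⟩) h
      · exact pair_base_right (hb _ _ ⟨3, e'⟩) h)
  filter_upwards [st, eventually_gt_atTop 0] with m hm hm0
  have := hm (fun v => lab (pair (Bs H (pt m v)) (Bt H (pt m v)))) (fun v _ => lab_valid _)
  simp only [pt_face hm0] at this
  have r1 : ∀ z : Fin 6 → ℝ, Bs H (rface ((0 : Fin 7), false) z) = Fs H z := by
    intro z
    show H (z 0) ![z 1, z 3, z 4 - (if false = true then 1 else 0), z 5] = H (z 0) ![z 1, z 3, z 4, z 5]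
    simp
  have r2 : ∀ z : Fin 6 → ℝ, Bt H (rface ((0 : Fin 7), false) z) = Ft H z := fun z => rfl
  have r3 : ∀ z : Fin 6 → ℝ, Bs H (rface ((1 : Fin 7), false) z) = H 0 ![z 1, z 3, z 4 - z 0, z 5] := by
    intro z
    show H (if false = true then 1 else 0) ![z 1, z 3, z 4 - z 0, z 5] = _
    simp
  have r4 : ∀ z : Fin 6 → ℝ, Bt H (rface ((1 : Fin 7), false) z) = H 0 ![z 2, z 3, z 4, z 5] := by
    intro z
    show H (if false = true then 1 else 0) ![z 2, z 3, z 4, z 5] = _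
    simp
  simp only [r1, r2, r3, r4] at this
  exact this

end big

theorem susp_hl_ne : cls (suspL hl) ≠ 1 := by
  intro h
  rw [← cls_const, cls_eq] at h
  obtain ⟨H, hc, hne, hb, e0, e1⟩ := homotopic_ext h
  rw [sb_sb_b1] at hb
  have h1 : ∀ y, H 1 y = ((1, 0), 0) := by
    intro y
    rw [e1 1 le_rfl y, ← sb_sb_b1]
    rfl
  have h0 : ∀ y, 0 ≤ y 0 → y 0 ≤ 1 → (H 0 y).1.1.re = 0 → (H 0 y).2 = 0 → y 0 = 1 / 2 := by
    intro y a b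
    rw [e0 0 le_rfl, ext_susp_hl y a b, ← sv_zero]
    exact sv_eq_zero le_rfl zero_le_one a b
  obtain ⟨m, hm1, hm2, hm3⟩ := ((big_stokes H hc hne hb h1).and
    ((d_zero H hc hne hb h1 h0).and e_one)).exists
  rw [hm2] at hm1
  have key : ∀ z : Fin 6 → ℝ, z ∈ Q 6 → H 0 ![z 1, z 3, z 4 - z 0, z 5] = susp (1, 0) (W' z) (z 1) ∧
      H 0 ![z 2, z 3, z 4, z 5] = susp (1, 0) (W z) (z 2) := by
    intro z hz
    constructor
    · rw [e0 0 le_rfl, ext_susp_hl _ (hz 1).1 (hz 1).2]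
      simp only [Matrix.cons_val, W']
      congr 2
      ring
    · rw [e0 0 le_rfl, ext_susp_hl _ (hz 2).1 (hz 2).2]
      rfl
  have : (0 : ZMod 2) = 1 := by
    rw [hm1, ← hm3]
    unfold Dc
    apply D_congr
    · intro w hw
      simp only [key _ (pt_mem w hw)]
    · intro w hw
      simp only [key _ (pt_mem w hw)]
  exact zero_ne_one this

theorem gen4_ne : gen4 ≠ 1 := by
  intro h
  rcases pi4_S3_cases (cls (suspL hl)) with h' | h'
  · exact susp_hl_ne h'
  · exact susp_hl_ne (h'.trans h)

end Pi4
end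

open scoped unitInterval Topology Topology.Homotopy
open Set
set_option linter.unusedSectionVars false
noncomputable section
namespace Pi4

/-! ### M9 : conclusion -/

theorem card_pi4 : Nat.card (HomotopyGroup (Fin 4) (P (ℂ × ℝ)) (sb b1)) = 2 := by
  rw [← Nat.card_congr (Equiv.ofBijective _ toS2_bij), Nat.card_eq_two_iff]
  refine ⟨1, gen4, gen4_ne.symm, ?_⟩
  ext a
  simpa using pi4_S3_cases a

theorem exists_lin (N : EuclideanSpace ℝ (Fin 3)) (hN : N ≠ 0) :
    ∃ L : EuclideanSpace ℝ (Fin 3) ≃L[ℝ] (ℂ × ℝ), L N = (1, 0) := by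
  have e : Module.finrank ℝ (EuclideanSpace ℝ (Fin 3)) = Module.finrank ℝ (ℂ × ℝ) := by
    simp [Complex.finrank_real_complex]
  let L0 : EuclideanSpace ℝ (Fin 3) ≃L[ℝ] (ℂ × ℝ) := ContinuousLinearEquiv.ofFinrankEq e
  have h0 : L0 N ≠ 0 := by simpa using hN
  have h1 : ((1 : ℂ), (0 : ℝ)) ≠ 0 := by simp
  obtain ⟨A, hA⟩ := SeparatingDual.exists_continuousLinearEquiv_apply_eq (R := ℝ) h0 h1
  exact ⟨L0.trans A, hA⟩

theorem sphere_bij (N : Metric.sphere (0 : EuclideanSpace ℝ (Fin 3)) 1) :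
    ∃ φ : HomotopyGroup (Fin 4) (Metric.sphere (0 : EuclideanSpace ℝ (Fin 3)) 1) N →*
      HomotopyGroup (Fin 4) (P (ℂ × ℝ)) (sb b1), Function.Bijective φ := by
  have nz : ∀ v : Metric.sphere (0 : EuclideanSpace ℝ (Fin 3)) 1, v.1 ≠ 0 :=
    fun v => ne_zero_of_mem_unit_sphere v
  obtain ⟨L, hL⟩ := exists_lin N.1 (nz N)
  have ln : ∀ w : P (ℂ × ℝ), 0 < ‖L.symm w.1‖ := by
    intro w
    rw [norm_pos_iff]
    simpa using w.2
  have lc : Continuous fun w : P (ℂ × ℝ) => ‖L.symm w.1‖⁻¹ :=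
    Continuous.inv₀ (by fun_prop) (fun w => (ln w).ne')
  let i : C(Metric.sphere (0 : EuclideanSpace ℝ (Fin 3)) 1, P (ℂ × ℝ)) :=
    ⟨fun v => ⟨L v.1, by simpa using nz v⟩, by fun_prop⟩
  let r : C(P (ℂ × ℝ), Metric.sphere (0 : EuclideanSpace ℝ (Fin 3)) 1) :=
    ⟨fun w => ⟨‖L.symm w.1‖⁻¹ • L.symm w.1, by
      rw [mem_sphere_zero_iff_norm, norm_smul, norm_inv, norm_norm]
      exact inv_mul_cancel₀ (ln w).ne'⟩, by
      apply Continuous.subtype_mk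
      exact lc.smul (by fun_prop)⟩
  have nv : ∀ v : Metric.sphere (0 : EuclideanSpace ℝ (Fin 3)) 1, ‖v.1‖ = 1 :=
    fun v => mem_sphere_zero_iff_norm.1 v.2
  have ri : ∀ v, r (i v) = v := by
    intro v
    apply Subtype.ext
    show ‖L.symm (L v.1)‖⁻¹ • L.symm (L v.1) = v.1
    rw [L.symm_apply_apply, nv v, inv_one, one_smul]
  have hi : i N = sb b1 := by
    apply Subtype.ext
    rw [sb_b1]
    exact hL
  have hr : r (sb b1) = N := by rw [← hi, ri]
  have hs : L.symm (sb b1).1 = N.1 := by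
    rw [sb_b1, ← hL, L.symm_apply_apply]
  refine ⟨pimap i hi, ?_⟩
  let H : C(I × P (ℂ × ℝ), P (ℂ × ℝ)) :=
    ⟨fun q => ⟨((1 - (q.1 : ℝ)) * ‖L.symm q.2.1‖⁻¹ + q.1) • q.2.1, by
      refine smul_ne_zero ?_ q.2.2
      have h1 := inv_pos.2 (ln q.2)
      have h2 := q.1.2.1
      have h3 := q.1.2.2
      rcases h2.eq_or_lt with h | h
      · rw [← h]; simpa using (ln q.2).ne'
      · have := mul_nonneg (sub_nonneg.2 h3) h1.le
        exact (add_pos_of_nonneg_of_pos this h).ne'⟩, by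
      apply Continuous.subtype_mk
      have := lc.comp (continuous_snd (X := I))
      exact (((by fun_prop : Continuous fun q : I × P (ℂ × ℝ) => 1 - (q.1 : ℝ)).mul this).add
        (by fun_prop)).smul (by fun_prop)⟩
  constructor
  · intro a b hab
    have : ∀ a : HomotopyGroup (Fin 4) (Metric.sphere (0 : EuclideanSpace ℝ (Fin 3)) 1) N,
        pimap r hr (pimap i hi a) = a := by
      intro a
      obtain ⟨p, rfl⟩ := cls_surj a
      rw [pimap_cls, pimap_cls]
      congr 1
      ext1 t
      exact ri _
    rw [← this a, ← this b, hab]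
  · intro a
    refine ⟨pimap r hr a, ?_⟩
    rw [pimap_comp]
    refine (pimap_congr (i.comp r) (ContinuousMap.id _) _ rfl H ?_ ?_ ?_ a).trans ?_
    · intro w
      apply Subtype.ext
      show ((1 - ((0 : I) : ℝ)) * ‖L.symm w.1‖⁻¹ + ((0 : I) : ℝ)) • w.1 = L (‖L.symm w.1‖⁻¹ • L.symm w.1)
      rw [map_smul, L.apply_symm_apply]
      simp
    · intro w
      apply Subtype.ext
      show ((1 - ((1 : I) : ℝ)) * ‖L.symm w.1‖⁻¹ + ((1 : I) : ℝ)) • w.1 = w.1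
      simp
    · intro u
      apply Subtype.ext
      show ((1 - (u : ℝ)) * ‖L.symm (sb b1).1‖⁻¹ + (u : ℝ)) • (sb b1).1 = (sb b1).1
      rw [hs, nv N]
      simp
    · obtain ⟨p, rfl⟩ := cls_surj a
      rfl

end Pi4
end

/-- The fourth homotopy group of the 2-sphere is cyclic of order two: `π₄(S², N) ≅ ℤ/2ℤ`. -/
theorem pi4_sphere2_iso_zmod2 (N : Metric.sphere (0 : EuclideanSpace ℝ (Fin 3)) 1) :
    Nonempty
      (HomotopyGroup (Fin 4) (Metric.sphere (0 : EuclideanSpace ℝ (Fin 3)) 1) N ≃*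
        Multiplicative (ZMod 2)) := by
  obtain ⟨φ, hφ⟩ := Pi4.sphere_bij N
  have h1 : Nat.card (HomotopyGroup (Fin 4) (Metric.sphere (0 : EuclideanSpace ℝ (Fin 3)) 1) N) = 2 := by
    rw [Nat.card_congr (Equiv.ofBijective φ hφ), Pi4.card_pi4]
  have h2 : Nat.card (Multiplicative (ZMod 2)) = 2 := by simp
  haveI : Fact (Nat.Prime 2) := ⟨Nat.prime_two⟩
  exact ⟨mulEquivOfPrimeCardEq h1 h2⟩
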